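/- Let X ⊂ P^4 be an integral nondegenerate surface of degree 3 with only isolated singularities (a minimal degree surface). Then X is of type A, and X is of type II (reducible general entry locus) if and only if X is a cone. -/

import Mathlib

open MvPolynomial

noncomputable section

namespace EL

variable {k : Type} [Field k] {n : ℕ}

/-- Projective space of (vector) dimension `n` over `k`. -/
abbrev PS (k : Type) [Field k] (n : ℕ) : Type := Projectivization k (Fin n → k)

/-- Projective vanishing set of a polynomial (intended to be homogeneous). -/
def V0 (f : MvPolynomial (Fin n) k) : Set (PS k n) :=
  {p | ∀ (v : Fin n → k) (hv : v ≠ 0), Projectivization.mk k v hv = p → eval v f = 0}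

/-- The Zariski topology on projective space, generated by complements of vanishing
sets of homogeneous polynomials. -/
instance : TopologicalSpace (PS k n) :=
  TopologicalSpace.generateFrom
    {U | ∃ (d : ℕ) (f : MvPolynomial (Fin n) k), f.IsHomogeneous d ∧ U = (V0 f)ᶜ}

/-- The linear span (as a submodule of the cone) of a set of projective points. -/
def pspan (S : Set (PS k n)) : Submodule k (Fin n → k) := ⨆ p ∈ S, p.submodule

/-- The projective linear subspace associated to a submodule. -/
def linSet (W : Submodule k (Fin n → k)) : Set (PS k n) := {p | p.submodule ≤ W}

/-- `q` lies in the projective span of `S`. -/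
def memSpan (q : PS k n) (S : Set (PS k n)) : Prop := q.submodule ≤ pspan S

/-- The projective dimension of the span of `S`. -/
def spanDim (S : Set (PS k n)) : ℕ := Module.finrank k ↥(pspan S) - 1

/-- `S` is nondegenerate (spans the ambient projective space). -/
def Nondeg (S : Set (PS k n)) : Prop := pspan S = ⊤

/-- `S` is a projective linear subspace of projective dimension `d`. -/
def IsLin (S : Set (PS k n)) (d : ℕ) : Prop :=
  ∃ W : Submodule k (Fin n → k), Module.finrank k ↥W = d + 1 ∧ S = linSet W

/-- Dimension of a subset, as topological Krull dimension. -/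
def pdim (S : Set (PS k n)) : WithBot ℕ∞ := topologicalKrullDim ↥S

/-- An integral (sub)variety: an irreducible Zariski-closed set. -/
def IsVariety (S : Set (PS k n)) : Prop := IsClosed S ∧ IsIrreducible S

/-- A property holds for a general point of projective space. -/
def Generic (P : PS k n → Prop) : Prop :=
  ∃ U : Set (PS k n), IsOpen U ∧ Dense U ∧ ∀ q ∈ U, P q

/-- A property holds for a general point of the set `S`. -/
def GenericIn (S : Set (PS k n)) (P : PS k n → Prop) : Prop :=
  ∃ U : Set (PS k n), IsOpen U ∧ S ⊆ closure (S ∩ U) ∧ ∀ q ∈ S ∩ U, P q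

/-- A property holds for a general tuple of points of projective space. -/
def GenericP {ι : Type} (P : (ι → PS k n) → Prop) : Prop :=
  ∃ U : Set (ι → PS k n), IsOpen U ∧ Dense U ∧ ∀ z ∈ U, P z

/-- `q` is spanned by some `s` points of `X`. -/
def hasDecomp (X : Set (PS k n)) (q : PS k n) (s : ℕ) : Prop :=
  ∃ A : Finset (PS k n), ↑A ⊆ X ∧ A.card = s ∧ memSpan q ↑A

/-- The `X`-rank of a point `q`. -/
def rk (X : Set (PS k n)) (q : PS k n) : ℕ := sInf {s | hasDecomp X q s}

/-- `A` irredundantly spans `q`. -/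
def Irredundant (q : PS k n) (A : Finset (PS k n)) : Prop :=
  memSpan q ↑A ∧ ∀ B : Finset (PS k n), B ⊂ A → ¬ memSpan q ↑B

/-- The set `𝒮(X,q)` of minimal irredundant decompositions of `q` by points of `X`. -/
def decomps (X : Set (PS k n)) (q : PS k n) : Set (Finset (PS k n)) :=
  {A | ↑A ⊆ X ∧ A.card = rk X q ∧ Irredundant q A}

/-- The entry locus of `q` with respect to `X`. -/
def entryLocus (X : Set (PS k n)) (q : PS k n) : Set (PS k n) :=
  closure (⋃ A ∈ decomps X q, (↑A : Set (PS k n)))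

/-- The `s`-th secant variety of `X`. -/
def secant (X : Set (PS k n)) (s : ℕ) : Set (PS k n) :=
  closure {q | hasDecomp X q s}

/-- The generic `X`-rank: least `s` whose secant fills the span of `X`. -/
def rgen (X : Set (PS k n)) : ℕ := sInf {s | secant X s = linSet (pspan X)}

/-- Type I: the general entry locus is irreducible. -/
def TypeI (X : Set (PS k n)) : Prop := Generic (fun q => IsIrreducible (entryLocus X q))

/-- Type II: the general entry locus is reducible. -/
def TypeII (X : Set (PS k n)) : Prop := Generic (fun q => ¬ IsIrreducible (entryLocus X q))

/-- Type A: the entry locus does not change at a general point of its span. -/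
def TypeA (X : Set (PS k n)) : Prop :=
  Generic (fun q => GenericIn (linSet (pspan (entryLocus X q)))
    (fun o => entryLocus X o = entryLocus X q))

/-- `S` (of dimension `m`) has degree `d`: `d` is the largest finite number of points cut
on `S` by a linear subspace of complementary dimension. -/
def HasDegree (S : Set (PS k n)) (m d : ℕ) : Prop :=
  IsGreatest {t | ∃ L : Set (PS k n), IsLin L (n - 1 - m) ∧ (S ∩ L).Finite ∧
    (S ∩ L).ncard = t} d

/-- All secant varieties of `Y` (of dimension `m`) have the expected dimension. -/
def NonDefective (Y : Set (PS k n)) (m : ℕ) : Prop :=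
  ∀ s : ℕ, 1 ≤ s →
    pdim (secant Y s) = ((min ((m+1)*s - 1) (spanDim Y) : ℕ) : WithBot ℕ∞)

/-- `π_o(T) ⊆ π_o(Y)`: every point of `T` (other than `o`) is collinear with `o`
and a point of `Y`. -/
def projLE (o : PS k n) (T Y : Set (PS k n)) : Prop :=
  ∀ t ∈ T, t ≠ o → ∃ y ∈ Y, t.submodule ≤ o.submodule ⊔ y.submodule

/-- A Segre point of the pair `(Y,T)`: projection from `o` maps `Y` and `T`
onto the same set. -/
def SegrePtPair (Y T : Set (PS k n)) (o : PS k n) : Prop :=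
  o ∉ Y ∪ T ∧ projLE o Y T ∧ projLE o T Y

/-- A Segre point of `Y`: the projection from `o` is non-birational on `Y`
(it is not generically injective). -/
def SegrePt (Y : Set (PS k n)) (o : PS k n) : Prop :=
  o ∉ Y ∧ ¬ GenericIn Y (fun y => ∀ y' ∈ Y, y'.submodule ≤ o.submodule ⊔ y.submodule → y' = y)

/-- The Segre locus of `Y`. -/
def segreLocus (Y : Set (PS k n)) : Set (PS k n) := closure {o | SegrePt Y o}

/-- `X` is a cone with vertex `v`. -/
def IsCone (X : Set (PS k n)) (v : PS k n) : Prop :=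
  ∀ p ∈ X, ∀ q : PS k n, q.submodule ≤ v.submodule ⊔ p.submodule → q ∈ X

/-- The homogeneous polynomials vanishing on `X`. -/
def homogCut (X : Set (PS k n)) : Set (MvPolynomial (Fin n) k) :=
  {f | (∃ d, f.IsHomogeneous d) ∧ X ⊆ V0 f}

/-- The span of the gradients at `p` of homogeneous polynomials vanishing on `X`. -/
def gradSpan (X : Set (PS k n)) (p : PS k n) : Submodule k (Fin n → k) :=
  Submodule.span k ((fun f => fun i => eval p.rep (pderiv i f)) '' homogCut X)

/-- Smoothness at a point of an `m`-dimensional subvariety (Jacobian criterion). -/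
def IsSmoothPt (X : Set (PS k n)) (m : ℕ) (p : PS k n) : Prop :=
  Module.finrank k ↥(gradSpan X p) = n - (m + 1)

/-- `X` (of dimension `m`) has only isolated singularities. -/
def IsolatedSings (X : Set (PS k n)) (m : ℕ) : Prop :=
  {p ∈ X | ¬ IsSmoothPt X m p}.Finite

/-- `X` (of dimension `m`) is smooth. -/
def IsSmoothVar (X : Set (PS k n)) (m : ℕ) : Prop := ∀ p ∈ X, IsSmoothPt X m p

/-- The hyperplane (as a submodule) determined by a point of the dual projective space. -/
def hypSub (a : PS k n) : Submodule k (Fin n → k) :=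
  LinearMap.ker (∑ i, a.rep i • (LinearMap.proj i : (Fin n → k) →ₗ[k] k))

/-- The hyperplane determined by a point of the dual projective space. -/
def hypOf (a : PS k n) : Set (PS k n) := linSet (hypSub a)

/-- The (geometric) genus of a space curve `C`, defined by the node count of a
projection from a general point of its span: a general point of `⟨C⟩` lies on
`(d-1)(d-2)/2 - g` secant lines of `C`. -/
def HasGenus (C : Set (PS k n)) (g : ℕ) : Prop :=
  ∃ d : ℕ, HasDegree C 1 d ∧
    GenericIn (linSet (pspan C)) (fun q =>
      2 * (decomps C q).ncard + 2 * g + 3 * d = d * d + 2)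

/-- The embedded tangent space of `X` at `p` (as a submodule of the cone). -/
def tangentSub (X : Set (PS k n)) (p : PS k n) : Submodule k (Fin n → k) :=
  ⨅ f ∈ homogCut X,
    LinearMap.ker (∑ i, (eval p.rep (pderiv i f)) • (LinearMap.proj i : (Fin n → k) →ₗ[k] k))

/-- A curve is tangentially degenerate if its general tangent line meets the
curve elsewhere. -/
def TangDeg (X : Set (PS k n)) : Prop :=
  GenericIn {p ∈ X | IsSmoothPt X 1 p}
    (fun p => ∃ y ∈ X, y ≠ p ∧ y.submodule ≤ tangentSub X p)

/-- The homogeneous ideal of `X`. -/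
def projIdeal (X : Set (PS k n)) : Ideal (MvPolynomial (Fin n) k) :=
  Ideal.span {f | X ⊆ V0 f}

/-- `X` is a normal variety: its homogeneous coordinate ring is integrally closed
in its total fraction ring. -/
def IsNormalVar (X : Set (PS k n)) : Prop :=
  ∀ x : FractionRing (MvPolynomial (Fin n) k ⧸ projIdeal X),
    IsIntegral (MvPolynomial (Fin n) k ⧸ projIdeal X) x →
      ∃ y : MvPolynomial (Fin n) k ⧸ projIdeal X,
        algebraMap (MvPolynomial (Fin n) k ⧸ projIdeal X)
          (FractionRing (MvPolynomial (Fin n) k ⧸ projIdeal X)) y = x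

/-- `C` is an irreducible component of `Y`. -/
def IsCompOf (C Y : Set (PS k n)) : Prop :=
  Maximal (fun Z => Z ⊆ Y ∧ IsIrreducible Z) C

/-- The image of `X` under the linear projection from (the linear space of) `W`,
realized inside the complementary linear space of `Λ`. -/
def projFrom (W Λ : Submodule k (Fin n → k)) (X : Set (PS k n)) : Set (PS k n) :=
  {y | y.submodule ≤ Λ ∧ ∃ x ∈ X, y.submodule ≤ W ⊔ x.submodule}

/-- Decompositions of `q` as irredundant spans of one point from each `Xs i`. -/
def tupleDecomps {s : ℕ} (Xs : Fin s → Set (PS k n)) (q : PS k n) :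
    Set (Fin s → PS k n) :=
  {p | (∀ i, p i ∈ Xs i) ∧ Function.Injective p ∧ memSpan q (Set.range p) ∧
    ∀ i, ¬ memSpan q (Set.range p \ {p i})}

/-- The entry locus of `q` with respect to the tuple of varieties `Xs`. -/
def entryLocusT {s : ℕ} (Xs : Fin s → Set (PS k n)) (q : PS k n) : Set (PS k n) :=
  closure (⋃ p ∈ tupleDecomps Xs q, Set.range p)

/-- The join of the varieties `Xs`. -/
def joinT {s : ℕ} (Xs : Fin s → Set (PS k n)) : Set (PS k n) :=
  closure {q | ∃ p : Fin s → PS k n, (∀ i, p i ∈ Xs i) ∧ memSpan q (Set.range p)}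

/-- Relation `q = F(p)` for a tuple `F` of homogeneous polynomials of the same degree. -/
def polyMapRel {N M : ℕ} (F : Fin M → MvPolynomial (Fin N) k) (p : PS k N) (q : PS k M) :
    Prop :=
  q.submodule = Submodule.span k {fun j => eval p.rep (F j)}

/-- `A` and `B` are isomorphic via mutually inverse polynomial maps. -/
def IsPolyIso {N M : ℕ} (A : Set (PS k N)) (B : Set (PS k M)) : Prop :=
  ∃ (d e : ℕ) (F : Fin M → MvPolynomial (Fin N) k) (G : Fin N → MvPolynomial (Fin M) k),
    (∀ j, (F j).IsHomogeneous d) ∧ (∀ i, (G i).IsHomogeneous e) ∧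
    (∀ p ∈ A, ∃ q ∈ B, polyMapRel F p q ∧ polyMapRel G q p) ∧
    (∀ q ∈ B, ∃ p ∈ A, polyMapRel F p q ∧ polyMapRel G q p)

/-- `A` and `B` are birational: polynomially isomorphic on dense open subsets. -/
def Birational (A B : Set (PS k n)) : Prop :=
  ∃ U V : Set (PS k n), IsOpen U ∧ IsOpen V ∧
    A ⊆ closure (A ∩ U) ∧ B ⊆ closure (B ∩ V) ∧ IsPolyIso (A ∩ U) (B ∩ V)

/-- A finite set `S` imposes independent conditions on hypersurfaces of degree `i`. -/
def ImposesIndep (S : Finset (PS k n)) (i : ℕ) : Prop :=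
  Function.Surjective (fun f : ↥(homogeneousSubmodule (Fin n) k i) =>
    fun p : ↥(↑S : Set (PS k n)) => eval (↑p : PS k n).rep (↑f : MvPolynomial (Fin n) k))

end EL

namespace EL

section Topology
variable {k : Type} [Field k] {n : ℕ}

theorem eval_smul_of_isHomogeneous {d : ℕ} {f : MvPolynomial (Fin n) k} (hf : f.IsHomogeneous d)
    (c : k) (v : Fin n → k) : eval (c • v) f = c ^ d * eval v f := by
  rw [eval_eq, eval_eq, Finset.mul_sum]
  refine Finset.sum_congr rfl fun m hm => ?_
  have h1 : ∑ i ∈ m.support, m i = d := by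
    have := hf (mem_support_iff.mp hm)
    simpa [Finsupp.weight_apply, Finsupp.sum] using this
  simp only [Pi.smul_apply, smul_eq_mul, mul_pow, Finset.prod_mul_distrib]
  rw [Finset.prod_pow_eq_pow_sum, h1]; ring

theorem mk_mem_V0_iff {d : ℕ} {f : MvPolynomial (Fin n) k} (hf : f.IsHomogeneous d)
    {v : Fin n → k} (hv : v ≠ 0) : Projectivization.mk k v hv ∈ V0 f ↔ eval v f = 0 := by
  constructor
  · intro h; exact h v hv rfl
  · intro h w hw e
    obtain ⟨c, rfl⟩ := (Projectivization.mk_eq_mk_iff' k w v hw hv).mp e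
    rw [eval_smul_of_isHomogeneous hf, h, mul_zero]

theorem isClosed_V0 {d : ℕ} {f : MvPolynomial (Fin n) k} (hf : f.IsHomogeneous d) :
    IsClosed (V0 f) :=
  ⟨TopologicalSpace.isOpen_generateFrom_of_mem ⟨d, f, hf, rfl⟩⟩

/-- Complements of hypersurfaces form a basis of the Zariski topology. -/
theorem exists_V0_compl_subset {U : Set (PS k n)} (hU : IsOpen U) {v : Fin n → k} (hv : v ≠ 0)
    (h : Projectivization.mk k v hv ∈ U) :
    ∃ (d : ℕ) (f : MvPolynomial (Fin n) k), f.IsHomogeneous d ∧ eval v f ≠ 0 ∧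
      ∀ (w : Fin n → k) (hw : w ≠ 0), eval w f ≠ 0 → Projectivization.mk k w hw ∈ U := by
  induction hU with
  | basic s hs =>
    obtain ⟨d, f, hf, rfl⟩ := hs
    refine ⟨d, f, hf, fun h0 => h ((mk_mem_V0_iff hf hv).mpr h0), fun w hw h0 h1 => h0 ?_⟩
    exact (mk_mem_V0_iff hf hw).mp h1
  | univ => exact ⟨0, 1, isHomogeneous_one _ _, by simp, fun _ _ _ => trivial⟩
  | inter s t _ _ ihs iht =>
    obtain ⟨d, f, hf, hfv, hfU⟩ := ihs h.1
    obtain ⟨e, g, hg, hgv, hgU⟩ := iht h.2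
    refine ⟨d + e, f * g, hf.mul hg, by simp [hfv, hgv], fun w hw h0 => ?_⟩
    rw [map_mul] at h0
    exact ⟨hfU w hw (left_ne_zero_of_mul h0), hgU w hw (right_ne_zero_of_mul h0)⟩
  | sUnion S _ ih =>
    obtain ⟨s, hs, hvs⟩ := h
    obtain ⟨d, f, hf, hfv, hfU⟩ := ih s hs hvs
    exact ⟨d, f, hf, hfv, fun w hw h0 => ⟨s, hs, hfU w hw h0⟩⟩

/-- The linear form attached to a functional. -/
def lin : Module.Dual k (Fin n → k) →ₗ[k] MvPolynomial (Fin n) k :=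
  ∑ i, (LinearMap.toSpanSingleton k _ (X i)).comp (Module.Dual.eval k _ (Pi.single i 1))

theorem lin_apply (φ : Module.Dual k (Fin n → k)) :
    lin φ = ∑ i, φ (Pi.single i 1) • (X i : MvPolynomial (Fin n) k) := by
  simp [lin]

theorem isHomogeneous_lin (φ : Module.Dual k (Fin n → k)) : (lin φ).IsHomogeneous 1 := by
  rw [lin_apply]
  refine IsHomogeneous.sum _ _ _ fun i _ => ?_
  rw [smul_eq_C_mul]
  simpa using (isHomogeneous_C (Fin n) (φ (Pi.single i 1))).mul (isHomogeneous_X k i)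

@[simp] theorem eval_lin (φ : Module.Dual k (Fin n → k)) (v : Fin n → k) :
    eval v (lin φ) = φ v := by
  rw [lin_apply]
  simp only [map_sum, smul_eval, eval_X]
  conv_rhs => rw [pi_eq_sum_univ' v, map_sum]
  refine Finset.sum_congr rfl fun i _ => ?_
  rw [map_smul, smul_eq_mul, mul_comm]

theorem mk_mem_linSet {W : Submodule k (Fin n → k)} {v : Fin n → k} (hv : v ≠ 0) :
    Projectivization.mk k v hv ∈ linSet W ↔ v ∈ W := by
  simp [linSet, Projectivization.submodule_mk, Submodule.span_singleton_le_iff_mem]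

theorem isClosed_linSet (W : Submodule k (Fin n → k)) : IsClosed (linSet W) := by
  have : linSet W = ⋂ φ ∈ W.dualAnnihilator, V0 (lin φ) := by
    ext p
    induction p using Projectivization.ind with | _ v hv =>
    simp only [mk_mem_linSet, Set.mem_iInter, mk_mem_V0_iff (isHomogeneous_lin _), eval_lin]
    rw [← Subspace.dualAnnihilator_dualCoannihilator_eq (W := W),
      Submodule.mem_dualCoannihilator]
    simp
  rw [this]
  exact isClosed_biInter fun φ _ => isClosed_V0 (isHomogeneous_lin φ)

theorem eval_aeval_curve (φ : Fin n → Polynomial k) (f : MvPolynomial (Fin n) k) (t : k) :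
    (aeval φ f).eval t = eval (fun i => (φ i).eval t) f := by
  induction f using MvPolynomial.induction_on with
  | C a => simp
  | add p q hp hq => simp [hp, hq]
  | mul_X p i hp => simp [hp]

/-- An open set meeting a parametrised rational curve contains almost all of it. -/
theorem finite_curve_notMem (φ : Fin n → Polynomial k)
    (h : ∀ t, (fun i => (φ i).eval t) ≠ 0) {U : Set (PS k n)} (hU : IsOpen U) {t₀ : k}
    (h0 : Projectivization.mk k _ (h t₀) ∈ U) :
    {t | Projectivization.mk k _ (h t) ∉ U}.Finite := by
  obtain ⟨d, f, -, hf, hfU⟩ := exists_V0_compl_subset hU _ h0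
  have hne : aeval φ f ≠ 0 := fun h0 => hf (by rw [← eval_aeval_curve, h0, Polynomial.eval_zero])
  refine (Polynomial.finite_setOfPred_isRoot hne).subset fun t ht => ?_
  by_contra hr
  refine ht (hfU _ _ ?_)
  rw [← eval_aeval_curve]; exact hr

/-- Two open sets through two points of a linear space meet on it. -/
theorem exists_mem_line [Infinite k] {U U' : Set (PS k n)} (hU : IsOpen U) (hU' : IsOpen U')
    {v w : Fin n → k} (hv : v ≠ 0) (hw : w ≠ 0) (hvU : Projectivization.mk k v hv ∈ U)
    (hwU : Projectivization.mk k w hw ∈ U') :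
    ∃ (t : k) (h : v + t • (w - v) ≠ 0), Projectivization.mk k _ h ∈ U ∩ U' := by
  obtain ⟨d, f, -, hf, hfU⟩ := exists_V0_compl_subset hU _ hvU
  obtain ⟨e, g, -, hg, hgU⟩ := exists_V0_compl_subset hU' _ hwU
  obtain ⟨i, hi⟩ := Function.ne_iff.mp hv
  let φ : Fin n → Polynomial k := fun i => Polynomial.C (v i) + Polynomial.X * Polynomial.C (w i - v i)
  have hφ (t : k) : (fun i => (φ i).eval t) = v + t • (w - v) := by
    ext j; simp [φ]
  have h1 : aeval φ f ≠ 0 := fun h => hf (by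
    have := eval_aeval_curve φ f 0
    rw [h, hφ] at this; simpa using this.symm)
  have h2 : aeval φ g ≠ 0 := fun h => hg (by
    have := eval_aeval_curve φ g 1
    rw [h, hφ] at this; simpa using this.symm)
  have h3 : φ i ≠ 0 := fun h => hi (by
    have := congrFun (hφ 0) i
    simpa [h] using this.symm)
  obtain ⟨t, ht⟩ : ∃ t, ¬ (aeval φ f * aeval φ g * φ i).IsRoot t := by
    by_contra! hcon
    have := Polynomial.finite_setOfPred_isRoot (mul_ne_zero (mul_ne_zero h1 h2) h3)
    exact Set.infinite_univ (this.subset fun t _ => hcon t)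
  simp only [Polynomial.IsRoot, Polynomial.eval_mul, eval_aeval_curve, hφ] at ht
  have hne : v + t • (w - v) ≠ 0 := fun h => ht (by
    have := congrFun (hφ t) i
    rw [h] at this
    exact mul_eq_zero_of_right _ this)
  exact ⟨t, hne, hfU _ _ (left_ne_zero_of_mul (left_ne_zero_of_mul ht)),
    hgU _ _ (right_ne_zero_of_mul (left_ne_zero_of_mul ht))⟩

theorem linSet_subset_closure [Infinite k] {W : Submodule k (Fin n → k)} {U : Set (PS k n)} (hU : IsOpen U)
    {q : PS k n} (hqU : q ∈ U) (hqW : q ∈ linSet W) : linSet W ⊆ closure (linSet W ∩ U) := by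
  intro p hp
  rw [mem_closure_iff]
  intro U' hU' hpU'
  induction p using Projectivization.ind with | _ v hv =>
  induction q using Projectivization.ind with | _ w hw =>
  obtain ⟨t, ht, h1, h2⟩ := exists_mem_line hU' hU hv hw hpU' hqU
  rw [mk_mem_linSet] at hp hqW
  exact ⟨_, h1, (mk_mem_linSet _).mpr (W.add_mem hp (W.smul_mem _ (W.sub_mem hqW hp))), h2⟩

theorem dense_of_isOpen [Infinite k] {U : Set (PS k n)} (hU : IsOpen U) (h : U.Nonempty) : Dense U := by
  obtain ⟨q, hq⟩ := h
  intro p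
  have := linSet_subset_closure (W := ⊤) hU hq (by simp [linSet]) (show p ∈ linSet ⊤ by simp [linSet])
  exact closure_mono Set.inter_subset_right this

theorem Generic.and_exists {P Q : PS k n → Prop} (hP : Generic P) (hQ : Generic Q)
    (h : Nonempty (PS k n)) : ∃ q, P q ∧ Q q := by
  obtain ⟨U, hU, hUd, hUP⟩ := hP
  obtain ⟨V, hV, hVd, hVP⟩ := hQ
  obtain ⟨q, hq⟩ := (hUd.inter_of_isOpen_left hVd hU).nonempty
  exact ⟨q, hUP q hq.1, hVP q hq.2⟩

theorem isIrreducible_curve [Infinite k] (φ : Fin n → Polynomial k)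
    (h : ∀ t, (fun i => (φ i).eval t) ≠ 0) {T : Set k} (hT : Tᶜ.Finite) :
    IsIrreducible (closure ((fun t => Projectivization.mk k _ (h t)) '' T)) := by
  have hTi : T.Infinite := fun hf => Set.infinite_univ ((hf.union hT).subset (by simp))
  refine IsIrreducible.closure ⟨(hTi.nonempty).image _, ?_⟩
  rintro U V hU hV ⟨_, ⟨t, ht, rfl⟩, htU⟩ ⟨_, ⟨s, hs, rfl⟩, hsV⟩
  have h1 := finite_curve_notMem φ h hU htU
  have h2 := finite_curve_notMem φ h hV hsV
  obtain ⟨r, hrT, hr⟩ := (hTi.sdiff (h1.union h2)).nonempty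
  simp only [Set.mem_union, Set.mem_ofPred_eq, not_or, not_not] at hr
  exact ⟨_, ⟨r, hrT, rfl⟩, hr.1, hr.2⟩

theorem curve_mem_closure (φ : Fin n → Polynomial k)
    (h : ∀ t, (fun i => (φ i).eval t) ≠ 0) {S : Set (PS k n)} {T : Set k} (hT : T.Infinite)
    (hS : ∀ t ∈ T, Projectivization.mk k _ (h t) ∈ S) (t : k) :
    Projectivization.mk k _ (h t) ∈ closure S := by
  rw [mem_closure_iff]
  intro U hU htU
  obtain ⟨r, hrT, hr⟩ := (hT.sdiff (finite_curve_notMem φ h hU htU)).nonempty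
  exact ⟨_, by simpa using hr, hS r hrT⟩

end Topology

section Rank
variable {k : Type} [Field k] {n : ℕ}

theorem pspan_le_iff {S : Set (PS k n)} {W : Submodule k (Fin n → k)} :
    pspan S ≤ W ↔ S ⊆ linSet W := by
  simp only [pspan, iSup_le_iff]; rfl

theorem pspan_mono {S T : Set (PS k n)} (h : S ⊆ T) : pspan S ≤ pspan T :=
  biSup_mono fun _ hp => h hp

theorem pspan_pair (x y : PS k n) : pspan {x, y} = x.submodule ⊔ y.submodule := by
  rw [pspan, iSup_insert, iSup_singleton]

theorem submodule_ne_bot (q : PS k n) : q.submodule ≠ ⊥ := by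
  induction q using Projectivization.ind with | _ v hv =>
  simpa [Projectivization.submodule_mk] using hv

theorem eq_of_submodule_le {p q : PS k n} (h : p.submodule ≤ q.submodule) : p = q := by
  induction p using Projectivization.ind with | _ v hv =>
  induction q using Projectivization.ind with | _ w hw =>
  rw [Projectivization.submodule_mk, Projectivization.submodule_mk,
    Submodule.span_singleton_le_iff_mem, Submodule.mem_span_singleton] at h
  exact (Projectivization.mk_eq_mk_iff' k v w hv hw).mpr h

theorem mk_submodule_le_sup {u v w : Fin n → k} (hu : u ≠ 0) (hv : v ≠ 0) (hw : w ≠ 0) :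
    (Projectivization.mk k u hu).submodule ≤
      (Projectivization.mk k v hv).submodule ⊔ (Projectivization.mk k w hw).submodule ↔
    ∃ a b : k, a • v + b • w = u := by
  simp only [Projectivization.submodule_mk]
  rw [← Submodule.span_insert, Submodule.span_singleton_le_iff_mem, Submodule.mem_span_pair]

theorem not_hasDecomp_zero (X : Set (PS k n)) (q : PS k n) : ¬ hasDecomp X q 0 := by
  rintro ⟨A, -, hc, hq⟩
  rw [Finset.card_eq_zero] at hc
  subst hc
  simp only [memSpan, pspan, Finset.coe_empty, Set.mem_empty_iff_false, iSup_false, iSup_bot,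
    le_bot_iff] at hq
  exact submodule_ne_bot q hq

theorem hasDecomp_one {X : Set (PS k n)} {q : PS k n} (h : hasDecomp X q 1) : q ∈ X := by
  obtain ⟨A, hA, hc, hq⟩ := h
  obtain ⟨a, rfl⟩ := Finset.card_eq_one.mp hc
  simp only [memSpan, pspan, Finset.coe_singleton, Set.mem_singleton_iff, iSup_iSup_eq_left] at hq
  rw [eq_of_submodule_le hq]
  exact hA (by simp)

theorem two_le_rk {X : Set (PS k n)} {q : PS k n} (hq : q ∉ X) {s : ℕ} (hs : hasDecomp X q s) :
    2 ≤ s := by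
  rcases s with _ | _ | s
  · exact absurd hs (not_hasDecomp_zero X q)
  · exact absurd (hasDecomp_one hs) hq
  · omega

theorem rk_eq_two {X : Set (PS k n)} {q : PS k n} (hq : q ∉ X) (h : hasDecomp X q 2) :
    rk X q = 2 :=
  le_antisymm (Nat.sInf_le h) (two_le_rk hq (Nat.sInf_mem (s := {s | hasDecomp X q s}) ⟨2, h⟩))

open Classical in
theorem pair_mem_decomps {X : Set (PS k n)} {q x y : PS k n} (hq : q ∉ X) (hx : x ∈ X) (hy : y ∈ X)
    (h : q.submodule ≤ x.submodule ⊔ y.submodule) :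
    rk X q = 2 ∧ ({x, y} : Finset (PS k n)) ∈ decomps X q := by
  have hxy : x ≠ y := by
    rintro rfl
    rw [sup_idem] at h
    exact hq (eq_of_submodule_le h ▸ hx)
  have hsub : ((({x, y} : Finset (PS k n)) : Set (PS k n))) ⊆ X := by
    intro z hz
    simp only [Finset.coe_insert, Finset.coe_singleton, Set.mem_insert_iff,
      Set.mem_singleton_iff] at hz
    rcases hz with rfl | rfl <;> assumption
  have hspan : memSpan q (({x, y} : Finset (PS k n)) : Set (PS k n)) := by
    simpa [memSpan, pspan_pair] using h
  have hr : rk X q = 2 := rk_eq_two hq ⟨{x, y}, hsub, Finset.card_pair hxy, hspan⟩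
  refine ⟨hr, hsub, by rw [hr, Finset.card_pair hxy], hspan, fun B hB hB' => ?_⟩
  have h1 := Finset.card_lt_card hB
  rw [Finset.card_pair hxy] at h1
  have h2 := two_le_rk hq ⟨B, (Finset.coe_subset.mpr hB.subset).trans hsub, rfl, hB'⟩
  omega

/-- Description of the entry locus of a point of rank two. -/
theorem entryLocus_eq {X Γ D : Set (PS k n)} {q : PS k n} (hq : q ∉ X) (hΓ : IsClosed Γ)
    (h1 : ∀ x ∈ X, ∀ y ∈ X, q.submodule ≤ x.submodule ⊔ y.submodule → x ∈ Γ)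
    (hD : ∀ x ∈ D, x ∈ X ∧ ∃ y ∈ X, q.submodule ≤ x.submodule ⊔ y.submodule) (hne : D.Nonempty)
    (hΓD : Γ ⊆ closure D) : entryLocus X q = Γ ∧ q ∈ linSet (pspan (entryLocus X q)) := by
  classical
  have hDsub : D ⊆ ⋃ A ∈ decomps X q, (↑A : Set (PS k n)) := by
    intro x hx
    obtain ⟨hxX, y, hy, hqxy⟩ := hD x hx
    exact Set.mem_biUnion (pair_mem_decomps hq hxX hy hqxy).2 (by simp)
  obtain ⟨x, hx⟩ := hne
  obtain ⟨hxX, y, hy, hqxy⟩ := hD x hx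
  obtain ⟨hr, hmem⟩ := pair_mem_decomps hq hxX hy hqxy
  refine ⟨Set.Subset.antisymm (closure_minimal ?_ hΓ) (hΓD.trans (closure_mono hDsub)), ?_⟩
  · refine Set.iUnion₂_subset fun A hA => ?_
    obtain ⟨hAX, hc, hs, -⟩ := hA
    rw [hr, Finset.card_eq_two] at hc
    obtain ⟨a, b, -, rfl⟩ := hc
    simp only [memSpan, Finset.coe_insert, Finset.coe_singleton, pspan_pair] at hs hAX ⊢
    have ha : a ∈ X := hAX (by simp)
    have hb : b ∈ X := hAX (by simp)
    rintro z (rfl | rfl)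
    · exact h1 _ ha _ hb hs
    · exact h1 _ hb _ ha (by rwa [sup_comm])
  · exact hmem.2.2.1.trans (pspan_mono ((Set.subset_biUnion_of_mem hmem).trans subset_closure))

theorem typeA_of {ι : Type*} [Infinite k] {X U : Set (PS k n)} (hU : IsOpen U) (hne : U.Nonempty)
    (Γ : ι → Set (PS k n)) (W : ι → Submodule k (Fin n → k)) (hΓ : ∀ i, Γ i ⊆ linSet (W i))
    (hW : ∀ q ∈ U, ∃ i, q ∈ linSet (W i))
    (hE : ∀ i, ∀ q ∈ U, q ∈ linSet (W i) →
      entryLocus X q = Γ i ∧ q ∈ linSet (pspan (entryLocus X q))) : TypeA X := by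
  refine ⟨U, hU, dense_of_isOpen hU hne, fun q hq => ?_⟩
  obtain ⟨i, hi⟩ := hW q hq
  obtain ⟨hq1, hq2⟩ := hE i q hq hi
  refine ⟨U, hU, linSet_subset_closure hU hq hq2, fun o ho => ?_⟩
  have : o ∈ linSet (W i) := by
    have h1 := ho.1
    rw [hq1] at h1
    exact le_trans h1 (pspan_le_iff.mpr (hΓ i))
  exact (hE i o ho.2 this).1.trans hq1.symm

theorem generic_of [Infinite k] {U : Set (PS k n)} {P : PS k n → Prop} (hU : IsOpen U)
    (hne : U.Nonempty) (h : ∀ q ∈ U, P q) : Generic P :=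
  ⟨U, hU, dense_of_isOpen hU hne, h⟩

theorem mk_mem_of_smul {X : Set (PS k n)} {v : Fin n → k} (hv : v ≠ 0) (c : k)
    (h : ∀ hc : c • v ≠ 0, Projectivization.mk k (c • v) hc ∈ X) (hc : c ≠ 0) :
    Projectivization.mk k v hv ∈ X := by
  have := h (smul_ne_zero hc hv)
  rwa [(Projectivization.mk_eq_mk_iff' k (c • v) v _ hv).mpr ⟨c, rfl⟩] at this

theorem mk_mem_congr {X : Set (PS k n)} {v w : Fin n → k} (hv : v ≠ 0) (e : v = w)
    (h : ∀ hw : w ≠ 0, Projectivization.mk k w hw ∈ X) : Projectivization.mk k v hv ∈ X := by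
  subst e; exact h hv

/-- A map given by polynomials in one variable. -/
def PolyCurve (c : k → Fin n → k) : Prop := ∀ i, ∃ p : Polynomial k, ∀ t, c t i = p.eval t

theorem PolyCurve.comp_equiv {c : k → Fin n → k} (hc : PolyCurve c)
    (e : (Fin n → k) ≃ₗ[k] (Fin n → k)) : PolyCurve fun t => e (c t) := by
  intro i
  choose p hp using hc
  refine ⟨∑ j, Polynomial.C (e (Pi.single j 1) i) * p j, fun t => ?_⟩
  change e (c t) i = _
  conv_lhs => rw [pi_eq_sum_univ' (c t), map_sum]
  rw [Finset.sum_apply, Polynomial.eval_finsetSum]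
  refine Finset.sum_congr rfl fun j _ => ?_
  simp only [map_smul, Pi.smul_apply, smul_eq_mul, Polynomial.eval_mul, Polynomial.eval_C, hp]
  rw [mul_comm]

theorem PolyCurve.mem_closure {c : k → Fin n → k} (hc : PolyCurve c) (h : ∀ t, c t ≠ 0)
    {S : Set (PS k n)} {T : Set k} (hT : T.Infinite)
    (hS : ∀ t ∈ T, Projectivization.mk k _ (h t) ∈ S) (t : k) :
    Projectivization.mk k _ (h t) ∈ closure S := by
  choose p hp using hc
  have : c = fun t i => (p i).eval t := by ext t i; exact hp i t
  subst this
  exact curve_mem_closure p h hT hS t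

theorem PolyCurve.isIrreducible [Infinite k] {c : k → Fin n → k} (hc : PolyCurve c)
    (h : ∀ t, c t ≠ 0) {T : Set k} (hT : Tᶜ.Finite) :
    IsIrreducible (closure ((fun t => Projectivization.mk k _ (h t)) '' T)) := by
  choose p hp using hc
  have : c = fun t i => (p i).eval t := by ext t i; exact hp i t
  subst this
  exact isIrreducible_curve p h hT

end Rank

section Scroll
variable {k : Type} [Field k]

/-- The linear form giving the `i`-th coordinate after the coordinate change `e`. -/
def coordForm {n : ℕ} (e : (Fin n → k) ≃ₗ[k] (Fin n → k)) (i : Fin n) : MvPolynomial (Fin n) k :=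
  lin ((LinearMap.proj i).comp e.toLinearMap)

@[simp] theorem eval_coordForm {n : ℕ} (e : (Fin n → k) ≃ₗ[k] (Fin n → k)) (i : Fin n)
    (v : Fin n → k) : eval v (coordForm e i) = e v i := by
  simp [coordForm]

theorem isHomogeneous_coordForm {n : ℕ} (e : (Fin n → k) ≃ₗ[k] (Fin n → k)) (i : Fin n) :
    (coordForm e i).IsHomogeneous 1 := isHomogeneous_lin _

/-- The conics in the cubic scroll. -/
def scrollConic (e : (Fin 5 → k) ≃ₗ[k] (Fin 5 → k)) (m : k × k) : Set (PS k 5) :=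
  V0 (coordForm e 0 * coordForm e 2 - coordForm e 1 ^ 2) ∩
    (V0 (m.1 • coordForm e 0 + m.2 • coordForm e 1 + coordForm e 3) ∩
      V0 (m.1 • coordForm e 1 + m.2 • coordForm e 2 + coordForm e 4))

variable {e : (Fin 5 → k) ≃ₗ[k] (Fin 5 → k)}

theorem isHomogeneous_conic :
    (coordForm e 0 * coordForm e 2 - coordForm e 1 ^ 2).IsHomogeneous 2 :=
  (((isHomogeneous_coordForm e 0).mul (isHomogeneous_coordForm e 2))).sub
    ((isHomogeneous_coordForm e 1).pow 2)

theorem isHomogeneous_comb (a b : k) (i j l : Fin 5) :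
    (a • coordForm e i + b • coordForm e j + coordForm e l).IsHomogeneous 1 := by
  simp only [← mem_homogeneousSubmodule]
  exact Submodule.add_mem _ (Submodule.add_mem _
    (Submodule.smul_mem _ _ (isHomogeneous_coordForm e i))
    (Submodule.smul_mem _ _ (isHomogeneous_coordForm e j))) (isHomogeneous_coordForm e l)

theorem mk_mem_scrollConic {m : k × k} {v : Fin 5 → k} (hv : v ≠ 0) :
    Projectivization.mk k v hv ∈ scrollConic e m ↔ e v 0 * e v 2 = e v 1 ^ 2 ∧
      e v 3 = -(m.1 * e v 0 + m.2 * e v 1) ∧ e v 4 = -(m.1 * e v 1 + m.2 * e v 2) := by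
  simp only [scrollConic, Set.mem_inter_iff, mk_mem_V0_iff isHomogeneous_conic,
    mk_mem_V0_iff (isHomogeneous_comb _ _ _ _ _), map_sub, map_mul, map_pow, map_add, smul_eval,
    eval_coordForm, sub_eq_zero]
  grind

theorem isClosed_scrollConic (m : k × k) : IsClosed (scrollConic e m) :=
  (isClosed_V0 isHomogeneous_conic).inter
    ((isClosed_V0 (isHomogeneous_comb _ _ _ _ _)).inter (isClosed_V0 (isHomogeneous_comb _ _ _ _ _)))

/-- `X` is a cubic scroll in the coordinates `e`. -/
structure IsScroll (e : (Fin 5 → k) ≃ₗ[k] (Fin 5 → k)) (X : Set (PS k 5)) : Prop where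
  eqs : ∀ v (hv : v ≠ 0), Projectivization.mk k v hv ∈ X →
    e v 0 * e v 2 = e v 1 ^ 2 ∧ e v 0 * e v 4 = e v 1 * e v 3 ∧ e v 1 * e v 4 = e v 2 * e v 3
  pts : ∀ (a b c : k) (h : e.symm ![a ^ 2, a * b, b ^ 2, a * c, b * c] ≠ 0),
    Projectivization.mk k _ h ∈ X

variable {X : Set (PS k 5)}

theorem IsScroll.conic_subset (h : IsScroll e X) (m : k × k) : scrollConic e m ⊆ X := by
  intro p hp
  induction p using Projectivization.ind with | _ v hv =>
  obtain ⟨h1, h2, h3⟩ := (mk_mem_scrollConic hv).mp hp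
  by_cases h0 : e v 0 = 0
  · have h11 : e v 1 = 0 := by simpa [h0] using h1.symm
    have h33 : e v 3 = 0 := by simp [h2, h0, h11]
    by_cases h22 : e v 2 = 0
    · refine absurd (e.map_eq_zero_iff.mp ?_) hv
      ext i; fin_cases i <;> simp [h0, h11, h33, h22, h3]
    refine mk_mem_of_smul hv (e v 2) (fun hc => mk_mem_congr hc ?_ (h.pts 0 (e v 2) (e v 4))) h22
    rw [LinearEquiv.eq_symm_apply, map_smul]
    ext i; fin_cases i <;> simp [h0, h11, h33, pow_two]
  · refine mk_mem_of_smul hv (e v 0)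
      (fun hc => mk_mem_congr hc ?_ (h.pts (e v 0) (e v 1) (e v 3))) h0
    rw [LinearEquiv.eq_symm_apply, map_smul]
    ext i; fin_cases i <;> simp [pow_two, h1]
    rw [h2, h3]; linear_combination (-m.2) * h1

/-- A parametrisation of the conics in the scroll. -/
def conicPt (e : (Fin 5 → k) ≃ₗ[k] (Fin 5 → k)) (m : k × k) (t : k) : Fin 5 → k :=
  e.symm ![1, t, t ^ 2, -(m.1 + m.2 * t), -(t * (m.1 + m.2 * t))]

/-- A parametrisation of the conics in the scroll around the point at infinity. -/
def conicPt' (e : (Fin 5 → k) ≃ₗ[k] (Fin 5 → k)) (m : k × k) (t : k) : Fin 5 → k :=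
  e.symm ![t ^ 2, t, 1, -(t * (m.1 * t + m.2)), -(m.1 * t + m.2)]

theorem polyCurve_conicPt (m : k × k) : PolyCurve (conicPt e m) := by
  refine PolyCurve.comp_equiv (fun i => ?_) e.symm
  refine ⟨(![1, Polynomial.X, Polynomial.X ^ 2,
    -(Polynomial.C m.1 + Polynomial.C m.2 * Polynomial.X),
    -(Polynomial.X * (Polynomial.C m.1 + Polynomial.C m.2 * Polynomial.X))] : Fin 5 → Polynomial k) i,
    fun t => ?_⟩
  fin_cases i <;> simp

theorem polyCurve_conicPt' (m : k × k) : PolyCurve (conicPt' e m) := by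
  refine PolyCurve.comp_equiv (fun i => ?_) e.symm
  refine ⟨(![Polynomial.X ^ 2, Polynomial.X, 1,
    -(Polynomial.X * (Polynomial.C m.1 * Polynomial.X + Polynomial.C m.2)),
    -(Polynomial.C m.1 * Polynomial.X + Polynomial.C m.2)] : Fin 5 → Polynomial k) i, fun t => ?_⟩
  fin_cases i <;> simp

theorem conicPt_ne (m : k × k) (t : k) : conicPt e m t ≠ 0 := by
  intro h
  have := congrFun (congrArg e h) 0
  simp [conicPt] at this

theorem conicPt'_ne (m : k × k) (t : k) : conicPt' e m t ≠ 0 := by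
  intro h
  have := congrFun (congrArg e h) 2
  simp [conicPt'] at this

theorem conicPt_mem (m : k × k) (t : k) :
    Projectivization.mk k _ (conicPt_ne (e := e) m t) ∈ scrollConic e m := by
  rw [mk_mem_scrollConic]
  simp [conicPt]; ring

theorem scrollConic_subset_closure [Infinite k] (m : k × k) {T : Set k} (hT : Tᶜ.Finite) :
    scrollConic e m ⊆ closure ((fun t => Projectivization.mk k _ (conicPt_ne (e := e) m t)) '' T) := by
  have hTi : T.Infinite := fun hf => Set.infinite_univ ((hf.union hT).subset (by simp))
  intro p hp
  induction p using Projectivization.ind with | _ v hv =>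
  obtain ⟨h1, h2, h3⟩ := (mk_mem_scrollConic hv).mp hp
  by_cases h0 : e v 0 = 0
  · have h11 : e v 1 = 0 := by simpa [h0] using h1.symm
    have h33 : e v 3 = 0 := by simp [h2, h0, h11]
    have h22 : e v 2 ≠ 0 := by
      intro h22
      refine absurd (e.map_eq_zero_iff.mp ?_) hv
      ext i; fin_cases i <;> simp [h0, h11, h33, h22, h3]
    have key := (polyCurve_conicPt' (e := e) m).mem_closure (conicPt'_ne m)
      (S := (fun t => Projectivization.mk k _ (conicPt_ne (e := e) m t)) '' T)
      (T := {t | t ≠ 0 ∧ t⁻¹ ∈ T}) ?_ ?_ 0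
    · convert key using 1
      rw [Projectivization.mk_eq_mk_iff']
      refine ⟨e v 2, ?_⟩
      rw [conicPt', ← map_smul, LinearEquiv.symm_apply_eq]
      ext i; fin_cases i <;> simp [h0, h11, h33, h3, mul_comm]
    · have : {t : k | t ≠ 0 ∧ t⁻¹ ∈ T}ᶜ.Finite := by
        refine ((hT.image (·⁻¹)).union (Set.finite_singleton 0)).subset fun t ht => ?_
        by_cases h : t = 0
        · right; exact h
        · left
          refine ⟨t⁻¹, fun h' => ht ⟨h, h'⟩, inv_inv t⟩
      exact fun hf => Set.infinite_univ ((hf.union this).subset (by simp))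
    · rintro t ⟨ht, htT⟩
      refine ⟨t⁻¹, htT, ?_⟩
      simp only
      rw [Projectivization.mk_eq_mk_iff']
      refine ⟨(t ^ 2)⁻¹, ?_⟩
      rw [conicPt', conicPt, ← map_smul]
      congr 1
      ext i; fin_cases i <;> simp <;> field_simp <;> ring
  · have key := (polyCurve_conicPt (e := e) m).mem_closure (conicPt_ne m)
      (S := (fun t => Projectivization.mk k _ (conicPt_ne (e := e) m t)) '' T) hTi
      (fun t ht => ⟨t, ht, rfl⟩) (e v 1 / e v 0)
    convert key using 1
    rw [Projectivization.mk_eq_mk_iff']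
    refine ⟨e v 0, ?_⟩
    rw [conicPt, ← map_smul, LinearEquiv.symm_apply_eq]
    ext i; fin_cases i <;> simp <;> field_simp <;> grind

theorem isIrreducible_scrollConic [Infinite k] (m : k × k) : IsIrreducible (scrollConic e m) := by
  have h1 := scrollConic_subset_closure (e := e) m (T := Set.univ) (by simp)
  have h2 := (polyCurve_conicPt (e := e) m).isIrreducible (conicPt_ne m) (T := Set.univ) (by simp)
  rwa [Set.Subset.antisymm h1 (closure_minimal ?_ (isClosed_scrollConic m))]
  rintro _ ⟨t, -, rfl⟩
  exact conicPt_mem m t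

theorem IsScroll.entryLocus_eq [CharZero k] (h : IsScroll e X) {q : Fin 5 → k} (hq : q ≠ 0)
    (hU : e q 0 * e q 2 - e q 1 ^ 2 ≠ 0) (m : k × k) (h3 : e q 3 = -(m.1 * e q 0 + m.2 * e q 1))
    (h4 : e q 4 = -(m.1 * e q 1 + m.2 * e q 2)) :
    entryLocus X (Projectivization.mk k q hq) = scrollConic e m ∧
      Projectivization.mk k q hq ∈
        linSet (pspan (entryLocus X (Projectivization.mk k q hq))) := by
  have hqX : Projectivization.mk k q hq ∉ X := fun hmem =>
    hU (sub_eq_zero.mpr (h.eqs q hq hmem).1)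
  let B : Polynomial k := Polynomial.C (e q 0) * Polynomial.X ^ 2
    - Polynomial.C (2 * e q 1) * Polynomial.X + Polynomial.C (e q 2)
  have hB : B ≠ 0 := by
    intro h0
    have hc0 := congrArg (Polynomial.coeff · 0) h0
    have hc2 := congrArg (Polynomial.coeff · 2) h0
    have hc1 := congrArg (Polynomial.coeff · 1) h0
    simp [B, Polynomial.coeff_X, Polynomial.coeff_C] at hc0 hc2 hc1
    rw [hc0, hc2, hc1] at hU
    simp at hU
  have hT : {t | ¬ B.IsRoot t}ᶜ.Finite :=
    (Polynomial.finite_setOfPred_isRoot hB).subset fun t ht => by simpa using ht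
  refine EL.entryLocus_eq (D := (fun t => Projectivization.mk k _ (conicPt_ne (e := e) m t)) ''
    {t | ¬ B.IsRoot t}) hqX (isClosed_scrollConic m) ?_ ?_ ?_ (scrollConic_subset_closure m hT)
  · intro x hx y hy hxy
    induction x using Projectivization.ind with | _ x hx0 =>
    induction y using Projectivization.ind with | _ y hy0 =>
    obtain ⟨a, b, rfl⟩ := (mk_submodule_le_sup hq hx0 hy0).mp hxy
    obtain ⟨x1, x2, x3⟩ := h.eqs x hx0 hx
    obtain ⟨y1, y2, y3⟩ := h.eqs y hy0 hy
    simp only [map_add, map_smul, Pi.add_apply, Pi.smul_apply, smul_eq_mul] at h3 h4 hU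
    have ha : a ≠ 0 := by
      rintro rfl
      apply hU
      linear_combination b ^ 2 * y1
    rw [mk_mem_scrollConic]
    generalize e x = x at *
    generalize e y = y at *
    have e0 : (m.1 * x 0 + m.2 * x 1 + x 3) * (a * x 1 + b * y 1)
        = (m.1 * x 1 + m.2 * x 2 + x 4) * (a * x 0 + b * y 0) := by
      refine mul_left_cancel₀ ha ?_
      linear_combination a ^ 2 * (-m.2 * x1 - x2) + b * y 1 * h3 - b * y 0 * h4
        + b ^ 2 * (m.2 * y1 + y2)
    have e1 : (m.1 * x 0 + m.2 * x 1 + x 3) * (a * x 2 + b * y 2)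
        = (m.1 * x 1 + m.2 * x 2 + x 4) * (a * x 1 + b * y 1) := by
      refine mul_left_cancel₀ ha ?_
      linear_combination a ^ 2 * (m.1 * x1 - x3) + b * y 2 * h3 - b * y 1 * h4
        - b ^ 2 * (m.1 * y1 - y3)
    have f0 : (m.1 * x 0 + m.2 * x 1 + x 3) = 0 := by
      refine (mul_eq_zero.mp ?_).resolve_right hU
      linear_combination (a * x 0 + b * y 0) * e1 - (a * x 1 + b * y 1) * e0
    have f1 : (m.1 * x 1 + m.2 * x 2 + x 4) = 0 := by
      refine (mul_eq_zero.mp ?_).resolve_right hU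
      linear_combination (a * x 1 + b * y 1) * e1 - (a * x 2 + b * y 2) * e0
    exact ⟨x1, by linear_combination f0, by linear_combination f1⟩
  · rintro _ ⟨t, ht, rfl⟩
    refine ⟨h.conic_subset m (conicPt_mem m t), ?_⟩
    have hBt : e q 0 * t ^ 2 - 2 * e q 1 * t + e q 2 ≠ 0 := by simpa [B] using ht
    set μ := (e q 0 * e q 2 - e q 1 ^ 2) / (e q 0 * t ^ 2 - 2 * e q 1 * t + e q 2) with hμ
    have hμ' : μ * (e q 0 * t ^ 2 - 2 * e q 1 * t + e q 2) = e q 0 * e q 2 - e q 1 ^ 2 :=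
      div_mul_cancel₀ _ hBt
    have hy0 : q - μ • conicPt e m t ≠ 0 := by
      intro h0
      rw [sub_eq_zero] at h0
      apply hU
      rw [h0]
      simp [conicPt]; ring
    refine ⟨Projectivization.mk k _ hy0, h.conic_subset m ?_, ?_⟩
    · rw [mk_mem_scrollConic]
      simp [conicPt]
      refine ⟨?_, ?_, ?_⟩
      · linear_combination -hμ'
      · rw [h3]; ring
      · rw [h4]; ring
    · rw [mk_submodule_le_sup]
      exact ⟨μ, 1, by simp⟩
  · have : {t | ¬ B.IsRoot t}.Infinite := fun hf =>
      Set.infinite_univ ((hf.union hT).subset (by simp))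
    exact this.nonempty.image _

/-- The general entry loci of a cubic scroll are its conics. -/
theorem IsScroll.typeA_and_typeII_iff [CharZero k] (h : IsScroll e X) :
    TypeA X ∧ (TypeII X ↔ ∃ v ∈ X, IsCone X v) := by
  set U : Set (PS k 5) := (V0 (coordForm e 0 * coordForm e 2 - coordForm e 1 ^ 2))ᶜ with hUdef
  have hU : IsOpen U := (isClosed_V0 isHomogeneous_conic).isOpen_compl
  have hmem : ∀ v (hv : v ≠ 0), Projectivization.mk k v hv ∈ U ↔
      e v 0 * e v 2 - e v 1 ^ 2 ≠ 0 := by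
    intro v hv
    rw [hUdef, Set.mem_compl_iff, mk_mem_V0_iff isHomogeneous_conic]
    simp
  have hne : U.Nonempty := by
    have h0 : e.symm ![1, 0, 1, 0, 0] ≠ 0 := by
      intro h0
      have := congrFun (congrArg e h0) 0
      simp at this
    exact ⟨Projectivization.mk k _ h0, (hmem _ _).mpr (by simp)⟩
  let W : k × k → Submodule k (Fin 5 → k) := fun m => 
    LinearMap.ker ((m.1 • LinearMap.proj 0 + m.2 • LinearMap.proj 1 + LinearMap.proj 3 :
      (Fin 5 → k) →ₗ[k] k).comp e.toLinearMap) ⊓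
    LinearMap.ker ((m.1 • LinearMap.proj 1 + m.2 • LinearMap.proj 2 + LinearMap.proj 4 :
      (Fin 5 → k) →ₗ[k] k).comp e.toLinearMap)
  have hW : ∀ m v, v ∈ W m ↔ e v 3 = -(m.1 * e v 0 + m.2 * e v 1) ∧
      e v 4 = -(m.1 * e v 1 + m.2 * e v 2) := by
    intro m v
    simp [W]
    grind
  have hex : ∀ q ∈ U, ∃ m, q ∈ linSet (W m) := by
    intro q hq
    induction q using Projectivization.ind with | _ v hv =>
    rw [hmem] at hq
    refine ⟨((-e v 3 * e v 2 + e v 4 * e v 1) * (e v 0 * e v 2 - e v 1 ^ 2)⁻¹,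
      (-e v 4 * e v 0 + e v 3 * e v 1) * (e v 0 * e v 2 - e v 1 ^ 2)⁻¹), ?_⟩
    have hi := mul_inv_cancel₀ hq
    rw [mk_mem_linSet, hW]
    exact ⟨by linear_combination (-e v 3) * hi, by linear_combination (-e v 4) * hi⟩
  have hE : ∀ m, ∀ q ∈ U, q ∈ linSet (W m) →
      entryLocus X q = scrollConic e m ∧ q ∈ linSet (pspan (entryLocus X q)) := by
    intro m q hq hqm
    induction q using Projectivization.ind with | _ v hv =>
    rw [hmem] at hq
    rw [mk_mem_linSet, hW] at hqm
    exact h.entryLocus_eq hv hq m hqm.1 hqm.2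
  have hirr : ∀ q ∈ U, IsIrreducible (entryLocus X q) := by
    intro q hq
    obtain ⟨m, hm⟩ := hex q hq
    rw [(hE m q hq hm).1]
    exact isIrreducible_scrollConic m
  refine ⟨typeA_of hU hne (scrollConic e) W ?_ hex hE, ?_⟩
  · intro m p hp
    induction p using Projectivization.ind with | _ v hv =>
    rw [mk_mem_linSet, hW]
    exact ((mk_mem_scrollConic hv).mp hp).2
  constructor
  · intro hII
    obtain ⟨q, h1, h2⟩ := hII.and_exists (generic_of hU hne hirr) ⟨hne.some⟩
    exact absurd h2 h1
  · rintro ⟨v, hv, hc⟩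
    exfalso
    induction v using Projectivization.ind with | _ v hv0 =>
    have key : ∀ t u : k, (e v 0 + 1) * (e v 2 + t ^ 2) = (e v 1 + t) ^ 2 ∧
        (e v 0 + 1) * (e v 4 + t * u) = (e v 1 + t) * (e v 3 + u) := by
      intro t u
      have hp : e.symm ![1 ^ 2, 1 * t, t ^ 2, 1 * u, t * u] ≠ 0 := by
        intro h0
        have := congrFun (congrArg e h0) 0
        simp at this
      by_cases h0 : v + e.symm ![1 ^ 2, 1 * t, t ^ 2, 1 * u, t * u] = 0
      · have h00 := congrArg e h0
        have a0 := congrFun h00 0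
        have a1 := congrFun h00 1
        simp at a0 a1
        rw [a0, a1]; simp
      · have := h.eqs _ h0 (hc _ (h.pts 1 t u hp) _
          ((mk_submodule_le_sup _ _ _).mpr ⟨1, 1, by simp⟩))
        exact ⟨by simpa using this.1, by simpa using this.2.1⟩
    have k0 := (key 0 0).1
    have k1 := (key 1 0).1
    have k2 := (key (-1) 0).1
    have k3 := (key 0 0).2
    have k4 := (key 1 0).2
    have h2 : (2 : k) ≠ 0 := two_ne_zero
    apply hv0
    apply e.map_eq_zero_iff.mp
    have v1 : e v 1 = 0 := by
      refine (mul_eq_zero.mp ?_).resolve_left (mul_ne_zero h2 h2)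
      linear_combination k2 - k1
    have v0 : e v 0 = 0 := by linear_combination k1 - k0 + 2 * v1
    have v2 : e v 2 = 0 := by simpa [v0, v1] using k0
    have v4 : e v 4 = 0 := by simpa [v0, v1] using k3
    have v3 : e v 3 = 0 := by simpa [v0, v1, v4] using k4.symm
    ext i; fin_cases i <;> simp [v0, v1, v2, v3, v4]

end Scroll

section CubicCone
variable {k : Type} [Field k]

/-- `X` is a cone over a twisted cubic in the coordinates `e`. -/
structure IsCubicCone (e : (Fin 5 → k) ≃ₗ[k] (Fin 5 → k)) (X : Set (PS k 5)) : Prop where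
  eqs : ∀ v (hv : v ≠ 0), Projectivization.mk k v hv ∈ X →
    e v 0 * e v 2 = e v 1 ^ 2 ∧ e v 0 * e v 3 = e v 1 * e v 2 ∧ e v 1 * e v 3 = e v 2 ^ 2
  pts : ∀ (a b c : k) (h : e.symm ![a ^ 3, a ^ 2 * b, a * b ^ 2, b ^ 3, a ^ 2 * c] ≠ 0),
    Projectivization.mk k _ h ∈ X

variable {e : (Fin 5 → k) ≃ₗ[k] (Fin 5 → k)} {X : Set (PS k 5)}

theorem symm_ne_zero {w : Fin 5 → k} (i : Fin 5) (h : w i ≠ 0) : e.symm w ≠ 0 := by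
  intro h0
  exact h (congrFun (e.symm.map_eq_zero_iff.mp h0) i)

theorem IsCubicCone.pts' [Infinite k] (h : IsCubicCone e X) (hX : IsClosed X) (a b c : k)
    (hne : e.symm ![a ^ 3, a ^ 2 * b, a * b ^ 2, b ^ 3, c] ≠ 0) :
    Projectivization.mk k _ hne ∈ X := by
  have key : ∀ a ≠ 0, ∀ h' : e.symm ![a ^ 3, a ^ 2 * b, a * b ^ 2, b ^ 3, c] ≠ 0,
      Projectivization.mk k _ h' ∈ X := by
    intro a ha h'
    refine mk_mem_congr h' ?_ (h.pts a b (c / a ^ 2))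
    rw [mul_div_cancel₀ _ (pow_ne_zero 2 ha)]
  by_cases ha : a = 0
  · subst ha
    have hbc : ∀ t : k, e.symm ![t ^ 3, t ^ 2 * b, t * b ^ 2, b ^ 3, c] ≠ 0 := by
      intro t
      by_cases hb : b = 0
      · refine symm_ne_zero 4 fun hc : c = 0 => hne ?_
        rw [LinearEquiv.map_eq_zero_iff]
        ext i; fin_cases i <;> simp [hb, hc]
      · exact symm_ne_zero 3 (pow_ne_zero 3 hb)
    have hp : PolyCurve fun t : k => e.symm ![t ^ 3, t ^ 2 * b, t * b ^ 2, b ^ 3, c] := by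
      refine PolyCurve.comp_equiv (fun i => ?_) e.symm
      refine ⟨(![Polynomial.X ^ 3, Polynomial.X ^ 2 * Polynomial.C b,
        Polynomial.X * Polynomial.C (b ^ 2), Polynomial.C (b ^ 3), Polynomial.C c] :
          Fin 5 → Polynomial k) i, fun t => ?_⟩
      fin_cases i <;> simp; ring
    have := hp.mem_closure hbc (S := X) (T := {0}ᶜ) (Set.finite_singleton 0).infinite_compl
      (fun t ht => key t ht (hbc t)) 0
    rwa [hX.closure_eq] at this
  · exact key a ha hne

theorem IsCubicCone.mem_iff [Infinite k] (h : IsCubicCone e X) (hX : IsClosed X) {v : Fin 5 → k}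
    (hv : v ≠ 0) : Projectivization.mk k v hv ∈ X ↔
      e v 0 * e v 2 = e v 1 ^ 2 ∧ e v 0 * e v 3 = e v 1 * e v 2 ∧ e v 1 * e v 3 = e v 2 ^ 2 := by
  refine ⟨h.eqs v hv, fun ⟨h1, h2, h3⟩ => ?_⟩
  by_cases h0 : e v 0 = 0
  · have h11 : e v 1 = 0 := by simpa [h0] using h1.symm
    have h22 : e v 2 = 0 := by simpa [h11] using h3.symm
    by_cases h33 : e v 3 = 0
    · refine mk_mem_congr hv ?_ (h.pts' hX 0 0 (e v 4))
      rw [LinearEquiv.eq_symm_apply]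
      ext i; fin_cases i <;> simp [h0, h11, h22, h33]
    · refine mk_mem_of_smul hv (e v 3 ^ 2) (fun hc => mk_mem_congr hc ?_
        (h.pts' hX 0 (e v 3) (e v 3 ^ 2 * e v 4))) (pow_ne_zero 2 h33)
      rw [LinearEquiv.eq_symm_apply, map_smul]
      ext i; fin_cases i <;> simp [h0, h11, h22]; ring
  · refine mk_mem_of_smul hv (e v 0 ^ 2) (fun hc => mk_mem_congr hc ?_
        (h.pts' hX (e v 0) (e v 1) (e v 0 ^ 2 * e v 4))) (pow_ne_zero 2 h0)
    rw [LinearEquiv.eq_symm_apply, map_smul]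
    ext i; fin_cases i <;> simp
    · ring
    · linear_combination e v 0 * h1
    · linear_combination e v 0 * h2 + e v 1 * h1

theorem IsCubicCone.exists_vertex [Infinite k] (h : IsCubicCone e X) (hX : IsClosed X) :
    ∃ v ∈ X, IsCone X v := by
  have hv : e.symm ![0, 0, 0, 0, 1] ≠ 0 := symm_ne_zero 4 (by simp)
  refine ⟨Projectivization.mk k _ hv, (h.mem_iff hX hv).mpr (by simp), fun p hp q hq => ?_⟩
  induction p using Projectivization.ind with | _ p hp0 =>
  induction q using Projectivization.ind with | _ q hq0 =>
  obtain ⟨a, b, rfl⟩ := (mk_submodule_le_sup hq0 hv hp0).mp hq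
  obtain ⟨h1, h2, h3⟩ := h.eqs p hp0 hp
  rw [h.mem_iff hX]
  simp
  exact ⟨by linear_combination b ^ 2 * h1, by linear_combination b ^ 2 * h2,
    by linear_combination b ^ 2 * h3⟩

/-- The rulings of the cone. -/
def coneLine (e : (Fin 5 → k) ≃ₗ[k] (Fin 5 → k)) (t : k) : Submodule k (Fin 5 → k) :=
  LinearMap.ker (((LinearMap.proj 1 - t • LinearMap.proj 0 : (Fin 5 → k) →ₗ[k] k)).comp
    e.toLinearMap) ⊓
  (LinearMap.ker (((LinearMap.proj 2 - t ^ 2 • LinearMap.proj 0 : (Fin 5 → k) →ₗ[k] k)).comp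
    e.toLinearMap) ⊓
  LinearMap.ker (((LinearMap.proj 3 - t ^ 3 • LinearMap.proj 0 : (Fin 5 → k) →ₗ[k] k)).comp
    e.toLinearMap))

theorem mem_coneLine {t : k} {v : Fin 5 → k} : v ∈ coneLine e t ↔
    e v 1 = t * e v 0 ∧ e v 2 = t ^ 2 * e v 0 ∧ e v 3 = t ^ 3 * e v 0 := by
  simp [coneLine, sub_eq_zero]

/-- The point of a ruling with given last coordinate. -/
def rulingPt (e : (Fin 5 → k) ≃ₗ[k] (Fin 5 → k)) (t z : k) : Fin 5 → k :=
  e.symm ![1, t, t ^ 2, t ^ 3, z]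

theorem rulingPt_ne (t z : k) : rulingPt e t z ≠ 0 := symm_ne_zero 0 (by simp)

theorem coneLine_subset_closure [Infinite k] (t : k) : linSet (coneLine e t) ⊆
    closure (Set.range fun z => Projectivization.mk k _ (rulingPt_ne (e := e) t z)) := by
  intro p hp
  induction p using Projectivization.ind with | _ v hv =>
  obtain ⟨h1, h2, h3⟩ := mem_coneLine.mp ((mk_mem_linSet hv).mp hp)
  by_cases h0 : e v 0 = 0
  · have hc : PolyCurve fun z : k => e.symm ![z, z * t, z * t ^ 2, z * t ^ 3, 1] := by
      refine PolyCurve.comp_equiv (fun i => ?_) e.symm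
      refine ⟨(![Polynomial.X, Polynomial.X * Polynomial.C t,
        Polynomial.X * Polynomial.C (t ^ 2), Polynomial.X * Polynomial.C (t ^ 3), 1] :
          Fin 5 → Polynomial k) i, fun t => ?_⟩
      fin_cases i <;> simp; ring
    have key := hc.mem_closure (fun z => symm_ne_zero 4 (by simp))
      (S := Set.range fun z => Projectivization.mk k _ (rulingPt_ne (e := e) t z))
      (T := {0}ᶜ) (Set.finite_singleton 0).infinite_compl ?_ 0
    · convert key using 1
      rw [Projectivization.mk_eq_mk_iff']
      refine ⟨e v 4, ?_⟩
      rw [← map_smul, LinearEquiv.symm_apply_eq]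
      ext i; fin_cases i <;> simp [h0, h1, h2, h3]
    · intro z hz
      refine ⟨z⁻¹, ?_⟩
      simp only
      rw [Projectivization.mk_eq_mk_iff']
      refine ⟨z⁻¹, ?_⟩
      rw [rulingPt, ← map_smul]
      congr 1
      have hz' : z ≠ 0 := hz
      ext i; fin_cases i <;> simp [hz']
  · apply subset_closure
    refine ⟨e v 4 / e v 0, ?_⟩
    simp only
    rw [eq_comm, Projectivization.mk_eq_mk_iff']
    refine ⟨e v 0, ?_⟩
    rw [rulingPt, ← map_smul, LinearEquiv.symm_apply_eq]
    ext i; fin_cases i <;> simp [h1, h2, h3, mul_comm, mul_div_cancel₀, h0]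

/-- The union of two rulings. -/
def linePair (e : (Fin 5 → k) ≃ₗ[k] (Fin 5 → k)) (t : k × k) : Set (PS k 5) :=
  linSet (coneLine e t.1) ∪ linSet (coneLine e t.2)

theorem not_isIrreducible_linePair {t : k × k} (ht : t.1 ≠ t.2) :
    ¬ IsIrreducible (linePair e t) := by
  intro h
  have key : ∀ a b : k, a ≠ b →
      ¬ linSet (coneLine e a) ⊆ linSet (coneLine e b) := by
    intro a b hab hs
    have := hs ((mk_mem_linSet (rulingPt_ne (e := e) a 0)).mpr
      (mem_coneLine.mpr (by simp [rulingPt])))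
    rw [mk_mem_linSet, mem_coneLine] at this
    exact hab (by simpa [rulingPt] using this.1)
  rcases (isPreirreducible_iff_isClosed_union_isClosed.mp h.isPreirreducible) _ _
    (isClosed_linSet (coneLine e t.1)) (isClosed_linSet (coneLine e t.2)) subset_rfl with h1 | h1
  · exact key _ _ ht.symm (Set.subset_union_right.trans h1)
  · exact key _ _ ht (Set.subset_union_left.trans h1)

theorem IsCubicCone.entryLocus_eq [Infinite k] (h : IsCubicCone e X) (hX : IsClosed X)
    {q : Fin 5 → k} (hq : q ≠ 0) (hU : e q 0 * e q 2 - e q 1 ^ 2 ≠ 0) (t : k × k)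
    (ht : t.1 ≠ t.2) (h2 : e q 2 = (t.1 + t.2) * e q 1 - t.1 * t.2 * e q 0)
    (h3 : e q 3 = (t.1 + t.2) * e q 2 - t.1 * t.2 * e q 1) :
    entryLocus X (Projectivization.mk k q hq) = linePair e t ∧
      Projectivization.mk k q hq ∈
        linSet (pspan (entryLocus X (Projectivization.mk k q hq))) := by
  have hqX : Projectivization.mk k q hq ∉ X := fun hmem =>
    hU (sub_eq_zero.mpr (h.eqs q hq hmem).1)
  have hmemX : ∀ t z : k, Projectivization.mk k _ (rulingPt_ne (e := e) t z) ∈ X := by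
    intro t z
    rw [h.mem_iff hX]
    simp [rulingPt]
    constructor <;> ring
  have hD : ∀ a b : k, a ≠ b → e q 2 = (a + b) * e q 1 - a * b * e q 0 →
      e q 3 = (a + b) * e q 2 - a * b * e q 1 → ∀ z : k,
      ∃ y ∈ X, (Projectivization.mk k q hq).submodule ≤
        (Projectivization.mk k _ (rulingPt_ne (e := e) a z)).submodule ⊔ y.submodule := by
    intro a b hab h2 h3 z
    have hd : a - b ≠ 0 := sub_ne_zero.mpr hab
    set α := (e q 1 - b * e q 0) / (a - b) with hα
    have hα' : α * (a - b) = e q 1 - b * e q 0 := div_mul_cancel₀ _ hd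
    set β := e q 0 - α with hβ
    have q1 : e q 1 = α * a + β * b := by rw [hβ]; linear_combination -hα'
    have q0 : e q 0 = α + β := by rw [hβ]; ring
    clear_value β
    clear_value α
    have hβ0 : β ≠ 0 := by
      rintro rfl
      apply hU
      rw [h2, q1, q0]; ring
    have hy : e.symm ![β, β * b, β * b ^ 2, β * b ^ 3, e q 4 - α * z] ≠ 0 := symm_ne_zero 0 hβ0
    refine ⟨Projectivization.mk k _ hy, ?_, (mk_submodule_le_sup _ _ _).mpr ⟨α, 1, ?_⟩⟩
    · rw [h.mem_iff hX]
      simp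
      refine ⟨?_, ?_, ?_⟩ <;> ring
    · rw [rulingPt, ← map_smul, ← map_smul, ← map_add, LinearEquiv.symm_apply_eq]
      have q2 : e q 2 = α * a ^ 2 + β * b ^ 2 := by rw [h2, q1, q0]; ring
      ext i; fin_cases i <;> simp
      · exact q0.symm
      · exact q1.symm
      · exact q2.symm
      · rw [h3, q2, q1]; ring
  refine EL.entryLocus_eq (D := (Set.range fun z => Projectivization.mk k _
    (rulingPt_ne (e := e) t.1 z)) ∪ (Set.range fun z => Projectivization.mk k _
    (rulingPt_ne (e := e) t.2 z))) hqX ((isClosed_linSet _).union (isClosed_linSet _)) ?_ ?_ ?_ ?_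
  · intro x hx y hy hxy
    induction x using Projectivization.ind with | _ x hx0 =>
    induction y using Projectivization.ind with | _ y hy0 =>
    obtain ⟨a, b, rfl⟩ := (mk_submodule_le_sup hq hx0 hy0).mp hxy
    obtain ⟨x1, x2, x3⟩ := h.eqs x hx0 hx
    obtain ⟨y1, y2, y3⟩ := h.eqs y hy0 hy
    simp only [map_add, map_smul, Pi.add_apply, Pi.smul_apply, smul_eq_mul] at h2 h3 hU
    have ha : a ≠ 0 := by
      rintro rfl
      apply hU
      linear_combination b ^ 2 * y1
    simp only [linePair, Set.mem_union, mk_mem_linSet, mem_coneLine]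
    generalize e x = x at *
    generalize e y = y at *
    obtain ⟨t1, t2⟩ := t
    simp only at *
    have e0 : (x 2 - (t1 + t2) * x 1 + t1 * t2 * x 0) * (a * x 1 + b * y 1)
        = (x 3 - (t1 + t2) * x 2 + t1 * t2 * x 1) * (a * x 0 + b * y 0) := by
      refine mul_left_cancel₀ ha ?_
      linear_combination a ^ 2 * ((t1 + t2) * x1 - x2) + b * y 1 * h2 - b * y 0 * h3
        - b ^ 2 * ((t1 + t2) * y1 - y2)
    have e1 : (x 2 - (t1 + t2) * x 1 + t1 * t2 * x 0) * (a * x 2 + b * y 2)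
        = (x 3 - (t1 + t2) * x 2 + t1 * t2 * x 1) * (a * x 1 + b * y 1) := by
      refine mul_left_cancel₀ ha ?_
      linear_combination a ^ 2 * (t1 * t2 * x1 - x3) + b * y 2 * h2 - b * y 1 * h3
        - b ^ 2 * (t1 * t2 * y1 - y3)
    have f0 : x 2 - (t1 + t2) * x 1 + t1 * t2 * x 0 = 0 := by
      refine (mul_eq_zero.mp ?_).resolve_right hU
      linear_combination (a * x 0 + b * y 0) * e1 - (a * x 1 + b * y 1) * e0
    have f1 : x 3 - (t1 + t2) * x 2 + t1 * t2 * x 1 = 0 := by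
      refine (mul_eq_zero.mp ?_).resolve_right hU
      linear_combination (a * x 1 + b * y 1) * e1 - (a * x 2 + b * y 2) * e0
    have hprod : (x 1 - t1 * x 0) * (x 1 - t2 * x 0) = 0 := by
      linear_combination -x1 + x 0 * f0
    rcases mul_eq_zero.mp hprod with h0 | h0
    · left
      rw [sub_eq_zero] at h0
      have g2 : x 2 = t1 ^ 2 * x 0 := by rw [h0] at f0; linear_combination f0
      refine ⟨h0, g2, ?_⟩
      rw [g2, h0] at f1; linear_combination f1
    · right
      rw [sub_eq_zero] at h0
      have g2 : x 2 = t2 ^ 2 * x 0 := by rw [h0] at f0; linear_combination f0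
      refine ⟨h0, g2, ?_⟩
      rw [g2, h0] at f1; linear_combination f1
  · rintro _ (⟨z, rfl⟩ | ⟨z, rfl⟩)
    · exact ⟨hmemX _ _, hD t.1 t.2 ht h2 h3 z⟩
    · exact ⟨hmemX _ _, hD t.2 t.1 ht.symm (by rw [h2]; ring) (by rw [h3]; ring) z⟩
  · exact ⟨_, Or.inl ⟨0, rfl⟩⟩
  · rw [closure_union]
    exact Set.union_subset_union (coneLine_subset_closure _) (coneLine_subset_closure _)

/-- The general entry loci of a cone over a twisted cubic are pairs of rulings. -/
theorem IsCubicCone.typeA_and_typeII_iff [IsAlgClosed k] [CharZero k] (h : IsCubicCone e X)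
    (hX : IsClosed X) : TypeA X ∧ (TypeII X ↔ ∃ v ∈ X, IsCone X v) := by
  set n2 : MvPolynomial (Fin 5) k := coordForm e 0 * coordForm e 2 - coordForm e 1 ^ 2 with hn2
  set n1 : MvPolynomial (Fin 5) k :=
    coordForm e 1 * coordForm e 2 - coordForm e 0 * coordForm e 3 with hn1
  set n0 : MvPolynomial (Fin 5) k := coordForm e 1 * coordForm e 3 - coordForm e 2 ^ 2 with hn0
  have c := isHomogeneous_coordForm e
  have i2 : n2.IsHomogeneous 2 := ((c 0).mul (c 2)).sub ((c 1).pow 2)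
  have i1 : n1.IsHomogeneous 2 := ((c 1).mul (c 2)).sub ((c 0).mul (c 3))
  have i0 : n0.IsHomogeneous 2 := ((c 1).mul (c 3)).sub ((c 2).pow 2)
  have iD : (n2 * (n1 ^ 2 - C 4 * (n0 * n2))).IsHomogeneous (2 + 2 * 2) := by
    refine i2.mul ((i1.pow 2).sub ?_)
    simpa using (isHomogeneous_C (Fin 5) (4 : k)).mul (i0.mul i2)
  set U : Set (PS k 5) := (V0 (n2 * (n1 ^ 2 - C 4 * (n0 * n2))))ᶜ with hUdef
  have hU : IsOpen U := (isClosed_V0 iD).isOpen_compl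
  have hmem : ∀ v (hv : v ≠ 0), Projectivization.mk k v hv ∈ U ↔
      (e v 0 * e v 2 - e v 1 ^ 2) * ((e v 1 * e v 2 - e v 0 * e v 3) ^ 2 -
        4 * ((e v 1 * e v 3 - e v 2 ^ 2) * (e v 0 * e v 2 - e v 1 ^ 2))) ≠ 0 := by
    intro v hv
    rw [hUdef, Set.mem_compl_iff, mk_mem_V0_iff iD]
    simp [n0, n1, n2]
  have hne : U.Nonempty := by
    have h0 : e.symm ![1, 0, 1, 0, 0] ≠ 0 := symm_ne_zero 0 (by simp)
    exact ⟨Projectivization.mk k _ h0, (hmem _ _).mpr (by simp)⟩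
  let W : k × k → Submodule k (Fin 5 → k) := fun t =>
    LinearMap.ker ((LinearMap.proj 2 - (t.1 + t.2) • LinearMap.proj 1
      + (t.1 * t.2) • LinearMap.proj 0 : (Fin 5 → k) →ₗ[k] k).comp e.toLinearMap) ⊓
    LinearMap.ker ((LinearMap.proj 3 - (t.1 + t.2) • LinearMap.proj 2
      + (t.1 * t.2) • LinearMap.proj 1 : (Fin 5 → k) →ₗ[k] k).comp e.toLinearMap)
  have hW : ∀ t v, v ∈ W t ↔ e v 2 = (t.1 + t.2) * e v 1 - t.1 * t.2 * e v 0 ∧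
      e v 3 = (t.1 + t.2) * e v 2 - t.1 * t.2 * e v 1 := by
    intro t v
    simp [W]
    grind
  have hex : ∀ q ∈ U, ∃ m, q ∈ linSet (W m) := by
    intro q hq
    induction q using Projectivization.ind with | _ v hv =>
    rw [hmem] at hq
    have hn := left_ne_zero_of_mul hq
    obtain ⟨δ, hδ⟩ := IsAlgClosed.exists_pow_nat_eq ((e v 1 * e v 2 - e v 0 * e v 3) ^ 2 -
        4 * ((e v 1 * e v 3 - e v 2 ^ 2) * (e v 0 * e v 2 - e v 1 ^ 2))) (n := 2) two_pos
    have hi := mul_inv_cancel₀ hn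
    set i := (e v 0 * e v 2 - e v 1 ^ 2)⁻¹
    have h2 : (2 : k) * 2⁻¹ = 1 := mul_inv_cancel₀ two_ne_zero
    set j := (2 : k)⁻¹
    have hs : (-(e v 1 * e v 2 - e v 0 * e v 3) + δ) * i * j
        + (-(e v 1 * e v 2 - e v 0 * e v 3) - δ) * i * j
        = -(e v 1 * e v 2 - e v 0 * e v 3) * i := by
      linear_combination (-(e v 1 * e v 2 - e v 0 * e v 3) * i) * h2
    have hp : ((-(e v 1 * e v 2 - e v 0 * e v 3) + δ) * i * j)
        * ((-(e v 1 * e v 2 - e v 0 * e v 3) - δ) * i * j)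
        = (e v 1 * e v 3 - e v 2 ^ 2) * i := by
      have : ((-(e v 1 * e v 2 - e v 0 * e v 3) + δ) * i * j)
        * ((-(e v 1 * e v 2 - e v 0 * e v 3) - δ) * i * j)
        = ((e v 1 * e v 2 - e v 0 * e v 3) ^ 2 - δ ^ 2) * i ^ 2 * j ^ 2 := by ring
      rw [this, hδ]
      linear_combination ((e v 1 * e v 3 - e v 2 ^ 2) * i) * hi * (4 * j ^ 2)
        + ((e v 1 * e v 3 - e v 2 ^ 2) * i) * (2 * j + 1) * h2
    refine ⟨((-(e v 1 * e v 2 - e v 0 * e v 3) + δ) * i * j,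
      (-(e v 1 * e v 2 - e v 0 * e v 3) - δ) * i * j), ?_⟩
    rw [mk_mem_linSet, hW]
    simp only [hs, hp]
    exact ⟨by linear_combination (-e v 2) * hi, by linear_combination (-e v 3) * hi⟩
  have hdist : ∀ t : k × k, ∀ v (hv : v ≠ 0), Projectivization.mk k v hv ∈ U → v ∈ W t →
      e v 0 * e v 2 - e v 1 ^ 2 ≠ 0 ∧ t.1 ≠ t.2 := by
    intro t v hv hq ht
    rw [hmem] at hq
    rw [hW] at ht
    refine ⟨left_ne_zero_of_mul hq, fun h12 => right_ne_zero_of_mul hq ?_⟩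
    rw [ht.2, ht.1, h12]; ring
  have hE : ∀ m, ∀ q ∈ U, q ∈ linSet (W m) →
      entryLocus X q = linePair e m ∧ q ∈ linSet (pspan (entryLocus X q)) := by
    intro m q hq hqm
    induction q using Projectivization.ind with | _ v hv =>
    rw [mk_mem_linSet] at hqm
    obtain ⟨h1, h2⟩ := hdist m v hv hq hqm
    rw [hW] at hqm
    exact h.entryLocus_eq hX hv h1 m h2 hqm.1 hqm.2
  have hirr : ∀ q ∈ U, ¬ IsIrreducible (entryLocus X q) := by
    intro q hq
    obtain ⟨m, hm⟩ := hex q hq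
    rw [(hE m q hq hm).1]
    induction q using Projectivization.ind with | _ v hv =>
    rw [mk_mem_linSet] at hm
    exact not_isIrreducible_linePair (hdist m v hv hq hm).2
  refine ⟨typeA_of hU hne (linePair e) W ?_ hex hE, fun _ => h.exists_vertex hX,
    fun _ => generic_of hU hne hirr⟩
  intro m p hp
  induction p using Projectivization.ind with | _ v hv =>
  rw [mk_mem_linSet, hW]
  rcases hp with hp | hp
  all_goals
    rw [mk_mem_linSet, mem_coneLine] at hp
    obtain ⟨h1, h2, h3⟩ := hp
    rw [h3, h2, h1]
    constructor <;> ring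

end CubicCone

section ConeIdeal
variable {k : Type} [Field k] {n : ℕ}

/-- The affine cone over a set of projective points. -/
def affCone (X : Set (PS k n)) : Set (Fin n → k) :=
  {v | ∀ hv : v ≠ 0, Projectivization.mk k v hv ∈ X}

theorem mem_affCone {X : Set (PS k n)} {v : Fin n → k} (hv : v ≠ 0) :
    v ∈ affCone X ↔ Projectivization.mk k v hv ∈ X := ⟨fun h => h hv, fun h _ => h⟩

theorem smul_mem_affCone {X : Set (PS k n)} {v : Fin n → k} (h : v ∈ affCone X) (c : k) :
    c • v ∈ affCone X := by
  intro hc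
  have hv : v ≠ 0 := right_ne_zero_of_smul hc
  rw [(Projectivization.mk_eq_mk_iff' k (c • v) v hc hv).mpr ⟨c, rfl⟩]
  exact h hv

/-- The ideal of the affine cone. -/
def coneIdeal (X : Set (PS k n)) : Ideal (MvPolynomial (Fin n) k) :=
  vanishingIdeal k (affCone X)

theorem mem_coneIdeal {X : Set (PS k n)} {f : MvPolynomial (Fin n) k} :
    f ∈ coneIdeal X ↔ ∀ v ∈ affCone X, eval v f = 0 := by
  simp [coneIdeal, mem_vanishingIdeal_iff, aeval_eq_eval]

theorem eval_smul_eq_sum (f : MvPolynomial (Fin n) k) (v : Fin n → k) (c : k) :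
    eval (c • v) f = ∑ d ∈ Finset.range (f.totalDegree + 1),
      c ^ d * eval v (homogeneousComponent d f) := by
  conv_lhs => rw [← sum_homogeneousComponent f, map_sum]
  exact Finset.sum_congr rfl fun d _ =>
    eval_smul_of_isHomogeneous (homogeneousComponent_isHomogeneous d f) c v

theorem homogeneousComponent_mem_coneIdeal [Infinite k] {X : Set (PS k n)}
    {f : MvPolynomial (Fin n) k} (hf : f ∈ coneIdeal X) (d : ℕ) :
    homogeneousComponent d f ∈ coneIdeal X := by
  rw [mem_coneIdeal] at *
  intro v hv
  let p : Polynomial k := ∑ d ∈ Finset.range (f.totalDegree + 1),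
    Polynomial.C (eval v (homogeneousComponent d f)) * Polynomial.X ^ d
  have hp : p = 0 := by
    refine Polynomial.funext fun c => ?_
    have := hf _ (smul_mem_affCone hv c)
    rw [eval_smul_eq_sum] at this
    simp only [p, Polynomial.eval_finsetSum, Polynomial.eval_mul, Polynomial.eval_C,
      Polynomial.eval_pow, Polynomial.eval_X, Polynomial.eval_zero]
    rw [← this]
    exact Finset.sum_congr rfl fun _ _ => mul_comm _ _
  by_cases hd : d < f.totalDegree + 1
  · have := congrArg (Polynomial.coeff · d) hp
    simpa [p, Polynomial.finsetSum_coeff, Polynomial.coeff_C_mul, Polynomial.coeff_X_pow, hd]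
      using this
  · rw [homogeneousComponent_eq_zero _ _ (by omega), map_zero]

theorem exists_homogeneous_of_notMem_coneIdeal [Infinite k] {X : Set (PS k n)} (hX : IsClosed X)
    {v : Fin n → k} (hv : v ∉ affCone X) :
    ∃ f ∈ coneIdeal X, eval v f ≠ 0 := by
  simp only [affCone, Set.mem_ofPred_eq, not_forall] at hv
  obtain ⟨hv, hvX⟩ := hv
  obtain ⟨d, f, hf, hfv, hfU⟩ := exists_V0_compl_subset hX.isOpen_compl hv hvX
  obtain ⟨i, hi⟩ := Function.ne_iff.mp hv
  refine ⟨f * MvPolynomial.X i, mem_coneIdeal.mpr fun w hw => ?_, by simpa [hfv] using hi⟩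
  by_cases hw0 : w = 0
  · simp [hw0]
  · by_contra h
    rw [map_mul] at h
    exact hfU w hw0 (left_ne_zero_of_mul h) (hw hw0)

theorem mem_affCone_iff [Infinite k] {X : Set (PS k n)} (hX : IsClosed X) {v : Fin n → k} :
    v ∈ affCone X ↔ ∀ f ∈ coneIdeal X, eval v f = 0 := by
  refine ⟨fun h f hf => mem_coneIdeal.mp hf v h, fun h => ?_⟩
  by_contra hv
  obtain ⟨f, hf, hfv⟩ := exists_homogeneous_of_notMem_coneIdeal hX hv
  exact hfv (h f hf)

theorem subset_V0_of_mem_coneIdeal {X : Set (PS k n)} {f : MvPolynomial (Fin n) k}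
    (hf : f ∈ coneIdeal X) : X ⊆ V0 f := by
  rintro p hp v hv rfl
  exact mem_coneIdeal.mp hf v fun _ => hp

theorem mem_coneIdeal_iff_subset_V0 {X : Set (PS k n)} (hne : X.Nonempty) {d : ℕ}
    {f : MvPolynomial (Fin n) k} (hf : f.IsHomogeneous d) : f ∈ coneIdeal X ↔ X ⊆ V0 f := by
  refine ⟨subset_V0_of_mem_coneIdeal, fun h => mem_coneIdeal.mpr fun v hv => ?_⟩
  by_cases h0 : v = 0
  · obtain ⟨p, hp⟩ := hne
    induction p using Projectivization.ind with | _ w hw =>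
    have := eval_smul_of_isHomogeneous hf 0 w
    rw [h hp w hw rfl] at this
    simpa [h0] using this
  · exact h (hv h0) v h0 rfl

theorem isPrime_coneIdeal [Infinite k] {X : Set (PS k n)} (hX : IsIrreducible X) :
    (coneIdeal X).IsPrime := by
  let := MvPolynomial.gradedAlgebra (σ := Fin n) (R := k)
  have hhom : (coneIdeal X).IsHomogeneous (homogeneousSubmodule (Fin n) k) := by
    intro i f hf
    change ((decomposition.decompose' f i : homogeneousSubmodule (Fin n) k i) : MvPolynomial (Fin n) k) ∈ _
    rw [decomposition.decompose'_apply]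
    exact homogeneousComponent_mem_coneIdeal hf i
  refine hhom.isPrime_of_homogeneous_mem_or_mem ?_ ?_
  · rw [Ne, Ideal.eq_top_iff_one]
    intro h
    obtain ⟨p, hp⟩ := hX.nonempty
    have := mem_coneIdeal.mp h 0 (fun h => absurd rfl h)
    simp at this
  · rintro f g ⟨d, hf⟩ ⟨e, hg⟩ hfg
    rw [mem_homogeneousSubmodule] at hf hg
    rw [mem_coneIdeal_iff_subset_V0 hX.nonempty hf, mem_coneIdeal_iff_subset_V0 hX.nonempty hg]
    refine isPreirreducible_iff_isClosed_union_isClosed.mp hX.isPreirreducible _ _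
      (isClosed_V0 hf) (isClosed_V0 hg) ?_
    intro p hp
    have := subset_V0_of_mem_coneIdeal hfg hp
    induction p using Projectivization.ind with | _ v hv =>
    rw [mk_mem_V0_iff (hf.mul hg), map_mul, mul_eq_zero] at this
    rwa [Set.mem_union, mk_mem_V0_iff hf, mk_mem_V0_iff hg]

theorem eq_zero_of_lin_mem_coneIdeal {X : Set (PS k n)} (hnd : Nondeg X)
    {φ : Module.Dual k (Fin n → k)} (h : lin φ ∈ coneIdeal X) : φ = 0 := by
  have h1 : pspan X ≤ LinearMap.ker φ := by
    rw [pspan_le_iff]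
    intro p hp
    have := subset_V0_of_mem_coneIdeal h hp
    induction p using Projectivization.ind with | _ v hv =>
    rw [mk_mem_V0_iff (isHomogeneous_lin φ), eval_lin] at this
    exact (mk_mem_linSet hv).mpr this
  rw [hnd, top_le_iff, LinearMap.ker_eq_top] at h1
  exact h1

end ConeIdeal

section CoordRing
variable {k : Type} [Field k] {n : ℕ}

theorem homogeneousComponent_add_mul {σ : Type} {e : ℕ} {l : MvPolynomial σ k}
    (hl : l.IsHomogeneous e) (g : MvPolynomial σ k) (d : ℕ) :
    homogeneousComponent (d + e) (g * l) = homogeneousComponent d g * l := by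
  conv_lhs => rw [← sum_homogeneousComponent g, Finset.sum_mul, map_sum]
  have h (i : ℕ) : homogeneousComponent (d + e) (homogeneousComponent i g * l) =
      if i = d then homogeneousComponent d g * l else 0 := by
    rw [homogeneousComponent_of_mem ((homogeneousComponent_isHomogeneous i g).mul hl)]
    by_cases h : i = d
    · simp [h]
    · rw [if_neg h, if_neg (by omega)]
  rw [Finset.sum_congr rfl fun i _ => h i, Finset.sum_ite_eq']
  split_ifs with hd
  · rfl
  · rw [homogeneousComponent_eq_zero, zero_mul]
    simpa using hd

theorem homogeneousComponent_mul_eq_zero {σ : Type} {e : ℕ} {l : MvPolynomial σ k}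
    (hl : l.IsHomogeneous e) (g : MvPolynomial σ k) {d : ℕ} (hd : d < e) :
    homogeneousComponent d (g * l) = 0 := by
  conv_lhs => rw [← sum_homogeneousComponent g, Finset.sum_mul, map_sum]
  refine Finset.sum_eq_zero fun i _ => ?_
  rw [homogeneousComponent_of_mem ((homogeneousComponent_isHomogeneous i g).mul hl),
    if_neg (by omega)]

/-- The homogeneous coordinate ring. -/
abbrev CoordRing (X : Set (PS k n)) : Type := MvPolynomial (Fin n) k ⧸ coneIdeal X

/-- Linear forms as elements of the homogeneous coordinate ring. -/
def form (X : Set (PS k n)) : Module.Dual k (Fin n → k) →ₗ[k] CoordRing X :=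
  (Ideal.Quotient.mkₐ k (coneIdeal X)).toLinearMap ∘ₗ lin

theorem form_apply (X : Set (PS k n)) (φ : Module.Dual k (Fin n → k)) :
    form X φ = Ideal.Quotient.mk _ (lin φ) := rfl

theorem form_eq_zero_iff {X : Set (PS k n)} (hnd : Nondeg X) {φ : Module.Dual k (Fin n → k)} :
    form X φ = 0 ↔ φ = 0 := by
  refine ⟨fun h => eq_zero_of_lin_mem_coneIdeal hnd ?_, fun h => by rw [h, map_zero]⟩
  rwa [form_apply, Ideal.Quotient.eq_zero_iff_mem] at h

/-- Evaluation at a point of the affine cone. -/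
def evalPt {X : Set (PS k n)} {v : Fin n → k} (hv : v ∈ affCone X) : CoordRing X →ₐ[k] k :=
  Ideal.Quotient.liftₐ (coneIdeal X) (aeval v) fun f hf => by
    rw [aeval_eq_eval]; exact mem_coneIdeal.mp hf v hv

theorem evalPt_mk {X : Set (PS k n)} {v : Fin n → k} (hv : v ∈ affCone X)
    (f : MvPolynomial (Fin n) k) : evalPt hv (Ideal.Quotient.mk _ f) = eval v f := by
  simp [evalPt, Ideal.Quotient.liftₐ_apply]

@[simp] theorem evalPt_form {X : Set (PS k n)} {v : Fin n → k} (hv : v ∈ affCone X)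
    (φ : Module.Dual k (Fin n → k)) : evalPt hv (form X φ) = φ v := by
  rw [form_apply, evalPt_mk, eval_lin]

theorem lin_proj (i : Fin n) : lin (LinearMap.proj i : Module.Dual k (Fin n → k)) = X i := by
  classical
  simp [lin_apply, Pi.single_apply]

theorem mk_eq_aeval_form (X : Set (PS k n)) (f : MvPolynomial (Fin n) k) :
    Ideal.Quotient.mk (coneIdeal X) f = aeval (fun i => form X (LinearMap.proj i)) f := by
  simp_rw [form_apply, lin_proj]
  induction f using MvPolynomial.induction_on with
  | C a => rw [aeval_C]; rfl
  | add p q hp hq => simp [hp, hq]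
  | mul_X p i hp => simp [hp]

theorem exists_evalPt_eq [Infinite k] {X : Set (PS k n)} (hX : IsClosed X)
    (ψ : CoordRing X →ₐ[k] k) :
    ∃ (v : Fin n → k) (hv : v ∈ affCone X), ψ = evalPt hv := by
  let v : Fin n → k := fun i => ψ (form X (LinearMap.proj i))
  have h (f : MvPolynomial (Fin n) k) : ψ (Ideal.Quotient.mk _ f) = eval v f := by
    rw [mk_eq_aeval_form, ← AlgHom.comp_apply, comp_aeval, aeval_eq_eval]
  have hv : v ∈ affCone X := by
    rw [mem_affCone_iff hX]
    intro f hf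
    rw [← h, Ideal.Quotient.eq_zero_iff_mem.mpr hf, map_zero]
  refine ⟨v, hv, AlgHom.ext fun s => ?_⟩
  obtain ⟨f, rfl⟩ := Ideal.Quotient.mk_surjective s
  rw [h, evalPt_mk]

/-- The form in the coordinate ring given by a polynomial in linear forms, as the class of a
polynomial. -/
theorem aeval_form (X : Set (PS k n)) {m : ℕ} (l : Fin m → Module.Dual k (Fin n → k))
    (F : MvPolynomial (Fin m) k) :
    aeval (fun i => form X (l i)) F = Ideal.Quotient.mk _ (aeval (fun i => lin (l i)) F) := by
  induction F using MvPolynomial.induction_on with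
  | C a => simp only [algHom_C]; rfl
  | add p q hp hq => simp [hp, hq]
  | mul_X p i hp => rw [map_mul, map_mul, map_mul, hp, aeval_X, aeval_X, form_apply]

theorem isHomogeneous_aeval_lin {m d : ℕ} (l : Fin m → Module.Dual k (Fin n → k))
    {F : MvPolynomial (Fin m) k} (hF : F.IsHomogeneous d) :
    (aeval (fun i => lin (l i)) F).IsHomogeneous d := by
  have := hF.aeval (fun i => lin (l i)) fun i => isHomogeneous_lin (l i)
  rwa [one_mul] at this

theorem homogeneousComponent_aeval_lin {m : ℕ} (l : Fin m → Module.Dual k (Fin n → k))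
    (F : MvPolynomial (Fin m) k) (d : ℕ) :
    homogeneousComponent d (aeval (fun i => lin (l i)) F) =
      aeval (fun i => lin (l i)) (homogeneousComponent d F) := by
  conv_lhs => rw [← sum_homogeneousComponent F, map_sum, map_sum]
  have h (i : ℕ) : homogeneousComponent d
      (aeval (fun i => lin (l i)) (homogeneousComponent i F)) =
      if i = d then aeval (fun i => lin (l i)) (homogeneousComponent d F) else 0 := by
    rw [homogeneousComponent_of_mem
      (isHomogeneous_aeval_lin l (homogeneousComponent_isHomogeneous i F))]
    by_cases h : i = d
    · simp [h]
    · rw [if_neg h, if_neg (Ne.symm h)]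
  rw [Finset.sum_congr rfl fun i _ => h i, Finset.sum_ite_eq']
  split_ifs with hd
  · rfl
  · rw [homogeneousComponent_eq_zero, map_zero]
    simpa using hd

/-- Relations between linear forms split into homogeneous relations. -/
theorem aeval_form_homogeneousComponent [Infinite k] {X : Set (PS k n)} {m : ℕ}
    {l : Fin m → Module.Dual k (Fin n → k)} {F : MvPolynomial (Fin m) k}
    (h : aeval (fun i => form X (l i)) F = 0) (d : ℕ) :
    aeval (fun i => form X (l i)) (homogeneousComponent d F) = 0 := by
  rw [aeval_form, Ideal.Quotient.eq_zero_iff_mem] at *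
  rw [← homogeneousComponent_aeval_lin]
  exact homogeneousComponent_mem_coneIdeal h d

end CoordRing

section Noether
variable {k : Type} [Field k] {n : ℕ}

theorem monomial_mem_of_X_pow_mem {I : Ideal (MvPolynomial (Fin n) k)} {N : ℕ}
    (h : ∀ i, (X i : MvPolynomial (Fin n) k) ^ N ∈ I) {f : MvPolynomial (Fin n) k} {d : ℕ}
    (hf : f.IsHomogeneous d) (hd : n * N + 1 ≤ d) : f ∈ I := by
  rw [f.as_sum]
  refine Ideal.sum_mem _ fun m hm => ?_
  have hmd : ∑ i, m i = d := by
    have := hf (mem_support_iff.mp hm)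
    rw [← this, Finsupp.weight_apply, Finsupp.sum_fintype _ _ (by simp)]; simp
  obtain ⟨i, hi⟩ : ∃ i, N ≤ m i := by
    by_contra! hcon
    have : ∑ i, m i ≤ ∑ _i : Fin n, N := Finset.sum_le_sum fun i _ => (hcon i).le
    simp at this
    omega
  have : (monomial m) (coeff m f) =
      monomial (m - Finsupp.single i N) (coeff m f) * (X i : MvPolynomial (Fin n) k) ^ N := by
    rw [X_pow_eq_monomial, monomial_mul, mul_one, tsub_add_cancel_of_le]
    simpa using hi
  rw [this]
  exact Ideal.mul_mem_left _ _ (h i)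

/-- Noether normalization by linear forms: if homogeneous equations together with linear forms
have only the trivial common zero, then everything is integral over the linear forms. -/
theorem isIntegral_adjoin_of_forall_eq_zero [IsAlgClosed k] {m : ℕ}
    {J : Ideal (MvPolynomial (Fin n) k)} (hJ : ∀ f ∈ J, ∀ d, homogeneousComponent d f ∈ J)
    {l : Fin m → Module.Dual k (Fin n → k)}
    (h0 : ∀ v : Fin n → k, (∀ f ∈ J, eval v f = 0) → (∀ i, l i v = 0) → v = 0)
    {B : Type} [CommRing B] [Algebra k B] (φ : MvPolynomial (Fin n) k →ₐ[k] B)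
    (hφ : ∀ f ∈ J, φ f = 0) (f : MvPolynomial (Fin n) k) :
    IsIntegral (Algebra.adjoin k (Set.range fun i => φ (lin (l i)))) (φ f) := by
  set R := Algebra.adjoin k (Set.range fun i => φ (lin (l i)))
  let I := J ⊔ Ideal.span (Set.range fun i => lin (l i))
  have hrad (i : Fin n) : (X i : MvPolynomial (Fin n) k) ∈ I.radical := by
    rw [← vanishingIdeal_zeroLocus_eq_radical (K := k), mem_vanishingIdeal_iff]
    intro v hv
    rw [aeval_eq_eval]
    have hv' : ∀ p ∈ I, eval v p = 0 := fun p hp => by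
      have := mem_zeroLocus_iff.mp hv p hp
      rwa [aeval_eq_eval] at this
    rw [h0 v (fun f hf => hv' f (Ideal.mem_sup_left hf)) fun j => by
      rw [← eval_lin]
      exact hv' _ (Ideal.mem_sup_right (Ideal.subset_span ⟨j, rfl⟩))]
    simp
  choose N hN using hrad
  let M := ∑ i, N i
  have hM (i : Fin n) : (X i : MvPolynomial (Fin n) k) ^ M ∈ I :=
    I.pow_mem_of_pow_mem (hN i) (Finset.single_le_sum (fun _ _ => Nat.zero_le _) (Finset.mem_univ i))
  let D := n * M + 1
  let T : Set B := φ '' (fun s : Fin n →₀ ℕ => monomial s (1 : k)) '' {s | s.degree < D}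
  have hT : T.Finite := by
    refine (Set.Finite.image _ ?_).image _
    exact Finsupp.finite_of_degree_lt D
  let Q : Submodule R B := Submodule.span R T
  have hQ : ∀ d, ∀ f : MvPolynomial (Fin n) k, f.IsHomogeneous d → φ f ∈ Q := by
    intro d
    induction d using Nat.strong_induction_on with | _ d ih =>
    intro f hf
    by_cases hd : d < D
    · rw [f.as_sum, map_sum]
      refine Submodule.sum_mem _ fun s hs => ?_
      have hsd : s.degree = d := by
        have := hf (mem_support_iff.mp hs)
        rw [← this, Finsupp.degree_eq_weight_one]; rfl
      have : φ (monomial s (coeff s f)) = (algebraMap k R (coeff s f)) • φ (monomial s 1) := by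
        rw [algebraMap_smul, ← map_smul, smul_monomial, smul_eq_mul, mul_one]
      rw [this]
      exact Q.smul_mem _ (Submodule.subset_span ⟨_, ⟨s, by simpa [hsd] using hd, rfl⟩, rfl⟩)
    · obtain ⟨e, rfl⟩ : ∃ e, d = e + 1 := ⟨d - 1, by omega⟩
      have hfI : f ∈ I := monomial_mem_of_X_pow_mem hM hf (by omega)
      obtain ⟨j, hj, g, hg, rfl⟩ := Submodule.mem_sup.mp hfI
      rw [← homogeneousComponent_of_mem hf |>.trans (if_pos rfl)]
      rw [map_add, map_add, hφ _ (hJ j hj _), zero_add]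
      obtain ⟨c, rfl⟩ := (Ideal.mem_span_range_iff_exists_fun).mp hg
      rw [map_sum, map_sum]
      refine Submodule.sum_mem _ fun i _ => ?_
      rw [homogeneousComponent_add_mul (isHomogeneous_lin _), map_mul, mul_comm]
      exact Q.smul_mem (⟨φ (lin (l i)), Algebra.subset_adjoin ⟨i, rfl⟩⟩ : R)
        (ih e (by omega) _ (homogeneousComponent_isHomogeneous e _))
  have hQ' (f) : φ f ∈ Q := by
    rw [← sum_homogeneousComponent f, map_sum]
    exact Submodule.sum_mem _ fun i _ => hQ i _ (homogeneousComponent_isHomogeneous i f)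
  have hR (r : R) : (r : B) ∈ φ.range := by
    refine Algebra.adjoin_le (S := φ.range) ?_ r.2
    rintro _ ⟨i, rfl⟩
    exact ⟨_, rfl⟩
  let A : Subalgebra R B := { φ.range.toSubring with algebraMap_mem' := fun r => hR r }
  have hAQ : Subalgebra.toSubmodule A = Q := by
    refine le_antisymm ?_ (Submodule.span_le.mpr ?_)
    · rintro _ ⟨g, rfl⟩; exact hQ' g
    · rintro _ ⟨_, ⟨s, _, rfl⟩, rfl⟩; exact ⟨_, rfl⟩
  refine IsIntegral.of_mem_of_fg A ?_ _ ⟨f, rfl⟩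
  rw [hAQ]
  exact Submodule.fg_span hT

end Noether

section Extension
variable {k : Type} [Field k] [IsAlgClosed k]

/-- Characters extend along integral extensions. -/
theorem exists_algHom_extension_of_isIntegral {B S : Type} [CommRing B] [CommRing S]
    [Algebra k B] [Algebra k S] [Algebra B S] [IsScalarTower k B S] [FaithfulSMul B S]
    [Algebra.IsIntegral B S] (ψ : B →ₐ[k] k) :
    ∃ ψ' : S →ₐ[k] k, ∀ b, ψ' (algebraMap B S b) = ψ b := by
  have hsurj : Function.Surjective ψ := fun c => ⟨algebraMap k B c, by simp⟩
  have hmax : (RingHom.ker ψ).IsMaximal := RingHom.ker_isMaximal_of_surjective ψ hsurj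
  obtain ⟨Q, hQ, hQc⟩ := Ideal.exists_ideal_over_maximal_of_isIntegral (S := S) (RingHom.ker ψ)
    (by rw [(RingHom.injective_iff_ker_eq_bot _).mp (FaithfulSMul.algebraMap_injective B S)]
        exact bot_le)
  have hb (b : B) : Ideal.Quotient.mk Q (algebraMap B S b) = algebraMap k (S ⧸ Q) (ψ b) := by
    have : b - algebraMap k B (ψ b) ∈ Q.comap (algebraMap B S) := by
      rw [hQc, RingHom.mem_ker]; simp
    rw [Ideal.mem_comap, map_sub, ← IsScalarTower.algebraMap_apply,
      ← Ideal.Quotient.eq_zero_iff_mem, map_sub, sub_eq_zero] at this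
    exact this
  let := Ideal.Quotient.field Q
  have hInt : Algebra.IsIntegral k (S ⧸ Q) := by
    refine ⟨fun s => ?_⟩
    obtain ⟨s, rfl⟩ := Ideal.Quotient.mk_surjective s
    obtain ⟨p, hp, hps⟩ := Algebra.IsIntegral.isIntegral (R := B) s
    refine ⟨p.map (ψ : B →+* k), hp.map _, ?_⟩
    have h2 := congrArg (Ideal.Quotient.mk Q) hps
    rw [Polynomial.hom_eval₂, map_zero] at h2
    rw [Polynomial.eval₂_map, ← h2]
    congr 1
    ext b
    exact (hb b).symm
  have hbij := IsAlgClosed.algebraMap_bijective_of_isIntegral (k := k) (K := S ⧸ Q)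
  let e : k ≃ₐ[k] S ⧸ Q := AlgEquiv.ofBijective (Algebra.ofId k _) hbij
  refine ⟨(e.symm : (S ⧸ Q) →ₐ[k] k).comp (Ideal.Quotient.mkₐ k Q), fun b => ?_⟩
  rw [AlgHom.comp_apply, Ideal.Quotient.mkₐ_eq_mk, hb]
  exact e.symm_apply_eq.mpr rfl

/-- Generic characters extend along algebraic extensions of finite type. -/
theorem exists_algHom_extension {B S : Type} [CommRing B] [IsDomain B] [CommRing S] [IsDomain S]
    [Algebra k B] [Algebra k S] [Algebra B S] [IsScalarTower k B S] [FaithfulSMul B S]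
    [Algebra.IsAlgebraic B S] [Algebra.FiniteType k S] :
    ∃ b : B, b ≠ 0 ∧ ∀ ψ : B →ₐ[k] k, ψ b ≠ 0 →
      ∃ ψ' : S →ₐ[k] k, ∀ b, ψ' (algebraMap B S b) = ψ b := by
  obtain ⟨T, hT⟩ := Algebra.FiniteType.out (R := k) (A := S)
  obtain ⟨a, ha, haT⟩ := Algebra.IsAlgebraic.exists_integral_multiples B T
  refine ⟨a, ha, fun ψ hψ => ?_⟩
  let S' := integralClosure B S
  have hmem (s : S) : ∃ n : ℕ, a ^ n • s ∈ S' := by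
    have hs : s ∈ Algebra.adjoin k (T : Set S) := hT ▸ Algebra.mem_top
    induction hs using Algebra.adjoin_induction with
    | mem x hx => exact ⟨1, by rw [pow_one]; exact haT x hx⟩
    | algebraMap c =>
      refine ⟨0, ?_⟩
      rw [pow_zero, one_smul, IsScalarTower.algebraMap_apply k B S]
      exact S'.algebraMap_mem _
    | add x y _ _ hx hy =>
      obtain ⟨n, hn⟩ := hx
      obtain ⟨m, hm⟩ := hy
      refine ⟨n + m, ?_⟩
      rw [smul_add]
      refine S'.add_mem ?_ ?_
      · rw [pow_add, mul_comm, mul_smul]; exact S'.smul_mem hn _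
      · rw [pow_add, mul_smul]; exact S'.smul_mem hm _
    | mul x y _ _ hx hy =>
      obtain ⟨n, hn⟩ := hx
      obtain ⟨m, hm⟩ := hy
      refine ⟨n + m, ?_⟩
      rw [pow_add, ← smul_mul_smul_comm]
      exact S'.mul_mem hn hm
  have : IsScalarTower k B S' := ⟨fun x y z => Subtype.ext (by simp)⟩
  obtain ⟨ψ₁, hψ₁⟩ := exists_algHom_extension_of_isIntegral (S := S') ψ
  have hsmul (c : B) (t : S') : ψ₁ (c • t) = ψ c * ψ₁ t := by
    rw [Algebra.smul_def, map_mul, hψ₁]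
  choose N hN using hmem
  let g (s : S) : k := ψ₁ ⟨_, hN s⟩ / ψ a ^ N s
  have key (s : S) (m : ℕ) (t : S') (ht : (t : S) = a ^ m • s) : g s = ψ₁ t / ψ a ^ m := by
    have : a ^ m • (⟨_, hN s⟩ : S') = a ^ (N s) • t := by
      refine Subtype.ext ?_
      change a ^ m • a ^ N s • s = a ^ N s • (t : S)
      rw [ht, smul_comm]
    have h2 := congrArg ψ₁ this
    rw [hsmul, hsmul, map_pow, map_pow] at h2
    rw [div_eq_div_iff (pow_ne_zero _ hψ) (pow_ne_zero _ hψ), mul_comm, h2, mul_comm]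
  have hg (b : B) : g (algebraMap B S b) = ψ b := by
    rw [key _ 0 (algebraMap B S' b) (by rw [pow_zero, one_smul]; rfl), hψ₁]; simp
  refine ⟨AlgHom.mk ⟨⟨⟨g, ?_⟩, ?_⟩, ?_, ?_⟩ ?_, hg⟩
  · rw [← map_one (algebraMap B S), hg, map_one]
  · intro x y
    change g _ = g _ * g _
    rw [key (x * y) (N x + N y) (⟨_, hN x⟩ * ⟨_, hN y⟩) (by
      rw [pow_add, ← smul_mul_smul_comm]; rfl), map_mul, pow_add, mul_div_mul_comm]
  · change g 0 = 0
    rw [← map_zero (algebraMap B S), hg, map_zero]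
  · intro x y
    change g _ = g _ + g _
    rw [key (x + y) (N x + N y) (a ^ N y • ⟨_, hN x⟩ + a ^ N x • ⟨_, hN y⟩) (by
      change a ^ N y • a ^ N x • x + a ^ N x • a ^ N y • y = _
      rw [smul_add, smul_smul, smul_smul, pow_add, mul_comm (a ^ N y)])]
    rw [map_add, hsmul, hsmul, map_pow, map_pow, pow_add, add_div,
      mul_div_mul_left _ _ (pow_ne_zero _ hψ), mul_comm (ψ a ^ N x) (ψ a ^ N y),
      mul_div_mul_left _ _ (pow_ne_zero _ hψ)]
  · intro c
    change g _ = _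
    rw [IsScalarTower.algebraMap_apply k B S, hg]
    simp

/-- A generic character of a normal domain has as many extensions, told apart by the value
of an integral element, as the degree of that element. -/
theorem exists_algHom_extension_card [CharZero k] {A S : Type} [CommRing A] [IsDomain A]
    [IsIntegrallyClosed A] [CommRing S] [IsDomain S] [Algebra k A] [Algebra k S] [Algebra A S]
    [IsScalarTower k A S] [FaithfulSMul A S] [Algebra.IsAlgebraic A S] [Algebra.FiniteType k S]
    {θ : S} (hθ : IsIntegral A θ) :
    ∃ h : A, h ≠ 0 ∧ ∀ χ : A →ₐ[k] k, χ h ≠ 0 → ∃ R : Finset k,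
      R.card = (minpoly A θ).natDegree ∧
      ∀ r ∈ R, ∃ ψ : S →ₐ[k] k, (∀ a, ψ (algebraMap A S a) = χ a) ∧ ψ θ = r := by
  let B := Algebra.adjoin A {θ}
  have : Module.IsTorsionFree A S := by
    rw [Module.isTorsionFree_iff_algebraMap_injective]
    exact FaithfulSMul.algebraMap_injective A S
  have hcz : CharZero A := charZero_of_injective_algebraMap (FaithfulSMul.algebraMap_injective k A)
  have : IsScalarTower k B S := ⟨fun x y z => by simp [Algebra.smul_def, mul_assoc]⟩
  have : Algebra.IsAlgebraic B S := Algebra.IsAlgebraic.extendScalars (R := A)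
    (FaithfulSMul.algebraMap_injective A B)
  have : Algebra.IsAlgebraic A B :=
    Algebra.IsAlgebraic.of_injective B.val Subtype.val_injective
  obtain ⟨b, hb, hbe⟩ := exists_algHom_extension (k := k) (B := B) (S := S)
  set μ := minpoly A θ with hμ
  have hd : Polynomial.aeval θ (Polynomial.derivative μ) ≠ 0 := by
    intro h
    have hne : Polynomial.derivative μ ≠ 0 := by
      intro h0
      exact absurd (Polynomial.derivative_eq_zero.mp h0) (minpoly.natDegree_pos hθ).ne'
    exact absurd (minpoly.IsIntegrallyClosed.degree_le_of_ne_zero hne h)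
      (not_le.mpr (Polynomial.degree_derivative_lt (minpoly.ne_zero hθ)))
  obtain ⟨d, hd0, s, hds⟩ := (Algebra.IsAlgebraic.isAlgebraic (R := A)
    (Polynomial.aeval θ (Polynomial.derivative μ))).exists_nonzero_dvd (mem_nonZeroDivisors_of_ne_zero hd)
  obtain ⟨a, ha0, s', has⟩ := (Algebra.IsAlgebraic.isAlgebraic (R := A)
    b).exists_nonzero_dvd (mem_nonZeroDivisors_of_ne_zero hb)
  refine ⟨d * a, mul_ne_zero hd0 ha0, fun χ hχ => ?_⟩
  rw [map_mul] at hχ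
  let ν : Polynomial k := μ.map (χ : A →+* k)
  have hν : ν.Monic := (minpoly.monic hθ).map _
  have hext : ∀ r ∈ ν.roots, ∃ ψ : S →ₐ[k] k, (∀ a, ψ (algebraMap A S a) = χ a) ∧ ψ θ = r := by
    intro r hr
    rw [Polynomial.mem_roots hν.ne_zero, Polynomial.IsRoot, Polynomial.eval_map] at hr
    let e := minpoly.equivAdjoin hθ
    let ψ₀ : B →+* k := (AdjoinRoot.lift (χ : A →+* k) r hr).comp (e.symm : B →+* _)
    have hA (a : A) : ψ₀ (algebraMap A B a) = χ a := by
      simp only [ψ₀, RingHom.comp_apply]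
      have : (e.symm : B →+* AdjoinRoot μ) (algebraMap A B a) = AdjoinRoot.of μ a :=
        e.symm.commutes a
      rw [this, AdjoinRoot.lift_of]; rfl
    let ψ₁ : B →ₐ[k] k := AlgHom.mk ψ₀ fun c => by
      change ψ₀ _ = _
      rw [IsScalarTower.algebraMap_apply k A B, hA]; simp
    have hψ₁A (a : A) : ψ₁ (algebraMap A B a) = χ a := hA a
    have hb1 : ψ₁ b ≠ 0 := by
      intro h0
      have := congrArg ψ₁ has
      rw [hψ₁A, map_mul, h0, zero_mul] at this
      exact right_ne_zero_of_mul hχ this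
    obtain ⟨ψ, hψ⟩ := hbe ψ₁ hb1
    refine ⟨ψ, fun a => ?_, ?_⟩
    · rw [IsScalarTower.algebraMap_apply A B S, hψ, hψ₁A]
    · have h1 : θ = algebraMap B S (e (AdjoinRoot.root _)) := by
        simp [e]
      rw [h1, hψ]
      change AdjoinRoot.lift (χ : A →+* k) r hr (e.symm (e _)) = r
      rw [AlgEquiv.symm_apply_apply, AdjoinRoot.lift_root]
  have hnodup : ν.roots.Nodup := by
    classical
    rw [Multiset.nodup_iff_count_le_one]
    intro r
    rw [Polynomial.count_roots]
    by_contra! hcon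
    rw [Polynomial.one_lt_rootMultiplicity_iff_isRoot hν.ne_zero] at hcon
    obtain ⟨ψ, hψ, hψθ⟩ := hext r ((Polynomial.mem_roots hν.ne_zero).mpr hcon.1)
    have h1 := congrArg ψ hds
    rw [hψ, map_mul] at h1
    refine left_ne_zero_of_mul hχ ?_
    rw [h1]
    refine mul_eq_zero_of_left ?_ _
    have h2 := hcon.2
    rw [Polynomial.IsRoot, Polynomial.derivative_map, Polynomial.eval_map, ← hψθ] at h2
    rw [← h2, Polynomial.aeval_def, ← AlgHom.coe_toRingHom, Polynomial.hom_eval₂]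
    congr 1
    ext a
    exact hψ a
  refine ⟨⟨ν.roots, hnodup⟩, ?_, fun r hr => hext r hr⟩
  change ν.roots.card = _
  rw [← IsAlgClosed.splits ν |>.natDegree_eq_card_roots]
  exact (minpoly.monic hθ).natDegree_map _

end Extension

section Dimension
variable {k : Type} [Field k] {n : ℕ}

theorem AlgebraicIndependent.option_of_quotient {R R' : Type} [CommRing R] [IsDomain R]
    [CommRing R'] [Algebra k R] [Algebra k R'] (π : R →ₐ[k] R') {ι : Type} {x : ι → R}
    (hx : AlgebraicIndependent k (π ∘ x)) {f : R} (hf : f ≠ 0) (hπ : π f = 0) :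
    AlgebraicIndependent k (fun o : Option ι => o.elim f x) := by
  rw [(hx.of_comp π).option_iff_transcendental]
  intro halg
  obtain ⟨q, hq0, hq⟩ := halg.exists_nonzero_coeff_and_aeval_eq_zero (mem_nonZeroDivisors_of_ne_zero hf)
  obtain ⟨F, hF⟩ : ∃ F, aeval x F = (q.coeff 0 : R) := by
    change (q.coeff 0 : R) ∈ (aeval x : MvPolynomial ι k →ₐ[k] R).range
    exact (Algebra.adjoin_range_eq_range_aeval k x).le (q.coeff 0).2
  have h1 : π (q.coeff 0 : R) = 0 := by
    rw [Polynomial.aeval_eq_sum_range, Finset.sum_range_succ'] at hq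
    have := congrArg π hq
    rw [map_add, map_sum, map_zero] at this
    rw [Finset.sum_eq_zero fun i _ => ?_, zero_add] at this
    · simpa [Algebra.smul_def] using this
    · rw [Algebra.smul_def, map_mul, map_pow, hπ, zero_pow (by omega), mul_zero]
  rw [← hF, ← AlgHom.comp_apply, comp_aeval] at h1
  have hF0 : F = 0 := (algebraicIndependent_iff.mp hx) F h1
  apply hq0
  apply Subtype.ext
  rw [← hF, hF0, map_zero]; rfl

theorem coneIdeal_lt [Infinite k] {Y Z : Set (PS k n)} (hY : IsClosed Y)
    (h : Y ⊂ Z) : coneIdeal Z < coneIdeal Y := by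
  have hmono {Y Z : Set (PS k n)} (h : Y ⊆ Z) : coneIdeal Z ≤ coneIdeal Y := fun f hf =>
    mem_coneIdeal.mpr fun v hv => mem_coneIdeal.mp hf v fun h0 => h (hv h0)
  refine lt_of_le_of_ne (hmono h.1) fun he => h.2 fun p hp => ?_
  induction p using Projectivization.ind with | _ v hv =>
  rw [← mem_affCone hv, mem_affCone_iff hY, ← he]
  exact fun f hf => mem_coneIdeal.mp hf v fun _ => hp

theorem exists_transcendental_coordRing [Infinite k] {Z : Set (PS k n)} (hZ : Z.Nonempty) :
    ∃ f : MvPolynomial (Fin n) k, Transcendental k (Ideal.Quotient.mk (coneIdeal Z) f) := by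
  obtain ⟨p, hp⟩ := hZ
  induction p using Projectivization.ind with | _ v hv =>
  obtain ⟨i, hi⟩ := Function.ne_iff.mp hv
  refine ⟨MvPolynomial.X i, ?_⟩
  rw [transcendental_iff]
  intro q hq
  have hv' : v ∈ affCone Z := fun _ => hp
  refine Polynomial.funext fun c => ?_
  have := congrArg (evalPt (smul_mem_affCone hv' (c / v i))) hq
  rw [← Polynomial.aeval_algHom_apply, evalPt_mk, map_zero] at this
  have h1 : c / v i * v i = c := div_mul_cancel₀ c hi
  simpa [h1] using this

/-- A surface has coordinate ring of transcendence degree at least three. -/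
theorem three_le_trdeg [Infinite k] {X : Set (PS k n)} (hX : IsClosed X) (hXi : IsIrreducible X)
    (hdim : ((2 : ℕ) : WithBot ℕ∞) ≤ pdim X) : 3 ≤ Algebra.trdeg k (CoordRing X) := by
  obtain ⟨c, hc⟩ := Order.le_krullDim_iff.mp hdim
  have hlen (i : Fin 3) : (i : ℕ) < c.length + 1 := by omega
  have hcont : Continuous (Subtype.val : X → PS k n) := continuous_subtype_val
  let Z (i : Fin 3) : Set (PS k n) := Subtype.val '' (c ⟨i, hlen i⟩ : Set X)
  have hZc (i) : IsClosed (Z i) :=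
    hX.isClosedEmbedding_subtypeVal.isClosedMap _ (c _).isClosed'
  have hZi (i) : IsIrreducible (Z i) := (c _).isIrreducible'.image _ hcont.continuousOn
  have hZlt (i j) (h : i < j) : Z i ⊂ Z j := by
    have h1 : c ⟨i, hlen i⟩ < c ⟨j, hlen j⟩ := c.strictMono h
    exact Subtype.val_injective.image_strictMono h1
  have hpr (i) : (coneIdeal (Z i)).IsPrime := isPrime_coneIdeal (hZi i)
  have hprX := isPrime_coneIdeal hXi
  obtain ⟨f, hf⟩ := exists_transcendental_coordRing (hZi 0).nonempty
  obtain ⟨g, hg, hg'⟩ := SetLike.exists_of_lt (coneIdeal_lt (hZc 0) (hZlt 0 1 (by decide)))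
  obtain ⟨h, hh, hh'⟩ := SetLike.exists_of_lt (coneIdeal_lt (hZc 1) (hZlt 1 2 (by decide)))
  have hle (i : Fin 3) (j : Fin 3) (hij : i < j) := (coneIdeal_lt (hZc i) (hZlt i j hij)).le
  have hle2 : coneIdeal X ≤ coneIdeal (Z 2) := fun f hf =>
    mem_coneIdeal.mpr fun v hv => mem_coneIdeal.mp hf v fun h0 => by
      obtain ⟨x, -, hx⟩ := hv h0
      rw [← hx]; exact x.2
  have a0 : AlgebraicIndependent k
      (fun _ : Unit => Ideal.Quotient.mk (coneIdeal (Z 0)) f) :=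
    algebraicIndependent_unique_type_iff.mpr hf
  have a1 := AlgebraicIndependent.option_of_quotient
    (Ideal.Quotient.factorₐ k (hle 0 1 (by decide)))
    (x := fun _ : Unit => Ideal.Quotient.mk (coneIdeal (Z 1)) f)
    (f := Ideal.Quotient.mk _ g) (by exact a0)
    (by rwa [Ne, Ideal.Quotient.eq_zero_iff_mem])
    (by change Ideal.Quotient.mk _ g = 0; rwa [Ideal.Quotient.eq_zero_iff_mem])
  have a2 := AlgebraicIndependent.option_of_quotient
    (Ideal.Quotient.factorₐ k (hle 1 2 (by decide)))
    (x := fun o : Option Unit => Ideal.Quotient.mk (coneIdeal (Z 2)) (o.elim g fun _ => f))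
    (f := Ideal.Quotient.mk _ h) (by
      convert! a1 using 1
      ext o; cases o <;> rfl)
    (by rwa [Ne, Ideal.Quotient.eq_zero_iff_mem])
    (by change Ideal.Quotient.mk _ h = 0; rwa [Ideal.Quotient.eq_zero_iff_mem])
  have a3 : AlgebraicIndependent k (fun o : Option (Option Unit) =>
      Ideal.Quotient.mk (coneIdeal X) (o.elim h fun o => o.elim g fun _ => f)) := by
    refine AlgebraicIndependent.of_comp (Ideal.Quotient.factorₐ k hle2) ?_
    convert! a2 using 1
    ext o; rcases o with _ | o
    · rfl
    · rfl
  have := a3.cardinalMk_le_trdeg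
  refine le_trans ?_ this
  simp

variable {S : Type} [CommRing S] [IsDomain S] [Algebra k S]

theorem algebraicIndependent_of_isAlgebraic {m : ℕ} (h3 : (m : Cardinal) ≤ Algebra.trdeg k S)
    {x : Fin m → S} (hx : Algebra.IsAlgebraic (Algebra.adjoin k (Set.range x)) S) :
    AlgebraicIndependent k x :=
  (Algebra.IsAlgebraic.isTranscendenceBasis_of_le_trdeg_of_finite k x (by simpa using h3)).1

theorem isAlgebraic_of_algebraicIndependent {m : ℕ} (h3 : Algebra.trdeg k S = m) {x : Fin m → S}
    (hx : AlgebraicIndependent k x) : Algebra.IsAlgebraic (Algebra.adjoin k (Set.range x)) S :=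
  (hx.isTranscendenceBasis_of_trdeg_le_of_finite (by simp [h3])).isAlgebraic

theorem trdeg_le_of_isAlgebraic {m : ℕ} {x : Fin m → S}
    (hx : Algebra.IsAlgebraic (Algebra.adjoin k (Set.range x)) S) : Algebra.trdeg k S ≤ m := by
  refine (Algebra.IsAlgebraic.trdeg_le_cardinalMk k (Set.range x)).trans ?_
  simpa using Cardinal.mk_range_le (f := x)

end Dimension

section Count
variable {k : Type} [Field k]

theorem finrank_comap_span_singleton {m n : ℕ} {L : (Fin (m + n) → k) →ₗ[k] (Fin n → k)}
    (hL : Function.Surjective L) {a : Fin n → k} (ha : a ≠ 0) :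
    Module.finrank k ((k ∙ a).comap L) = m + 1 := by
  set W := (k ∙ a).comap L
  have h1 := LinearMap.finrank_range_add_finrank_ker (L.domRestrict W)
  have h2 := LinearMap.finrank_range_add_finrank_ker L
  rw [LinearMap.range_domRestrict, Submodule.map_comap_eq_of_surjective hL,
    finrank_span_singleton ha] at h1
  rw [LinearMap.range_eq_top.mpr hL, finrank_top, Module.finrank_fin_fun, Module.finrank_fin_fun]
    at h2
  have h3 : Module.finrank k (LinearMap.ker (L.domRestrict W)) = Module.finrank k L.ker := by
    have : L.ker ≤ W := fun v hv => by
      rw [Submodule.mem_comap, LinearMap.mem_ker.mp hv]; exact zero_mem _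
    rw [← (Submodule.comapSubtypeEquivOfLe this).finrank_eq]
    rfl
  omega

theorem isIntegrallyClosed_adjoin {S ι : Type} [CommRing S] [IsDomain S] [Algebra k S] {x : ι → S}
    (hx : AlgebraicIndependent k x) : IsIntegrallyClosed (Algebra.adjoin k (Set.range x)) :=
  IsIntegrallyClosed.of_equiv hx.aevalEquiv.toRingEquiv

theorem pi_surjective_of_linearIndependent {V : Type} [AddCommGroup V] [Module k V]
    [FiniteDimensional k V] {m : ℕ} {l : Fin m → Module.Dual k V} (hl : LinearIndependent k l) :
    Function.Surjective (LinearMap.pi l) := by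
  rw [← LinearMap.dualMap_injective_iff, ← LinearMap.ker_eq_bot, LinearMap.ker_eq_bot']
  intro φ hφ
  have h1 : ∑ i, φ (Pi.single i 1) • l i = 0 := by
    ext v
    have := LinearMap.congr_fun hφ v
    rw [LinearMap.dualMap_apply, LinearMap.zero_apply,
      ← Finset.univ_sum_single (LinearMap.pi l v), map_sum] at this
    rw [LinearMap.zero_apply, ← this, LinearMap.sum_apply]
    refine Finset.sum_congr rfl fun i _ => ?_
    have : Pi.single i (LinearMap.pi l v i) = l i v • (Pi.single i 1 : Fin m → k) := by
      rw [← Pi.single_smul, smul_eq_mul, mul_one, LinearMap.pi_apply]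
    rw [this, map_smul, LinearMap.smul_apply, smul_eq_mul, smul_eq_mul, mul_comm]
  have := Fintype.linearIndependent_iff.mp hl _ h1
  ext i
  simpa using this i

/-- The properties of a surface of minimal degree from which its equations are derived. -/
structure IsCubicSurface (X : Set (PS k 5)) : Prop where
  closed : IsClosed X
  irreducible : IsIrreducible X
  nondeg : Nondeg X
  trdeg_eq : Algebra.trdeg k (CoordRing X) = (3 : ℕ)
  count : ∀ W : Submodule k (Fin 5 → k), Module.finrank k W = 3 → (X ∩ linSet W).Finite →
    (X ∩ linSet W).ncard ≤ 3

theorem IsCubicSurface.isDomain [Infinite k] {X : Set (PS k 5)} (h : IsCubicSurface X) :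
    IsDomain (CoordRing X) :=
  have := isPrime_coneIdeal h.irreducible
  inferInstance

theorem linearIndependent_of_form {n m : ℕ} {X : Set (PS k n)} {l : Fin m → Module.Dual k (Fin n → k)}
    (hl : AlgebraicIndependent k fun i => form X (l i)) : LinearIndependent k l :=
  LinearIndependent.of_comp (form X) hl.linearIndependent

theorem mem_linSet_ker_pi {n m : ℕ} {l : Fin m → Module.Dual k (Fin n → k)} {v : Fin n → k} (hv : v ≠ 0) :
    Projectivization.mk k v hv ∈ linSet (LinearMap.ker (LinearMap.pi l)) ↔ ∀ i, l i v = 0 := by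
  rw [mk_mem_linSet, LinearMap.mem_ker]
  exact funext_iff

theorem IsCubicSurface.ncard_fiber_add_ncard_le
    {X : Set (PS k 5)} (hX : IsCubicSurface X) {l : Fin 3 → Module.Dual k (Fin 5 → k)}
    (hl : LinearIndependent k l)
    (hfin : (X ∩ linSet (LinearMap.ker (LinearMap.pi l))).Finite) {a : Fin 3 → k} (ha : a ≠ 0)
    (hF : {v | v ∈ affCone X ∧ ∀ i, l i v = a i}.Finite) :
    {v | v ∈ affCone X ∧ ∀ i, l i v = a i}.ncard +
      (X ∩ linSet (LinearMap.ker (LinearMap.pi l))).ncard ≤ 3 := by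
  have hsurj := pi_surjective_of_linearIndependent hl
  set L := LinearMap.pi l with hLdef
  set W := (k ∙ a).comap L with hW
  have hWr : Module.finrank k W = 3 := finrank_comap_span_singleton (m := 2) hsurj ha
  have hker : L.ker ≤ W := fun v hv => by
    rw [hW, Submodule.mem_comap, LinearMap.mem_ker.mp hv]; exact zero_mem _
  set D := X ∩ linSet L.ker
  set F := {v | v ∈ affCone X ∧ ∀ i, l i v = a i}
  have hDW : D ⊆ X ∩ linSet W := fun q hq => ⟨hq.1, le_trans hq.2 hker⟩
  have hF0 (r : F) : r.1 ≠ 0 := fun h => ha (funext fun i => by rw [← r.2.2 i, h]; simp)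
  let P (r : F) : PS k 5 := Projectivization.mk k r.1 (hF0 r)
  have hPinj : Function.Injective P := by
    intro r r' hrr
    obtain ⟨c, hc⟩ := (Projectivization.mk_eq_mk_iff' ..).mp hrr
    have hc1 : c = 1 := by
      obtain ⟨i, hi⟩ := Function.ne_iff.mp ha
      have := congrArg (l i) hc
      rw [map_smul, r.2.2, r'.2.2, smul_eq_mul] at this
      exact mul_right_cancel₀ hi (this.trans (one_mul _).symm)
    rw [hc1, one_smul] at hc
    exact Subtype.ext hc.symm
  have hPW : Set.range P ⊆ X ∩ linSet W := by
    rintro _ ⟨r, rfl⟩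
    refine ⟨(mem_affCone _).mp r.2.1, ?_⟩
    rw [mk_mem_linSet, hW, Submodule.mem_comap]
    have : L r.1 = a := funext fun i => r.2.2 i
    rw [this]; exact Submodule.mem_span_singleton_self a
  have hdisj : Disjoint (Set.range P) D := by
    rw [Set.disjoint_left]
    rintro _ ⟨r, rfl⟩ hD
    have h1 := hD.2
    rw [mk_mem_linSet, LinearMap.mem_ker] at h1
    exact ha (by rw [← h1]; exact (funext fun i => r.2.2 i).symm)
  have hcov : X ∩ linSet W ⊆ Set.range P ∪ D := by
    rintro q ⟨hqX, hqW⟩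
    induction q using Projectivization.ind with | _ v hv =>
    rw [mk_mem_linSet, hW, Submodule.mem_comap, Submodule.mem_span_singleton] at hqW
    obtain ⟨s, hs⟩ := hqW
    rcases eq_or_ne s 0 with rfl | hs0
    · right
      refine ⟨hqX, ?_⟩
      rw [mk_mem_linSet, LinearMap.mem_ker, ← hs, zero_smul]
    · left
      refine ⟨⟨s⁻¹ • v, smul_mem_affCone ((mem_affCone hv).mpr hqX) _, fun i => ?_⟩, ?_⟩
      · have := congrFun hs i
        rw [map_smul, smul_eq_mul, inv_mul_eq_iff_eq_mul₀ hs0]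
        exact this.symm
      · rw [Projectivization.mk_eq_mk_iff']
        exact ⟨s⁻¹, rfl⟩
  have : Finite F := hF
  have hfinW : (X ∩ linSet W).Finite := ((Set.finite_range P).union hfin).subset hcov
  have h1 : (Set.range P ∪ D).ncard ≤ 3 :=
    (Set.ncard_le_ncard (Set.union_subset hPW hDW) hfinW).trans (hX.count W hWr hfinW)
  rw [Set.ncard_union_eq hdisj (Set.finite_range P) hfin] at h1
  rwa [← Set.image_univ, Set.ncard_image_of_injective _ hPinj, Set.ncard_univ] at h1

theorem exists_fiber_ncard [IsAlgClosed k] [CharZero k]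
    {X : Set (PS k 5)} (hX : IsCubicSurface X) {l : Fin 3 → Module.Dual k (Fin 5 → k)}
    (hl : AlgebraicIndependent k fun i => form X (l i)) {θ : CoordRing X}
    (hθ : IsIntegral (Algebra.adjoin k (Set.range fun i => form X (l i))) θ) :
    ∃ a : Fin 3 → k, a ≠ 0 ∧ {v | v ∈ affCone X ∧ ∀ i, l i v = a i}.Finite ∧
    (minpoly (Algebra.adjoin k (Set.range fun i => form X (l i))) θ).natDegree ≤
      {v | v ∈ affCone X ∧ ∀ i, l i v = a i}.ncard := by
  have := hX.isDomain
  have := isIntegrallyClosed_adjoin hl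
  have : Algebra.IsAlgebraic (Algebra.adjoin k (Set.range fun i => form X (l i))) (CoordRing X) :=
    isAlgebraic_of_algebraicIndependent hX.trdeg_eq hl
  obtain ⟨h, h0, hh⟩ := exists_algHom_extension_card (k := k) hθ
  have hlA (i) : form X (l i) ∈ Algebra.adjoin k (Set.range fun i => form X (l i)) :=
    Algebra.subset_adjoin ⟨i, rfl⟩
  let E := hl.aevalEquiv
  have hE (i) : E (MvPolynomial.X i) = ⟨form X (l i), hlA i⟩ := Subtype.ext (by simp [E])
  clear_value E
  generalize minpoly (Algebra.adjoin k (Set.range fun i => form X (l i))) θ = μ at *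
  generalize hA : Algebra.adjoin k (Set.range fun i => form X (l i)) = A at *
  have halg (i : Fin 5) : ∃ p : Polynomial A, p ≠ 0 ∧
      Polynomial.aeval (form X (LinearMap.proj i)) p = 0 :=
    Algebra.IsAlgebraic.isAlgebraic (form X (LinearMap.proj i))
  choose p hp0 hp using halg
  have hlc (i) : (p i).leadingCoeff ≠ 0 := Polynomial.leadingCoeff_ne_zero.mpr (hp0 i)
  have hH0 : E.symm (h * ∏ i, (p i).leadingCoeff) * MvPolynomial.X 0 ≠ 0 := by
    refine mul_ne_zero ?_ (X_ne_zero 0)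
    rw [Ne, map_eq_zero_iff _ E.symm.injective]
    exact mul_ne_zero h0 (Finset.prod_ne_zero_iff.mpr fun i _ => hlc i)
  obtain ⟨a, ha⟩ : ∃ a, eval a (E.symm (h * ∏ i, (p i).leadingCoeff) * MvPolynomial.X 0) ≠ 0 := by
    by_contra! hc
    exact hH0 (MvPolynomial.funext fun a => by rw [hc a, map_zero])
  obtain ⟨χ, hχ⟩ : ∃ χ : A →ₐ[k] k, ∀ x, χ x = eval a (E.symm x) :=
    ⟨(aeval a).comp E.symm.toAlgHom, fun x => by simp [aeval_eq_eval]⟩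
  rw [map_mul, eval_X, map_mul, map_mul, map_prod, map_prod, ← hχ] at ha
  simp only [← hχ] at ha
  have ha0 : a ≠ 0 := fun h => ha (by simp [h])
  have hχh : χ h ≠ 0 := fun h => ha (by simp [h])
  have hχp (i) : (p i).map χ.toRingHom ≠ 0 := fun h => by
    have h1 : χ (p i).leadingCoeff ≠ 0 := fun h => ha (by
      rw [Finset.prod_eq_zero (Finset.mem_univ i) h]; simp)
    apply h1
    have := congrArg (Polynomial.coeff · (p i).natDegree) h
    simpa using this
  have hχl (i) : χ ⟨form X (l i), hlA i⟩ = a i := by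
    rw [hχ, ← hE, AlgEquiv.symm_apply_apply, eval_X]
  have hext {v : Fin 5 → k} (hv : v ∈ affCone X) (hva : ∀ i, l i v = a i) (y : A) :
      evalPt hv y = χ y := by
    have : ((evalPt hv).comp A.val) = χ := by
      refine AlgHom.ext_of_eq_adjoin hA.symm ?_
      rintro _ ⟨i, rfl⟩
      rw [hχl i]
      simp [hva]
    exact DFunLike.congr_fun this y
  have hfin : {v | v ∈ affCone X ∧ ∀ i, l i v = a i}.Finite := by
    refine (Set.Finite.pi fun i => Polynomial.finite_setOfPred_isRoot (hχp i)).subset ?_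
    rintro v ⟨hwX, hwa⟩ i _
    change Polynomial.IsRoot _ _
    have := congrArg (evalPt hwX) (hp i)
    rw [map_zero, Polynomial.aeval_def, ← AlgHom.coe_toRingHom, Polynomial.hom_eval₂,
      AlgHom.coe_toRingHom, evalPt_form] at this
    rw [Polynomial.IsRoot, Polynomial.eval_map, ← this]
    congr 1
    ext y
    exact (hext hwX hwa y).symm
  refine ⟨a, ha0, hfin, ?_⟩
  obtain ⟨R, hRc, hR⟩ := hh χ hχh
  have hpt : ∀ r : R, ∃ v, v ∈ affCone X ∧ (∀ i, l i v = a i) ∧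
      ∀ w (hw : w ∈ affCone X), v = w → evalPt hw θ = r := by
    rintro ⟨r, hr⟩
    obtain ⟨ψ, hψ, hψθ⟩ := hR r hr
    obtain ⟨v, hv, rfl⟩ := exists_evalPt_eq hX.closed ψ
    refine ⟨v, hv, fun i => ?_, fun w hw hvw => by subst hvw; exact hψθ⟩
    rw [← evalPt_form hv, ← hχl i, ← hψ]; rfl
  choose v hv hva hvθ using hpt
  have hinj : Function.Injective v := fun r r' hrr =>
    Subtype.ext ((hvθ r _ (hv r) rfl).symm.trans (hvθ r' _ (hv r) hrr.symm))
  have : (Set.range v).ncard = R.card := by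
    rw [← Set.image_univ, Set.ncard_image_of_injective _ hinj, Set.ncard_univ, Nat.card_eq_fintype_card, Fintype.card_coe]
  rw [← hRc, ← this]
  refine Set.ncard_le_ncard ?_ hfin
  rintro _ ⟨r, rfl⟩
  exact ⟨hv r, hva r⟩

theorem IsCubicSurface.natDegree_minpoly_add_ncard_le [IsAlgClosed k] [CharZero k]
    {X : Set (PS k 5)} (hX : IsCubicSurface X) {l : Fin 3 → Module.Dual k (Fin 5 → k)}
    (hl : AlgebraicIndependent k fun i => form X (l i))
    (hfin : (X ∩ linSet (LinearMap.ker (LinearMap.pi l))).Finite) {θ : CoordRing X}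
    (hθ : IsIntegral (Algebra.adjoin k (Set.range fun i => form X (l i))) θ) :
    (minpoly (Algebra.adjoin k (Set.range fun i => form X (l i))) θ).natDegree +
      (X ∩ linSet (LinearMap.ker (LinearMap.pi l))).ncard ≤ 3 := by
  obtain ⟨a, ha, hF, h⟩ := exists_fiber_ncard hX hl hθ
  have := hX.ncard_fiber_add_ncard_le (linearIndependent_of_form hl) hfin ha hF
  omega

end Count

section Integral

theorem exists_monic_of_transcendental {R S : Type} [CommRing R] [IsDomain R] [CommRing S]
    [IsDomain S] [Algebra R S] [FaithfulSMul R S] {z θ : S} (hz : Transcendental R z)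
    (hθ : IsAlgebraic R θ) {p : Polynomial (Algebra.adjoin R {z})} (hp : p.Monic)
    (h : Polynomial.aeval θ p = 0) :
    ∃ q : Polynomial R, q.Monic ∧ q.natDegree = p.natDegree ∧ Polynomial.aeval θ q = 0 := by
  let z' : Algebra.adjoin R {z} := ⟨z, Algebra.self_mem_adjoin_singleton R z⟩
  let f : Polynomial R →+* Algebra.adjoin R {z} := (Polynomial.aeval z').toRingHom
  have hf : Function.Surjective f := by
    rintro ⟨y, hy⟩
    rw [Algebra.adjoin_singleton_eq_range_aeval] at hy
    obtain ⟨g, rfl⟩ := hy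
    exact ⟨g, Subtype.ext (by simp [f, z', Polynomial.aeval_subalgebra_coe])⟩
  obtain ⟨q, hqp, hdeg, hq⟩ := Polynomial.lifts_and_natDegree_eq_and_monic
    ((Polynomial.mem_lifts p).mpr (Polynomial.map_surjective f hf p)) hp
  refine ⟨q.map (Polynomial.evalRingHom 0), hq.map _, by rw [hq.natDegree_map, hdeg], ?_⟩
  let R' := Algebra.adjoin R {θ}
  let θ' : R' := ⟨θ, Algebra.self_mem_adjoin_singleton R θ⟩
  have halg : Algebra.IsAlgebraic R R' :=
    Subalgebra.isAlgebraic_iff _ |>.mp (Algebra.isAlgebraic_adjoin_singleton_iff.mpr hθ)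
  have hz' : Transcendental R' z := hz.extendScalars R'
  let Φ : Polynomial R' := q.eval₂ (Polynomial.mapRingHom (algebraMap R R')) (Polynomial.C θ')
  have h1 : Polynomial.aeval z Φ = 0 := by
    rw [← h, ← hqp]
    change (Polynomial.aeval z).toRingHom (q.eval₂ _ _) = _
    rw [Polynomial.hom_eval₂, Polynomial.aeval_def, Polynomial.eval₂_map]
    congr 1
    · ext
      · simp [f]
      · simp [f, z']
    · simp [θ']
  have h2 : Φ = 0 := transcendental_iff.mp hz' Φ h1
  have h3 : (R'.val.toRingHom.comp (Polynomial.evalRingHom 0)) Φ = 0 := by rw [h2, map_zero]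
  rw [Polynomial.hom_eval₂] at h3
  rw [Polynomial.aeval_def, Polynomial.eval₂_map, ← h3]
  congr 1
  · ext
    · simp
    · simp
  · simp [θ']

theorem exists_common_multiple_natDegree_minpoly {A S : Type} [CommRing A] [IsDomain A]
    [IsIntegrallyClosed A] [CharZero A] [CommRing S] [IsDomain S] [Algebra A S] [FaithfulSMul A S]
    [Algebra.IsAlgebraic A S] {α β : S} (hα : IsIntegral A α) (hβ : IsIntegral A β) :
    ∃ θ : S, IsIntegral A θ ∧ (minpoly A α).natDegree ∣ (minpoly A θ).natDegree ∧
      (minpoly A β).natDegree ∣ (minpoly A θ).natDegree := by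
  let F := FractionRing A
  let K := FractionRing S
  let : Algebra F K := FractionRing.liftAlgebra _ _
  have : CharZero F := charZero_of_injective_algebraMap (IsFractionRing.injective A F)
  have : Module.IsTorsionFree A S := inferInstance
  have halg : Algebra.IsAlgebraic F K := by
    have : Algebra.IsAlgebraic A K := (IsFractionRing.isAlgebraic_iff' A S K).mp inferInstance
    exact (IsFractionRing.comap_isAlgebraic_iff (A := A) (K := F) (C := K)).mp this
  obtain ⟨γ, hγ⟩ := Field.primitive_element_inf_aux F (algebraMap S K α) (algebraMap S K β)
  obtain ⟨s, t, ht, rfl⟩ := IsFractionRing.div_surjective (A := S) γ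
  have ht0 : t ≠ 0 := nonZeroDivisors.ne_zero ht
  obtain ⟨a, ha, s', hs'⟩ := (Algebra.IsAlgebraic.isAlgebraic (R := A) t).exists_nonzero_dvd
    (mem_nonZeroDivisors_of_ne_zero ht0)
  obtain ⟨b, hb, hInt⟩ :=
    (Algebra.IsAlgebraic.isAlgebraic (R := A) (s * s')).exists_integral_multiple
  have hfr {x : S} (hx : IsIntegral A x) :
      (minpoly A x).natDegree = Module.finrank F (IntermediateField.adjoin F {algebraMap S K x}) := by
    rw [IntermediateField.adjoin.finrank (Algebra.IsIntegral.isIntegral _),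
      minpoly.isIntegrallyClosed_eq_field_fractions F K hx, (minpoly.monic hx).natDegree_map]
  have htK : algebraMap S K t ≠ 0 := by simpa using ht0
  have hab : algebraMap F K (algebraMap A F (b * a)) ≠ 0 := by simpa using ⟨hb, ha⟩
  have hγθ : algebraMap S K s / algebraMap S K t = (algebraMap F K (algebraMap A F (b * a)))⁻¹ *
      algebraMap S K (b • (s * s')) := by
    rw [eq_inv_mul_iff_mul_eq₀ hab, mul_div_assoc', div_eq_iff htK, ← IsScalarTower.algebraMap_apply A F K,
      IsScalarTower.algebraMap_apply A S K, ← map_mul, ← map_mul, map_mul (algebraMap A S), hs', Algebra.smul_def]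
    congr 1
    ring
  have hle : IntermediateField.adjoin F {algebraMap S K α, algebraMap S K β} ≤
      IntermediateField.adjoin F {algebraMap S K (b • (s * s'))} := by
    rw [hγ, IntermediateField.adjoin_simple_le_iff, hγθ]
    exact mul_mem (inv_mem (IntermediateField.algebraMap_mem _ _))
      (IntermediateField.mem_adjoin_simple_self _ _)
  refine ⟨b • (s * s'), hInt, ?_, ?_⟩
  · rw [hfr hα, hfr hInt]
    refine IntermediateField.finrank_dvd_of_le_right (le_trans ?_ hle)
    exact IntermediateField.adjoin.mono _ _ _ (by simp)
  · rw [hfr hβ, hfr hInt]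
    refine IntermediateField.finrank_dvd_of_le_right (le_trans ?_ hle)
    exact IntermediateField.adjoin.mono _ _ _ (by simp)

theorem eq_zero_of_mul_add_mul_eq_zero {A S B : Type} [CommRing A] [IsDomain A]
    [IsIntegrallyClosed A] [CommRing S] [IsDomain S] [Algebra A S] [FaithfulSMul A S]
    [CommRing B] [IsDomain B] {u v : A} (hv : Prime v) (huv : ¬ v ∣ u) {G H : S}
    (hG : IsIntegral A G) (hH : IsIntegral A H) (h : u • G + v • H = 0) (ψ : S →+* B)
    (hψ : ψ (algebraMap A S v) = 0) : ψ G = 0 := by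
  have hu0 : u ≠ 0 := by rintro rfl; exact huv (dvd_zero _)
  have h1 : u • G = (-v) • H := by rw [neg_smul]; exact eq_neg_of_add_eq_zero_left h
  have h2 := congrArg (minpoly A) h1
  rw [IsIntegrallyClosed.minpoly_smul hu0 hG,
    IsIntegrallyClosed.minpoly_smul (neg_ne_zero.mpr hv.ne_zero) hH] at h2
  set μ := minpoly A G
  have hdeg : (minpoly A H).natDegree = μ.natDegree := by
    have := congrArg Polynomial.natDegree h2
    rw [Polynomial.natDegree_scaleRoots, Polynomial.natDegree_scaleRoots] at this
    exact this.symm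
  have h3 (i) (hi : i < μ.natDegree) : v ∣ μ.coeff i := by
    have := congrArg (Polynomial.coeff · i) h2
    simp only [Polynomial.coeff_scaleRoots, hdeg] at this
    have h4 : v ∣ μ.coeff i * u ^ (μ.natDegree - i) := by
      rw [this]
      exact Dvd.dvd.mul_left (dvd_pow (dvd_neg.mpr dvd_rfl) (by omega)) _
    exact (hv.dvd_or_dvd h4).resolve_right fun h => huv (hv.dvd_of_dvd_pow h)
  have h4 := congrArg ψ (minpoly.aeval A G)
  rw [map_zero, Polynomial.aeval_eq_sum_range, Finset.sum_range_succ, map_add, map_sum,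
    Finset.sum_eq_zero fun i hi => ?_, zero_add, ← Polynomial.leadingCoeff,
    (minpoly.monic hG).leadingCoeff, one_smul, map_pow] at h4
  · exact eq_zero_of_pow_eq_zero h4
  · obtain ⟨c, hc⟩ := h3 i (Finset.mem_range.mp hi)
    rw [Algebra.smul_def, map_mul, hc, map_mul, map_mul, hψ, zero_mul, zero_mul]

end Integral

section Relations
variable {k : Type} [Field k] {n : ℕ}

theorem algebraicIndependent_snoc {S : Type} [CommRing S] [Algebra k S] {m : ℕ}
    {x : Fin m → S} {z : S} : AlgebraicIndependent k (Fin.snoc x z : Fin (m + 1) → S) ↔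
      AlgebraicIndependent k x ∧ Transcendental (Algebra.adjoin k (Set.range x)) z := by
  have h1 : (Fin.snoc x z : Fin (m + 1) → S) =
      (fun o : Option (Fin m) => o.elim z x) ∘ finSuccEquivLast := by
    ext i
    induction i using Fin.lastCases <;> simp
  rw [h1, algebraicIndependent_equiv]
  refine ⟨fun h => ?_, fun h => (h.1.option_iff_transcendental z).mpr h.2⟩
  have hx : AlgebraicIndependent k x := h.comp some (Option.some_injective _)
  exact ⟨hx, (hx.option_iff_transcendental z).mp h⟩

/-- Integral equations specialize along a transcendental element. -/
theorem exists_monic_of_snoc {S : Type} [CommRing S] [IsDomain S] [Algebra k S] {m : ℕ}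
    {x : Fin m → S} {z θ : S} (hz : Transcendental (Algebra.adjoin k (Set.range x)) z)
    (hθ : IsAlgebraic (Algebra.adjoin k (Set.range x)) θ)
    {p : Polynomial (Algebra.adjoin k (Set.range (Fin.snoc x z : Fin (m + 1) → S)))}
    (hp : p.Monic) (h : Polynomial.aeval θ p = 0) :
    ∃ q : Polynomial (Algebra.adjoin k (Set.range x)), q.Monic ∧ q.natDegree = p.natDegree ∧
      Polynomial.aeval θ q = 0 := by
  have hle : Algebra.adjoin k (Set.range (Fin.snoc x z : Fin (m + 1) → S)) ≤
      (Algebra.adjoin (Algebra.adjoin k (Set.range x)) {z}).restrictScalars k := by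
    rw [← Algebra.adjoin_union_eq_adjoin_adjoin]
    refine Algebra.adjoin_mono ?_
    rintro _ ⟨i, rfl⟩
    induction i using Fin.lastCases <;> simp
  generalize Algebra.adjoin k (Set.range x) = R at *
  generalize Algebra.adjoin k (Set.range (Fin.snoc x z : Fin (m + 1) → S)) = T at *
  have hle' (y : T) : (y : S) ∈ Algebra.adjoin R {z} := hle y.2
  let f : T →+* Algebra.adjoin R {z} :=
    T.val.toRingHom.codRestrict (Algebra.adjoin R {z}) hle'
  have hf : (algebraMap (Algebra.adjoin R {z}) S).comp f = algebraMap T S := rfl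
  clear_value f
  obtain ⟨q, hq, hdeg, hq0⟩ := exists_monic_of_transcendental hz hθ (p := p.map f)
    (hp.map _) (by rw [← h, Polynomial.aeval_def, Polynomial.eval₂_map, hf, Polynomial.aeval_def])
  exact ⟨q, hq, by rw [hdeg, hp.natDegree_map], hq0⟩

/-- Monic relations between linear forms may be taken homogeneous. -/
theorem exists_homogeneous_of_monic [Infinite k] {X : Set (PS k n)} {m : ℕ}
    {l : Fin m → Module.Dual k (Fin n → k)} {u : Module.Dual k (Fin n → k)}
    {p : Polynomial (Algebra.adjoin k (Set.range fun i => form X (l i)))} (hp : p.Monic)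
    (h : Polynomial.aeval (form X u) p = 0) :
    ∃ Q : MvPolynomial (Fin (m + 1)) k, Q.IsHomogeneous p.natDegree ∧
      coeff (Finsupp.single (Fin.last m) p.natDegree) Q = 1 ∧
      aeval (fun i => form X ((Fin.snoc l u : Fin (m + 1) → _) i)) Q = 0 := by
  have hlift (y : Algebra.adjoin k (Set.range fun i => form X (l i))) :
      ∃ F : MvPolynomial (Fin m) k, aeval (fun i => form X (l i)) F = (y : CoordRing X) := by
    change (y : CoordRing X) ∈ (aeval fun i => form X (l i) : MvPolynomial (Fin m) k →ₐ[k] _).range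
    exact (Algebra.adjoin_range_eq_range_aeval k _).le y.2
  choose F hF using hlift
  set D := p.natDegree with hD
  let Q₀ : MvPolynomial (Fin (m + 1)) k :=
    ∑ i ∈ Finset.range D, rename Fin.castSucc (F (p.coeff i)) * monomial (Finsupp.single (Fin.last m) i) 1
      + monomial (Finsupp.single (Fin.last m) D) 1
  have hQ₀ : aeval (fun i => form X ((Fin.snoc l u : Fin (m + 1) → _) i)) Q₀ = 0 := by
    rw [← h, Polynomial.aeval_eq_sum_range, Finset.sum_range_succ, ← hD, ← Polynomial.leadingCoeff, hp.leadingCoeff]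
    simp only [Q₀, map_add, map_sum, map_mul, aeval_rename, aeval_monomial, map_one, one_mul,
      Finsupp.prod_single_index, pow_zero, Fin.snoc_last, one_smul]
    congr 1
    refine Finset.sum_congr rfl fun i _ => ?_
    have : ((fun i => form X ((Fin.snoc l u : Fin (m + 1) → _) i)) ∘ Fin.castSucc) =
      fun i => form X (l i) := by ext i; simp
    rw [this, hF, Algebra.smul_def]
    rfl
  refine ⟨homogeneousComponent D Q₀, homogeneousComponent_isHomogeneous D Q₀, ?_,
    aeval_form_homogeneousComponent hQ₀ D⟩
  rw [coeff_homogeneousComponent, if_pos (by simp [Finsupp.degree_single])]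
  simp only [Q₀, coeff_add, coeff_sum, coeff_monomial, if_true]
  rw [Finset.sum_eq_zero, zero_add]
  intro i hi
  rw [coeff_mul_monomial', if_pos (by simpa using (Finset.mem_range.mp hi).le), mul_one,
    ← Finsupp.single_tsub]
  refine coeff_rename_eq_zero _ _ _ fun w hw => ?_
  exfalso
  have h1 := DFunLike.congr_fun hw (Fin.last m)
  rw [Finsupp.mapDomain_of_notMem_range _ _ (by simp), Finsupp.single_eq_same] at h1
  have := Finset.mem_range.mp hi
  omega

theorem eval_single_of_isHomogeneous {m d : ℕ} {Q : MvPolynomial (Fin m) k}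
    (hQ : Q.IsHomogeneous d) (j : Fin m) {v : Fin m → k} (hv : ∀ i, i ≠ j → v i = 0) :
    eval v Q = coeff (Finsupp.single j d) Q * v j ^ d := by
  rw [eval_eq', Finset.sum_eq_single (Finsupp.single j d)]
  · congr 1
    rw [Finset.prod_eq_single j]
    · simp
    · intro i _ hij
      rw [Finsupp.single_eq_of_ne hij, pow_zero]
    · simp
  · intro e he hne
    obtain ⟨i, hij, hi⟩ : ∃ i, i ≠ j ∧ e i ≠ 0 := by
      by_contra! hc
      apply hne
      have h1 : e = Finsupp.single j (e j) := by
        ext i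
        by_cases hij : i = j
        · rw [hij, Finsupp.single_eq_same]
        · rw [hc i hij, Finsupp.single_eq_of_ne hij]
      have h2 := hQ (mem_support_iff.mp he)
      rw [h1] at h2 ⊢
      simp [Finsupp.weight_single] at h2
      rw [h2]
    rw [Finset.prod_eq_zero (Finset.mem_univ i), mul_zero]
    rw [hv i hij, zero_pow hi]
  · intro h
    rw [notMem_support_iff.mp h, zero_mul]

theorem evalPt_aeval_form {X : Set (PS k n)} {m : ℕ} (l : Fin m → Module.Dual k (Fin n → k))
    (F : MvPolynomial (Fin m) k) {v : Fin n → k} (hv : v ∈ affCone X) :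
    evalPt hv (aeval (fun i => form X (l i)) F) = eval (fun i => l i v) F := by
  rw [← AlgHom.comp_apply, comp_aeval, ← aeval_eq_eval]
  simp

theorem isIntegral_of_forall_eq_zero [IsAlgClosed k] {X : Set (PS k n)} (hX : IsClosed X) {m : ℕ}
    {l : Fin m → Module.Dual k (Fin n → k)}
    (h0 : ∀ v ∈ affCone X, (∀ i, l i v = 0) → v = 0) (s : CoordRing X) :
    IsIntegral (Algebra.adjoin k (Set.range fun i => form X (l i))) s := by
  have : Infinite k := IsAlgClosed.instInfinite
  obtain ⟨f, rfl⟩ := Ideal.Quotient.mk_surjective s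
  exact isIntegral_adjoin_of_forall_eq_zero (J := coneIdeal X)
    (fun f hf d => homogeneousComponent_mem_coneIdeal hf d)
    (fun v hv hl => h0 v ((mem_affCone_iff hX).mpr hv) hl) (Ideal.Quotient.mkₐ k _)
    (fun f hf => Ideal.Quotient.eq_zero_iff_mem.mpr hf) f

end Relations

section Sections
variable {k : Type} [Field k]

theorem form_snoc {n m : ℕ} (X : Set (PS k n)) (l : Fin m → Module.Dual k (Fin n → k))
    (u : Module.Dual k (Fin n → k)) :
    (fun i => form X ((Fin.snoc l u : Fin (m + 1) → _) i)) =
      (Fin.snoc (fun i => form X (l i)) (form X u) : Fin (m + 1) → CoordRing X) := by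
  ext i
  induction i using Fin.lastCases <;> simp

/-- A section of `X` by a codimension two linear space consisting of three points, with
representatives normalized by a linear form `z`. -/
structure IsSection (X : Set (PS k 5)) (y : Fin 2 → Module.Dual k (Fin 5 → k))
    (z : Module.Dual k (Fin 5 → k)) (e : Fin 3 → Fin 5 → k) : Prop where
  mem : ∀ i, e i ∈ affCone X
  eq_zero : ∀ j i, y j (e i) = 0
  eq_one : ∀ i, z (e i) = 1
  injective : Function.Injective e
  eq_smul : ∀ v ∈ affCone X, (∀ j, y j v = 0) → ∃ i, v = z v • e i

theorem exists_ker_pi_eq {n m : ℕ} (W : Submodule k (Fin n → k))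
    (hW : Module.finrank k W + m = n) :
    ∃ y : Fin m → Module.Dual k (Fin n → k), LinearMap.ker (LinearMap.pi y) = W := by
  have h1 := W.finrank_quotient_add_finrank
  rw [Module.finrank_fin_fun] at h1
  let E : ((Fin n → k) ⧸ W) ≃ₗ[k] (Fin m → k) :=
    LinearEquiv.ofFinrankEq _ _ (by rw [Module.finrank_fin_fun]; omega)
  refine ⟨fun i => LinearMap.proj i ∘ₗ E.toLinearMap ∘ₗ W.mkQ, ?_⟩
  have : LinearMap.pi (fun i => LinearMap.proj i ∘ₗ E.toLinearMap ∘ₗ W.mkQ) =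
      E.toLinearMap ∘ₗ W.mkQ := rfl
  rw [this, LinearEquiv.ker_comp, Submodule.ker_mkQ]

theorem exists_isSection [Infinite k] {X : Set (PS k 5)} {W : Submodule k (Fin 5 → k)}
    (hW : Module.finrank k W = 3) (hc : (X ∩ linSet W).ncard = 3) :
    ∃ y z e, IsSection X y z e := by
  obtain ⟨y, hy⟩ := exists_ker_pi_eq (m := 2) W (by omega)
  have hlin (v : Fin 5 → k) (hv : v ≠ 0) :
      Projectivization.mk k v hv ∈ linSet W ↔ ∀ i, y i v = 0 := by
    rw [← hy, mem_linSet_ker_pi]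
  have hfin : (X ∩ linSet W).Finite := Set.finite_of_ncard_pos (by omega)
  have hcard : Nat.card ↥(X ∩ linSet W) = 3 := hc
  have := hfin.to_subtype
  let E : Fin 3 ≃ ↥(X ∩ linSet W) := (Finite.equivFinOfCardEq hcard).symm
  obtain ⟨z, hz⟩ := Module.exists_dual_forall_apply_ne_zero (K := k) (fun i => (E i).1.rep)
    (fun i => (E i).1.rep_nonzero)
  have hmk (i : Fin 3) : Projectivization.mk k _ (E i).1.rep_nonzero = (E i).1 :=
    Projectivization.mk_rep _
  have hrep (i : Fin 3) : (E i).1.rep ∈ affCone X := by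
    rw [mem_affCone (E i).1.rep_nonzero, hmk]; exact (E i).2.1
  refine ⟨y, z, fun i => (z (E i).1.rep)⁻¹ • (E i).1.rep, ⟨?_, ?_, ?_, ?_, ?_⟩⟩
  · exact fun i => smul_mem_affCone (hrep i) _
  · intro j i
    have h1 : (E i).1 ∈ linSet W := (E i).2.2
    rw [← hmk, hlin] at h1
    rw [map_smul, h1 j, smul_zero]
  · intro i
    rw [map_smul, smul_eq_mul, inv_mul_cancel₀ (hz i)]
  · intro i j hij
    apply E.injective
    apply Subtype.ext
    rw [← hmk i, ← hmk j, Projectivization.mk_eq_mk_iff']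
    refine ⟨z (E i).1.rep * (z (E j).1.rep)⁻¹, ?_⟩
    have := congrArg (fun v => z (E i).1.rep • v) hij
    simp only [smul_smul, mul_inv_cancel₀ (hz i), one_smul] at this
    exact this.symm
  · intro v hv hyv
    by_cases hv0 : v = 0
    · exact ⟨0, by simp [hv0]⟩
    have hm : Projectivization.mk k v hv0 ∈ X ∩ linSet W :=
      ⟨(mem_affCone hv0).mp hv, (hlin v hv0).mpr hyv⟩
    obtain ⟨i, hi⟩ := E.surjective ⟨_, hm⟩
    refine ⟨i, ?_⟩
    have h1 := hmk i
    rw [hi, Projectivization.mk_eq_mk_iff'] at h1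
    obtain ⟨c, h1⟩ := h1
    have h2 := hz i
    rw [hi]
    rw [hi] at h2
    simp only at h1 h2 ⊢
    rw [← h1, map_smul, smul_eq_mul, mul_ne_zero_iff] at h2
    rw [← h1, map_smul, smul_eq_mul, smul_smul, smul_smul]
    have : z v * (c * z v)⁻¹ * c = 1 := by field_simp [h2.1, h2.2]
    rw [this, one_smul]

namespace IsSection

variable {X : Set (PS k 5)} {y : Fin 2 → Module.Dual k (Fin 5 → k)}
  {z : Module.Dual k (Fin 5 → k)} {e : Fin 3 → Fin 5 → k}

theorem ne_zero (h : IsSection X y z e) (i : Fin 3) : e i ≠ 0 := fun h0 => by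
  have := h.eq_one i
  rw [h0, map_zero] at this
  exact zero_ne_one this

theorem comp (h : IsSection X y z e) (σ : Equiv.Perm (Fin 3)) : IsSection X y z (e ∘ σ) where
  mem i := h.mem _
  eq_zero j i := h.eq_zero j _
  eq_one i := h.eq_one _
  injective := h.injective.comp σ.injective
  eq_smul v hv hy := by
    obtain ⟨i, hi⟩ := h.eq_smul v hv hy
    exact ⟨σ.symm i, by simpa using hi⟩

theorem change_basis (h : IsSection X y z e) {y' : Fin 2 → Module.Dual k (Fin 5 → k)}
    (hy : ∀ v, (∀ j, y' j v = 0) ↔ ∀ j, y j v = 0) : IsSection X y' z e where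
  mem := h.mem
  eq_zero j i := (hy _).mpr (fun j => h.eq_zero j i) j
  eq_one := h.eq_one
  injective := h.injective
  eq_smul v hv hv' := h.eq_smul v hv ((hy v).mp hv')

theorem isIntegral [IsAlgClosed k] (h : IsSection X y z e) (hX : IsClosed X) (s : CoordRing X) :
    IsIntegral (Algebra.adjoin k (Set.range fun i => form X ((Fin.snoc y z : Fin 3 → _) i))) s := by
  refine isIntegral_of_forall_eq_zero hX (fun v hv hl => ?_) s
  obtain ⟨i, hi⟩ := h.eq_smul v hv fun j => by simpa using hl j.castSucc
  have hz : z v = 0 := by have := hl (Fin.last 2); rwa [Fin.snoc_last] at this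
  rw [hi, hz, zero_smul]

theorem isAlgebraic [IsAlgClosed k] (h : IsSection X y z e) (hX : IsClosed X) :
    Algebra.IsAlgebraic
      (Algebra.adjoin k (Set.range fun i => form X ((Fin.snoc y z : Fin 3 → _) i)))
      (CoordRing X) :=
  have : Nontrivial (CoordRing X) := (evalPt (h.mem 0)).toRingHom.domain_nontrivial
  ⟨fun s => (h.isIntegral hX s).isAlgebraic⟩

theorem algebraicIndependent [IsAlgClosed k] (h : IsSection X y z e) (hX : IsCubicSurface X) :
    AlgebraicIndependent k fun i => form X ((Fin.snoc y z : Fin 3 → _) i) :=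
  have := hX.isDomain
  have := h.isAlgebraic hX.closed
  algebraicIndependent_of_isAlgebraic hX.trdeg_eq.ge this

theorem isIntegral_of_not_algebraicIndependent [IsAlgClosed k] (h : IsSection X y z e)
    (hX : IsCubicSurface X) {x : Module.Dual k (Fin 5 → k)}
    (hx : ¬ AlgebraicIndependent k fun i => form X ((Fin.snoc y x : Fin 3 → _) i)) :
    IsIntegral (Algebra.adjoin k (Set.range fun i => form X (y i))) (form X x) := by
  have := hX.isDomain
  have hz := h.algebraicIndependent hX
  have hi := h.isIntegral hX.closed (form X x)
  rw [form_snoc] at hx hz hi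
  obtain ⟨p, hp, hp0⟩ := hi
  rw [algebraicIndependent_snoc] at hx hz
  obtain ⟨q, hq, -, hq0⟩ :=
    exists_monic_of_snoc hz.2 (of_not_not (not_and.mp hx hz.1)) hp hp0
  exact ⟨q, hq, hq0⟩

end IsSection

theorem eq_zero_of_isIntegral [Infinite k] {n m : ℕ} {X : Set (PS k n)}
    {y : Fin m → Module.Dual k (Fin n → k)} {x : Module.Dual k (Fin n → k)}
    (hx : IsIntegral (Algebra.adjoin k (Set.range fun i => form X (y i))) (form X x))
    {v : Fin n → k} (hv : v ∈ affCone X) (hy : ∀ j, y j v = 0) : x v = 0 := by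
  obtain ⟨p, hp, hp0⟩ := hx
  obtain ⟨Q, hQ, hQ1, hQ0⟩ := exists_homogeneous_of_monic hp hp0
  have := congrArg (evalPt hv) hQ0
  rw [evalPt_aeval_form, map_zero, eval_single_of_isHomogeneous hQ (Fin.last m), hQ1, one_mul,
    Fin.snoc_last] at this
  · exact eq_zero_of_pow_eq_zero this
  · intro i hi
    induction i using Fin.lastCases with
    | last => exact absurd rfl hi
    | cast j => rw [Fin.snoc_castSucc]; exact hy j

theorem IsSection.algebraicIndependent_snoc [IsAlgClosed k] {X : Set (PS k 5)}
    {y : Fin 2 → Module.Dual k (Fin 5 → k)} {z : Module.Dual k (Fin 5 → k)}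
    {e : Fin 3 → Fin 5 → k} (h : IsSection X y z e) (hX : IsCubicSurface X)
    {x : Module.Dual k (Fin 5 → k)} {i : Fin 3} (hx : x (e i) ≠ 0) :
    AlgebraicIndependent k fun i => form X ((Fin.snoc y x : Fin 3 → _) i) := by
  have : Infinite k := IsAlgClosed.instInfinite
  by_contra hc
  exact hx (eq_zero_of_isIntegral (h.isIntegral_of_not_algebraicIndependent hX hc) (h.mem i)
    fun j => h.eq_zero j i)

theorem natDegree_minpoly_snoc {S : Type} [CommRing S] [IsDomain S] [Algebra k S] {m : ℕ}
    {x : Fin m → S} {z θ : S} (hz : Transcendental (Algebra.adjoin k (Set.range x)) z)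
    (hθ : IsIntegral (Algebra.adjoin k (Set.range x)) θ) :
    IsIntegral (Algebra.adjoin k (Set.range (Fin.snoc x z : Fin (m + 1) → S))) θ ∧
    (minpoly (Algebra.adjoin k (Set.range (Fin.snoc x z : Fin (m + 1) → S))) θ).natDegree =
      (minpoly (Algebra.adjoin k (Set.range x)) θ).natDegree := by
  have hspec := fun p => exists_monic_of_snoc (p := p) hz hθ.isAlgebraic
  have hle : Algebra.adjoin k (Set.range x) ≤
      Algebra.adjoin k (Set.range (Fin.snoc x z : Fin (m + 1) → S)) := by
    refine Algebra.adjoin_mono ?_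
    rintro _ ⟨i, rfl⟩
    exact ⟨i.castSucc, by simp⟩
  generalize Algebra.adjoin k (Set.range x) = R at *
  generalize Algebra.adjoin k (Set.range (Fin.snoc x z : Fin (m + 1) → S)) = T at *
  let f : R →+* T := (Subalgebra.inclusion hle).toRingHom
  have hf : (algebraMap T S).comp f = algebraMap R S := rfl
  have h0 : Polynomial.aeval θ ((minpoly R θ).map f) = 0 := by
    rw [Polynomial.aeval_def, Polynomial.eval₂_map, hf, ← Polynomial.aeval_def, minpoly.aeval]
  have hm := (minpoly.monic hθ).map f
  have hi : IsIntegral T θ := ⟨_, hm, h0⟩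
  refine ⟨hi, le_antisymm ?_ ?_⟩
  · have := Polynomial.natDegree_le_natDegree (minpoly.min T θ hm h0)
    rwa [(minpoly.monic hθ).natDegree_map] at this
  · obtain ⟨q, hq, hd, hq0⟩ := hspec _ (minpoly.monic hi) (minpoly.aeval _ _)
    rw [← hd]
    exact Polynomial.natDegree_le_natDegree (minpoly.min R θ hq hq0)

end Sections

section GeneralPosition
variable {k : Type} [Field k]

theorem charZero_subalgebra [CharZero k] {S : Type} [CommRing S] [IsDomain S] [Algebra k S]
    (A : Subalgebra k S) : CharZero A :=
  charZero_of_injective_algebraMap (algebraMap k A).injective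

theorem eq_sum_of_isHomogeneous_one {σ : Type} [Fintype σ] {Q : MvPolynomial σ k}
    (hQ : Q.IsHomogeneous 1) : Q = ∑ i, C (coeff (Finsupp.single i 1) Q) * MvPolynomial.X i := by
  classical
  have hQ' : Q ∈ homogeneousSubmodule σ k 1 := hQ
  rw [homogeneousSubmodule_one_eq_span_X, Submodule.mem_span_range_iff_exists_fun] at hQ'
  obtain ⟨c, rfl⟩ := hQ'
  refine Finset.sum_congr rfl fun i _ => ?_
  rw [smul_eq_C_mul]
  congr 2
  rw [coeff_sum, Finset.sum_eq_single i]
  · simp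
  · intro j _ hj
    rw [coeff_smul, coeff_X, if_neg (by simpa [Finsupp.single_left_inj] using hj), smul_zero]
  · simp

namespace IsSection

variable {X : Set (PS k 5)} {y : Fin 2 → Module.Dual k (Fin 5 → k)}
  {z : Module.Dual k (Fin 5 → k)} {e : Fin 3 → Fin 5 → k}

theorem inter_linSet (h : IsSection X y z e) (x : Module.Dual k (Fin 5 → k)) :
    X ∩ linSet (LinearMap.ker (LinearMap.pi (Fin.snoc y x : Fin 3 → _))) =
      (fun i => Projectivization.mk k (e i) (h.ne_zero i)) '' {i | x (e i) = 0} := by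
  ext p
  constructor
  · rintro ⟨hp, hl⟩
    induction p using Projectivization.ind with | _ v hv =>
    rw [mem_linSet_ker_pi] at hl
    obtain ⟨i, hi⟩ := h.eq_smul v ((mem_affCone hv).mpr hp) fun j => by simpa using hl j.castSucc
    have hz : z v ≠ 0 := fun h0 => hv (by rw [hi, h0, zero_smul])
    refine ⟨i, ?_, ?_⟩
    · have := hl (Fin.last 2)
      rw [Fin.snoc_last, hi, map_smul, smul_eq_mul] at this
      exact (mul_eq_zero.mp this).resolve_left hz
    · rw [Projectivization.mk_eq_mk_iff']
      exact ⟨(z v)⁻¹, by rw [inv_smul_eq_iff₀ hz]; exact hi⟩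
  · rintro ⟨i, hi, rfl⟩
    refine ⟨(mem_affCone _).mp (h.mem i), ?_⟩
    rw [mem_linSet_ker_pi]
    intro j
    induction j using Fin.lastCases with
    | last => rw [Fin.snoc_last]; exact hi
    | cast j => rw [Fin.snoc_castSucc]; exact h.eq_zero j i

theorem mk_injective (h : IsSection X y z e) :
    Function.Injective fun i => Projectivization.mk k (e i) (h.ne_zero i) := by
  intro i j hij
  obtain ⟨c, hc⟩ := (Projectivization.mk_eq_mk_iff' ..).mp hij
  have := congrArg z hc
  rw [map_smul, h.eq_one, h.eq_one, smul_eq_mul, mul_one] at this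
  rw [this, one_smul] at hc
  exact h.injective hc.symm

theorem natDegree_minpoly_add_ncard_le [IsAlgClosed k] [CharZero k] (h : IsSection X y z e)
    (hX : IsCubicSurface X) {x : Module.Dual k (Fin 5 → k)}
    (hx : AlgebraicIndependent k fun i => form X ((Fin.snoc y x : Fin 3 → _) i)) {θ : CoordRing X}
    (hθ : IsIntegral
      (Algebra.adjoin k (Set.range fun i => form X ((Fin.snoc y x : Fin 3 → _) i))) θ) :
    (minpoly (Algebra.adjoin k (Set.range fun i => form X ((Fin.snoc y x : Fin 3 → _) i)))
      θ).natDegree + {i | x (e i) = 0}.ncard ≤ 3 := by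
  have h1 := h.inter_linSet x
  have := hX.natDegree_minpoly_add_ncard_le hx (by rw [h1]; exact Set.toFinite _) hθ
  rwa [h1, Set.ncard_image_of_injective _ h.mk_injective] at this

theorem isIntegral_of_forall (h : IsSection X y z e) [IsAlgClosed k] [CharZero k]
    (hX : IsCubicSurface X) {u : Module.Dual k (Fin 5 → k)} (hu : ∀ i, u (e i) = 0) :
    IsIntegral (Algebra.adjoin k (Set.range fun i => form X (y i))) (form X u) := by
  refine h.isIntegral_of_not_algebraicIndependent hX fun hc => ?_
  have := hX.isDomain
  have h1 := h.natDegree_minpoly_add_ncard_le hX hc (θ := 0) isIntegral_zero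
  have h2 : {i | u (e i) = 0} = Set.univ := Set.eq_univ_of_forall hu
  rw [h2, Set.ncard_univ, Nat.card_eq_fintype_card, Fintype.card_fin] at h1
  have := minpoly.natDegree_pos (isIntegral_zero (B := CoordRing X)
    (R := Algebra.adjoin k (Set.range fun i => form X ((Fin.snoc y u : Fin 3 → _) i))))
  omega

theorem exists_separating (h : IsSection X y z e) [Infinite k] :
    ∃ w : Module.Dual k (Fin 5 → k), Function.Injective fun i => w (e i) := by
  obtain ⟨w, hw⟩ := Module.exists_dual_forall_apply_ne_zero (K := k)
    (fun p : {p : Fin 3 × Fin 3 // p.1 ≠ p.2} => e p.1.1 - e p.1.2)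
    (fun p => sub_ne_zero.mpr fun h0 => p.2 (h.injective h0))
  refine ⟨w, fun i j hij => ?_⟩
  by_contra hne
  refine hw ⟨(i, j), hne⟩ ?_
  rw [map_sub, sub_eq_zero]
  exact hij

theorem three_le_natDegree_minpoly [IsAlgClosed k] (h : IsSection X y z e) (hX : IsClosed X)
    {w : Module.Dual k (Fin 5 → k)} (hw : Function.Injective fun i => w (e i)) :
    3 ≤ (minpoly (Algebra.adjoin k (Set.range fun i => form X ((Fin.snoc y z : Fin 3 → _) i)))
      (form X w)).natDegree := by
  classical
  have hi := h.isIntegral hX (form X w)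
  have hχ (i : Fin 3) (a : Algebra.adjoin k (Set.range fun i => form X ((Fin.snoc y z : Fin 3 → _) i))) :
      evalPt (h.mem i) a = evalPt (h.mem 0) a := by
    refine DFunLike.congr_fun (AlgHom.ext_of_eq_adjoin (φ₁ := (evalPt (h.mem i)).comp (Subalgebra.val _))
      (φ₂ := (evalPt (h.mem 0)).comp (Subalgebra.val _)) rfl ?_) a
    rintro _ ⟨j, rfl⟩
    simp only [AlgHom.comp_apply, Subalgebra.coe_val, evalPt_form]
    induction j using Fin.lastCases with
    | last => simp only [Fin.snoc_last, h.eq_one]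
    | cast j => simp only [Fin.snoc_castSucc, h.eq_zero]
  generalize Algebra.adjoin k (Set.range fun i => form X ((Fin.snoc y z : Fin 3 → _) i)) = A at *
  have hm := minpoly.monic hi
  have h0 := minpoly.aeval A (form X w)
  generalize minpoly A (form X w) = p at *
  let χ : A →+* k := ((evalPt (h.mem 0)).comp A.val).toRingHom
  have hroot (i : Fin 3) : (p.map χ).IsRoot (w (e i)) := by
    have := congrArg (evalPt (h.mem i)) h0
    rw [map_zero, Polynomial.aeval_def, ← AlgHom.coe_toRingHom, Polynomial.hom_eval₂,
      AlgHom.coe_toRingHom, evalPt_form] at this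
    rw [Polynomial.IsRoot, Polynomial.eval_map, ← this]
    congr 1
    ext a
    exact (hχ i a).symm
  have hm' := hm.map χ
  rw [← hm.natDegree_map χ]
  have h1 : (Finset.univ.image fun i => w (e i)).card ≤ (p.map χ).natDegree := by
    refine Polynomial.card_le_degree_of_subset_roots ?_
    intro a ha
    obtain ⟨i, -, rfl⟩ := Finset.mem_image.mp (Finset.mem_def.mpr ha)
    exact (Polynomial.mem_roots hm'.ne_zero).mpr (hroot i)
  rwa [Finset.card_image_of_injective _ hw, Finset.card_univ, Fintype.card_fin] at h1

/-- The three points of a section are not collinear. -/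
theorem not_linearIndependent_snoc [IsAlgClosed k] [CharZero k] (h : IsSection X y z e)
    (hX : IsCubicSurface X) {u : Module.Dual k (Fin 5 → k)} (hu : ∀ i, u (e i) = 0) :
    ¬ LinearIndependent k (Fin.snoc y u : Fin 3 → Module.Dual k (Fin 5 → k)) := by
  intro hli
  have := hX.isDomain
  have hui := h.isIntegral_of_forall hX hu
  set D := (minpoly (Algebra.adjoin k (Set.range fun i => form X (y i))) (form X u)).natDegree
    with hD
  obtain ⟨w, hw⟩ := h.exists_separating
  have hsnoc (x : Module.Dual k (Fin 5 → k))
      (hx : AlgebraicIndependent k fun i => form X ((Fin.snoc y x : Fin 3 → _) i)) :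
      IsIntegral (Algebra.adjoin k (Set.range fun i => form X ((Fin.snoc y x : Fin 3 → _) i)))
        (form X u) ∧
      (minpoly (Algebra.adjoin k (Set.range fun i => form X ((Fin.snoc y x : Fin 3 → _) i)))
        (form X u)).natDegree = D := by
    rw [form_snoc] at *
    exact natDegree_minpoly_snoc (EL.algebraicIndependent_snoc.mp hx).2 hui
  have hD2 : D ≤ 2 := by
    let x := w - w (e 0) • z
    have hxe (i) : x (e i) = w (e i) - w (e 0) := by simp [x, h.eq_one]
    have hx := h.algebraicIndependent_snoc hX (x := x) (i := 1) (by
      rw [hxe, Ne, sub_eq_zero]; exact hw.ne (by decide))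
    obtain ⟨h1, h2⟩ := hsnoc x hx
    have h3 := h.natDegree_minpoly_add_ncard_le hX hx h1
    have h4 : 0 < {i | x (e i) = 0}.ncard :=
      (Set.ncard_pos (Set.toFinite _)).mpr ⟨0, by simp [hxe]⟩
    omega
  have hD3 : D ∣ 3 := by
    have hz := h.algebraicIndependent hX
    obtain ⟨h1, h2⟩ := hsnoc z hz
    have h3 := h.three_le_natDegree_minpoly hX.closed hw
    have := isIntegrallyClosed_adjoin hz
    have := h.isAlgebraic hX.closed
    have := charZero_subalgebra
      (Algebra.adjoin k (Set.range fun i => form X ((Fin.snoc y z : Fin 3 → _) i)))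
    obtain ⟨θ, hθ, hw', hu'⟩ :=
      exists_common_multiple_natDegree_minpoly (h.isIntegral hX.closed (form X w)) h1
    have h4 := h.natDegree_minpoly_add_ncard_le hX hz hθ
    have h5 := Nat.le_of_dvd (minpoly.natDegree_pos hθ) hw'
    rw [h2] at hu'
    have h6 : (minpoly (Algebra.adjoin k (Set.range fun i => form X ((Fin.snoc y z : Fin 3 → _) i)))
      θ).natDegree = 3 := by omega
    rwa [h6] at hu'
  have hD1 : D = 1 := by
    rcases (Nat.dvd_prime Nat.prime_three).mp hD3 with h | h <;> omega
  obtain ⟨Q, hQ, hQ1, hQ0⟩ := exists_homogeneous_of_monic (minpoly.monic hui) (minpoly.aeval _ _)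
  rw [← hD, hD1] at hQ hQ1
  rw [eq_sum_of_isHomogeneous_one hQ] at hQ0
  simp only [map_sum, map_mul, algHom_C, aeval_X] at hQ0
  have h7 : form X (∑ i, coeff (Finsupp.single i 1) Q • (Fin.snoc y u : Fin 3 → _) i) = 0 := by
    rw [← hQ0, map_sum]
    refine Finset.sum_congr rfl fun i _ => ?_
    rw [map_smul]
    exact Algebra.smul_def (R := k) (A := CoordRing X) _ _
  rw [form_eq_zero_iff hX.nondeg] at h7
  have := Fintype.linearIndependent_iff.mp hli _ h7 (Fin.last 2)
  rw [hQ1] at this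
  exact one_ne_zero this

end IsSection
end GeneralPosition

section Projection
variable {k : Type} [Field k] {n : ℕ}

theorem exists_quadratic_coeffs {P : MvPolynomial (Fin 4) k} (hP : P.IsHomogeneous 2) :
    ∃ c₀₀ c₀₁ c₁₁ a₀ a₁ b₀ b₁ d r s : k,
      P = C c₀₀ * MvPolynomial.X 0 ^ 2 + C c₀₁ * (MvPolynomial.X 0 * MvPolynomial.X 1)
        + C c₁₁ * MvPolynomial.X 1 ^ 2
        + C a₀ * (MvPolynomial.X 0 * MvPolynomial.X 2) + C a₁ * (MvPolynomial.X 1 * MvPolynomial.X 2)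
        + C b₀ * (MvPolynomial.X 0 * MvPolynomial.X 3) + C b₁ * (MvPolynomial.X 1 * MvPolynomial.X 3)
        + C d * (MvPolynomial.X 2 * MvPolynomial.X 3)
        + C r * MvPolynomial.X 2 ^ 2 + C s * MvPolynomial.X 3 ^ 2 := by
  have hP' : P ∈ homogeneousSubmodule (Fin 4) k 2 := hP
  have h2 : homogeneousSubmodule (Fin 4) k 2 =
      Submodule.span k (Set.range fun p : Fin 4 × Fin 4 => MvPolynomial.X p.1 * MvPolynomial.X p.2) := by
    rw [← homogeneousSubmodule_one_pow, homogeneousSubmodule_one_eq_span_X, pow_two,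
      Submodule.span_mul_span]
    congr 1
    ext x
    simp [Set.mem_mul]
  rw [h2, Submodule.mem_span_range_iff_exists_fun] at hP'
  obtain ⟨c, rfl⟩ := hP'
  refine ⟨c (0, 0), c (0, 1) + c (1, 0), c (1, 1), c (0, 2) + c (2, 0), c (1, 2) + c (2, 1),
    c (0, 3) + c (3, 0), c (1, 3) + c (3, 1), c (2, 3) + c (3, 2), c (2, 2), c (3, 3), ?_⟩
  simp only [Fintype.sum_prod_type, Fin.sum_univ_four, smul_eq_C_mul, map_add]
  ring

theorem exists_homogeneous_of_not_algebraicIndependent [Infinite k] {X : Set (PS k n)} {m : ℕ}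
    {W : Fin m → Module.Dual k (Fin n → k)}
    (hW : ¬ AlgebraicIndependent k fun i => form X (W i)) :
    ∃ (d : ℕ) (F : MvPolynomial (Fin m) k), F.IsHomogeneous d ∧ F ≠ 0 ∧
      aeval (fun i => form X (W i)) F = 0 := by
  rw [algebraicIndependent_iff] at hW
  push Not at hW
  obtain ⟨F, hF, hF0⟩ := hW
  obtain ⟨d, hd⟩ : ∃ d, homogeneousComponent d F ≠ 0 := by
    by_contra! hc
    exact hF0 (by rw [← sum_homogeneousComponent F]; exact Finset.sum_eq_zero fun i _ => hc i)
  exact ⟨d, _, homogeneousComponent_isHomogeneous d F, hd, aeval_form_homogeneousComponent hF d⟩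

theorem exists_eval_ne_zero [Infinite k] {m d : ℕ} {F : MvPolynomial (Fin m) k}
    (hF : F.IsHomogeneous d) (hF0 : F ≠ 0) (j : Fin m) :
    ∃ w : Fin m → k, w j = 1 ∧ eval w F ≠ 0 := by
  obtain ⟨w, hw⟩ : ∃ w, eval w (F * MvPolynomial.X j) ≠ 0 := by
    by_contra! hc
    exact mul_ne_zero hF0 (X_ne_zero j) (MvPolynomial.funext fun a => by rw [hc a, map_zero])
  rw [map_mul, eval_X, mul_ne_zero_iff] at hw
  refine ⟨(w j)⁻¹ • w, by simp [hw.2], ?_⟩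
  rw [eval_smul_of_isHomogeneous hF]
  exact mul_ne_zero (pow_ne_zero _ (inv_ne_zero hw.2)) hw.1

theorem eq_zero_of_projection {m d : ℕ} {F : MvPolynomial (Fin (m + 1)) k} (hF : F.IsHomogeneous d)
    {w : Fin (m + 1) → k} (hw1 : w (Fin.last m) = 1) (hw : eval w F ≠ 0) {v : Fin (m + 1) → k}
    (hv : eval v F = 0) (hl : ∀ j : Fin m, v j.castSucc - w j.castSucc * v (Fin.last m) = 0) :
    v = 0 := by
  have h1 : v = v (Fin.last m) • w := by
    ext i
    induction i using Fin.lastCases with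
    | last => simp [hw1]
    | cast j => rw [sub_eq_zero.mp (hl j), Pi.smul_apply, smul_eq_mul, mul_comm]
  rw [h1, eval_smul_of_isHomogeneous hF] at hv
  rw [h1, eq_zero_of_pow_eq_zero ((mul_eq_zero.mp hv).resolve_right hw), zero_smul]

theorem isIntegral_projection [IsAlgClosed k] {X : Set (PS k n)} {m d : ℕ}
    {W : Fin (m + 1) → Module.Dual k (Fin n → k)} {F : MvPolynomial (Fin (m + 1)) k}
    (hF : F.IsHomogeneous d) (hF0 : aeval (fun i => form X (W i)) F = 0)
    {w : Fin (m + 1) → k} (hw1 : w (Fin.last m) = 1) (hw : eval w F ≠ 0) :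
    IsIntegral (Algebra.adjoin k (Set.range fun j : Fin m =>
      form X (W j.castSucc - w j.castSucc • W (Fin.last m)))) (form X (W (Fin.last m))) := by
  let l (j : Fin m) : Module.Dual k (Fin (m + 1) → k) :=
    LinearMap.proj j.castSucc - w j.castSucc • LinearMap.proj (Fin.last m)
  have hJ : ∀ f ∈ Ideal.span {F}, ∀ d, homogeneousComponent d f ∈ Ideal.span {F} := by
    intro f hf c
    obtain ⟨g, rfl⟩ := Ideal.mem_span_singleton'.mp hf
    rcases le_or_gt d c with hdc | hdc
    · obtain ⟨b, rfl⟩ := Nat.exists_eq_add_of_le' hdc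
      rw [homogeneousComponent_add_mul hF]
      exact Ideal.mul_mem_left _ _ (Ideal.mem_span_singleton_self F)
    · rw [homogeneousComponent_mul_eq_zero hF g hdc]
      exact zero_mem _
  have := isIntegral_adjoin_of_forall_eq_zero hJ (l := l) (fun v hv hl => by
    refine eq_zero_of_projection hF hw1 hw (hv F (Ideal.mem_span_singleton_self F)) fun j => ?_
    simpa [l] using hl j) (aeval fun i => form X (W i)) (fun f hf => by
    obtain ⟨g, rfl⟩ := Ideal.mem_span_singleton'.mp hf
    rw [map_mul, hF0, mul_zero]) (MvPolynomial.X (Fin.last m))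
  rw [aeval_X] at this
  have hl : (fun j => aeval (fun i => form X (W i)) (lin (l j))) = fun j : Fin m =>
      form X (W j.castSucc - w j.castSucc • W (Fin.last m)) := by
    ext j
    simp only [l, map_sub, map_smul, lin_proj, aeval_X]
  rwa [hl] at this

end Projection

section Quadrics
variable {k : Type} [Field k] {X : Set (PS k 5)} {y : Fin 2 → Module.Dual k (Fin 5 → k)}
  {z : Module.Dual k (Fin 5 → k)} {e : Fin 3 → Fin 5 → k}

theorem IsSection.exists_quadric [IsAlgClosed k] [CharZero k] (h : IsSection X y z e)
    (hX : IsCubicSurface X) {xa xb : Module.Dual k (Fin 5 → k)} {i b : Fin 3}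
    (hb : xb (e b) ≠ 0) (hia : xa (e i) = 0) (hib : xb (e i) = 0)
    (hi : ∀ j, xa (e j) = 0 → xb (e j) = 0 → j = i) :
    ∃ P : MvPolynomial (Fin 4) k, P.IsHomogeneous 2 ∧ P ≠ 0 ∧
      aeval (fun i => form X (![y 0, y 1, xa, xb] i)) P = 0 := by
  have := hX.isDomain
  set W : Fin 4 → Module.Dual k (Fin 5 → k) := ![y 0, y 1, xa, xb] with hW
  obtain ⟨d, F, hF, hF0, hFX⟩ := exists_homogeneous_of_not_algebraicIndependent (X := X) (W := W)
    fun hc => by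
      have := hc.cardinalMk_le_trdeg
      rw [hX.trdeg_eq, Cardinal.mk_fin] at this
      exact absurd (Nat.cast_le.mp this) (by decide)
  obtain ⟨w, hw1, hw⟩ := exists_eval_ne_zero hF hF0 (Fin.last 3)
  have hInt := isIntegral_projection (X := X) hF hFX hw1 hw
  set l : Fin 3 → Module.Dual k (Fin 5 → k) := fun j => W j.castSucc - w j.castSucc • W (Fin.last 3)
    with hl
  change IsIntegral (Algebra.adjoin k (Set.range fun j => form X (l j))) _ at hInt
  have hW3 : W (Fin.last 3) = xb := rfl
  have hlW (j : Fin 3) : W j.castSucc = l j + w j.castSucc • xb := by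
    rw [hl, hW3, sub_add_cancel]
  have hzero (v) (hv : v ∈ affCone X) (hlv : ∀ j, l j v = 0) : ∀ j, W j v = 0 := by
    have := eq_zero_of_projection hF hw1 hw (v := fun j => W j v) (by
      rw [← evalPt_aeval_form W F hv, hFX, map_zero]) fun j => by simpa [hl] using hlv j
    exact fun j => congrFun this j
  have hind : AlgebraicIndependent k fun j => form X (l j) := by
    apply algebraicIndependent_of_isAlgebraic hX.trdeg_eq.ge
    have h1 := isAlgebraic_of_algebraicIndependent hX.trdeg_eq (h.algebraicIndependent_snoc hX hb)
    refine ⟨fun s => (h1.isAlgebraic s).adjoin_of_forall_isAlgebraic ?_⟩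
    rintro _ ⟨⟨j, rfl⟩, -⟩
    refine IsIntegral.isAlgebraic ?_
    have hj (j : Fin 3) : IsIntegral (Algebra.adjoin k (Set.range fun j => form X (l j)))
        (form X (W j.castSucc)) := by
      rw [hlW, map_add, map_smul]
      refine IsIntegral.add ?_ ?_
      · exact isIntegral_algebraMap (x := (⟨_, Algebra.subset_adjoin ⟨j, rfl⟩⟩ :
          Algebra.adjoin k (Set.range fun j => form X (l j))))
      · exact hInt.smul _
    fin_cases j
    · exact hj 0
    · exact hj 1
    · exact hInt
  have hXl : X ∩ linSet (LinearMap.ker (LinearMap.pi l)) =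
      {Projectivization.mk k (e i) (h.ne_zero i)} := by
    ext p
    constructor
    · rintro ⟨hp, hlp⟩
      induction p using Projectivization.ind with | _ v hv =>
      rw [mem_linSet_ker_pi] at hlp
      have hv' := (mem_affCone hv).mpr hp
      have h1 := hzero v hv' hlp
      obtain ⟨j, hj⟩ := h.eq_smul v hv' fun j => by
        fin_cases j
        · exact h1 0
        · exact h1 1
      have hz : z v ≠ 0 := fun h0 => hv (by rw [hj, h0, zero_smul])
      have h2 : xa (e j) = 0 := by
        have : xa v = 0 := h1 2
        rw [hj, map_smul, smul_eq_mul] at this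
        exact (mul_eq_zero.mp this).resolve_left hz
      have h3 : xb (e j) = 0 := by
        have : xb v = 0 := h1 3
        rw [hj, map_smul, smul_eq_mul] at this
        exact (mul_eq_zero.mp this).resolve_left hz
      obtain rfl := hi j h2 h3
      rw [Set.mem_singleton_iff, Projectivization.mk_eq_mk_iff']
      exact ⟨z v, hj.symm⟩
    · rintro rfl
      refine ⟨(mem_affCone _).mp (h.mem i), ?_⟩
      rw [mem_linSet_ker_pi]
      have h1 := h.eq_zero 0 i
      have h2 := h.eq_zero 1 i
      intro j
      fin_cases j <;> simp [hl, hW, h1, h2, hia, hib]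
  have hdeg := hX.natDegree_minpoly_add_ncard_le hind (by rw [hXl]; exact Set.finite_singleton _) hInt
  rw [hXl, Set.ncard_singleton] at hdeg
  obtain ⟨Q, hQ, hQ1, hQ0⟩ := exists_homogeneous_of_monic (minpoly.monic hInt) (minpoly.aeval _ _)
  generalize (minpoly (Algebra.adjoin k (Set.range fun j => form X (l j)))
    (form X (W (Fin.last 3)))).natDegree = D at *
  let τ : Fin 4 → MvPolynomial (Fin 4) k := Fin.snoc (fun j : Fin 3 =>
    MvPolynomial.X j.castSucc - C (w j.castSucc) * MvPolynomial.X (Fin.last 3)) (MvPolynomial.X (Fin.last 3))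
  have hτ (j : Fin 4) : (τ j).IsHomogeneous 1 := by
    induction j using Fin.lastCases with
    | last => simp only [τ, Fin.snoc_last]; exact isHomogeneous_X _ _
    | cast j =>
      simp only [τ, Fin.snoc_castSucc]
      refine (isHomogeneous_X _ _).sub ?_
      have := (isHomogeneous_C (Fin 4) (w j.castSucc)).mul (isHomogeneous_X k (Fin.last 3))
      rwa [zero_add] at this
  have hQh : (Q * MvPolynomial.X (Fin.last 3) ^ (2 - D)).IsHomogeneous 2 := by
    have := hQ.mul ((isHomogeneous_X k (Fin.last 3)).pow (2 - D))
    rwa [one_mul, Nat.add_sub_cancel' (by omega)] at this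
  refine ⟨aeval τ (Q * MvPolynomial.X (Fin.last 3) ^ (2 - D)), ?_, ?_, ?_⟩
  · have := hQh.aeval τ hτ
    rwa [one_mul] at this
  · intro h0
    have h1 := congrArg (eval w) h0
    rw [← aeval_eq_eval, ← AlgHom.comp_apply, comp_aeval, map_zero, aeval_eq_eval, map_mul] at h1
    have hτw : ∀ j, j ≠ Fin.last 3 → aeval w (τ j) = 0 := by
      intro j hj
      induction j using Fin.lastCases with
      | last => exact absurd rfl hj
      | cast j =>
        simp only [τ, Fin.snoc_castSucc, map_sub, map_mul, aeval_X, algHom_C, hw1, mul_one]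
        exact sub_self _
    have hτl : aeval w (τ (Fin.last 3)) = 1 := by
      simp only [τ, Fin.snoc_last, aeval_X, hw1]
    rw [eval_single_of_isHomogeneous hQ (Fin.last 3) hτw, hQ1, hτl, map_pow, eval_X, hτl,
      one_pow, one_pow, one_mul, one_mul] at h1
    exact one_ne_zero h1
  · rw [← AlgHom.comp_apply, comp_aeval]
    have : (fun i => aeval (fun i => form X (W i)) (τ i)) =
        fun i => form X ((Fin.snoc l (W (Fin.last 3)) : Fin 4 → _) i) := by
      ext j
      induction j using Fin.lastCases with
      | last => simp only [τ, Fin.snoc_last, aeval_X]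
      | cast j =>
        simp only [τ, Fin.snoc_castSucc, hl, map_sub, map_smul, map_mul, aeval_X, algHom_C]
        congr 1
        exact (Algebra.smul_def (R := k) (A := CoordRing X) _ _).symm
    rw [this, map_mul, hQ0, zero_mul]

end Quadrics

section DualCoordinates
variable {k : Type} [Field k] {X : Set (PS k 5)} {y : Fin 2 → Module.Dual k (Fin 5 → k)}
  {z : Module.Dual k (Fin 5 → k)} {e : Fin 3 → Fin 5 → k}

theorem linearIndependent_of_algebraicIndependent_form {n m : ℕ} {X : Set (PS k n)}
    [Nontrivial (CoordRing X)]
    {l : Fin m → Module.Dual k (Fin n → k)} (hl : AlgebraicIndependent k fun i => form X (l i)) :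
    LinearIndependent k l :=
  LinearIndependent.of_comp (form X) hl.linearIndependent

theorem prime_adjoin_of_algebraicIndependent {S : Type} [CommRing S] [Algebra k S] {m : ℕ}
    {x : Fin m → S} (hx : AlgebraicIndependent k x) (i : Fin m) :
    Prime (⟨x i, Algebra.subset_adjoin ⟨i, rfl⟩⟩ : Algebra.adjoin k (Set.range x)) := by
  have h1 : hx.aevalEquiv (MvPolynomial.X i) = ⟨x i, Algebra.subset_adjoin ⟨i, rfl⟩⟩ :=
    Subtype.ext (by simp)
  rw [← h1]
  exact (MulEquiv.prime_iff hx.aevalEquiv.toMulEquiv).mpr (MvPolynomial.X_prime)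

theorem not_dvd_adjoin_of_algebraicIndependent {S : Type} [CommRing S] [Algebra k S] {m : ℕ}
    {x : Fin m → S} (hx : AlgebraicIndependent k x) {i j : Fin m} (hij : i ≠ j) :
    ¬ (⟨x i, Algebra.subset_adjoin ⟨i, rfl⟩⟩ : Algebra.adjoin k (Set.range x)) ∣
      ⟨x j, Algebra.subset_adjoin ⟨j, rfl⟩⟩ := by
  have h1 (i) : hx.aevalEquiv (MvPolynomial.X i) = ⟨x i, Algebra.subset_adjoin ⟨i, rfl⟩⟩ :=
    Subtype.ext (by simp)
  rw [← h1, ← h1, map_dvd_iff, MvPolynomial.X_dvd_X]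
  simpa using hij

variable [IsAlgClosed k]

theorem IsSection.linearIndependent (h : IsSection X y z e) (hX : IsCubicSurface X) :
    LinearIndependent k y := by
  have := hX.isDomain
  have h1 := linearIndependent_of_algebraicIndependent_form (h.algebraicIndependent hX)
  exact (linearIndependent_finSnoc.mp h1).1

theorem IsSection.mem_span_range [CharZero k] (h : IsSection X y z e) (hX : IsCubicSurface X)
    {u : Module.Dual k (Fin 5 → k)} (hu : ∀ i, u (e i) = 0) :
    u ∈ Submodule.span k (Set.range y) := by
  by_contra hc
  exact h.not_linearIndependent_snoc hX hu
    (linearIndependent_finSnoc.mpr ⟨h.linearIndependent hX, hc⟩)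

theorem IsSection.exists_dual [CharZero k] (h : IsSection X y z e) (hX : IsCubicSurface X) :
    ∃ x : Fin 3 → Module.Dual k (Fin 5 → k), ∀ i j, x i (e j) = if i = j then 1 else 0 := by
  let E : Module.Dual k (Fin 5 → k) →ₗ[k] (Fin 3 → k) :=
    LinearMap.pi fun j => Module.Dual.eval k _ (e j)
  have hE (u j) : E u j = u (e j) := rfl
  have h1 : LinearMap.ker E ≤ Submodule.span k (Set.range y) := fun u hu =>
    h.mem_span_range hX fun i => congrFun (LinearMap.mem_ker.mp hu) i
  have h2 : Module.finrank k (LinearMap.ker E) ≤ 2 :=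
    (Submodule.finrank_mono h1).trans ((finrank_range_le_card y).trans (by simp))
  have h3 := LinearMap.finrank_range_add_finrank_ker E
  rw [Subspace.dual_finrank_eq, Module.finrank_fin_fun] at h3
  have h4 : LinearMap.range E = ⊤ := by
    apply Submodule.eq_top_of_finrank_eq
    have := (LinearMap.range E).finrank_le
    rw [Module.finrank_fin_fun] at this ⊢
    omega
  choose x hx using fun i : Fin 3 => LinearMap.range_eq_top.mp h4 (fun j => if i = j then 1 else 0)
  exact ⟨x, fun i j => by rw [← hE, hx]⟩

theorem IsSection.eq_zero_of_dual [CharZero k] (h : IsSection X y z e) (hX : IsCubicSurface X)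
    {x : Fin 3 → Module.Dual k (Fin 5 → k)} (hx : ∀ i j, x i (e j) = if i = j then 1 else 0)
    {v : Fin 5 → k} (hy : ∀ j, y j v = 0) (hxv : ∀ i, x i v = 0) : v = 0 := by
  rw [← Module.forall_dual_apply_eq_zero_iff k]
  intro u
  have h1 : u - ∑ i, u (e i) • x i ∈ Submodule.span k (Set.range y) :=
    h.mem_span_range hX fun j => by simp [hx]
  have h2 : ∀ w ∈ Submodule.span k (Set.range y), w v = 0 := by
    intro w hw
    induction hw using Submodule.span_induction with
    | mem w hw => obtain ⟨j, rfl⟩ := hw; exact hy j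
    | zero => rfl
    | add a b _ _ ha hb => rw [LinearMap.add_apply, ha, hb, add_zero]
    | smul c a _ ha => rw [LinearMap.smul_apply, ha, smul_zero]
  have h3 := h2 _ h1
  simpa [hxv] using h3

theorem IsSection.eq_zero_of_relation (h : IsSection X y z e) (hX : IsCubicSurface X)
    {x : Module.Dual k (Fin 5 → k)} {i : Fin 3} (hx : x (e i) ≠ 0) {a₀ a₁ c₀₀ c₀₁ c₁₁ : k}
    (hr : algebraMap k (CoordRing X) a₀ * (form X (y 0) * form X x)
      + algebraMap k (CoordRing X) a₁ * (form X (y 1) * form X x)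
      + algebraMap k (CoordRing X) c₀₀ * form X (y 0) ^ 2
      + algebraMap k (CoordRing X) c₀₁ * (form X (y 0) * form X (y 1))
      + algebraMap k (CoordRing X) c₁₁ * form X (y 1) ^ 2 = 0) :
    a₀ = 0 ∧ a₁ = 0 ∧ c₀₀ = 0 ∧ c₀₁ = 0 ∧ c₁₁ = 0 := by
  have hind := h.algebraicIndependent_snoc hX hx
  rw [algebraicIndependent_iff] at hind
  have h0 := hind (C a₀ * (MvPolynomial.X 0 * MvPolynomial.X 2)
    + C a₁ * (MvPolynomial.X 1 * MvPolynomial.X 2) + C c₀₀ * MvPolynomial.X 0 ^ 2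
    + C c₀₁ * (MvPolynomial.X 0 * MvPolynomial.X 1) + C c₁₁ * MvPolynomial.X 1 ^ 2) (by
      simp only [map_add, map_mul, map_pow, aeval_X, algHom_C]
      exact hr)
  have hv (v : Fin 3 → k) := congrArg (eval v) h0
  simp only [map_add, map_mul, map_pow, eval_X, eval_C, map_zero] at hv
  have h1 := hv ![1, 0, 0]
  have h2 := hv ![0, 1, 0]
  have h3 := hv ![1, 1, 0]
  have h4 := hv ![1, 0, 1]
  have h5 := hv ![0, 1, 1]
  simp at h1 h2 h3 h4 h5
  simp_all

end DualCoordinates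

section QuadricRelations
variable {k : Type} [Field k] {X : Set (PS k 5)} {y : Fin 2 → Module.Dual k (Fin 5 → k)}
  {z : Module.Dual k (Fin 5 → k)} {e : Fin 3 → Fin 5 → k}
variable [IsAlgClosed k]

theorem IsSection.eq_zero_of_bilinear_relation (h : IsSection X y z e) (hX : IsCubicSurface X)
    {xa xb : Module.Dual k (Fin 5 → k)} {a b : Fin 3} (haa : xa (e a) ≠ 0) (hba : xb (e a) = 0)
    (hbb : xb (e b) ≠ 0) {c₀₀ c₀₁ c₁₁ a₀ a₁ b₀ b₁ : k}
    (hr : algebraMap k (CoordRing X) c₀₀ * form X (y 0) ^ 2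
      + algebraMap k (CoordRing X) c₀₁ * (form X (y 0) * form X (y 1))
      + algebraMap k (CoordRing X) c₁₁ * form X (y 1) ^ 2
      + algebraMap k (CoordRing X) a₀ * (form X (y 0) * form X xa)
      + algebraMap k (CoordRing X) a₁ * (form X (y 1) * form X xa)
      + algebraMap k (CoordRing X) b₀ * (form X (y 0) * form X xb)
      + algebraMap k (CoordRing X) b₁ * (form X (y 1) * form X xb) = 0) :
    c₀₀ = 0 ∧ c₀₁ = 0 ∧ c₁₁ = 0 ∧ a₀ = 0 ∧ a₁ = 0 ∧ b₀ = 0 ∧ b₁ = 0 := by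
  have hdom := hX.isDomain
  have hsm (c : k) (u : Module.Dual k (Fin 5 → k)) :
      form X (c • u) = algebraMap k (CoordRing X) c * form X u := by
    rw [map_smul]
    exact Algebra.smul_def (R := k) (A := CoordRing X) _ _
  by_cases hD : a₀ * b₁ - a₁ * b₀ = 0
  · by_cases ha : a₀ = 0 ∧ a₁ = 0
    · obtain ⟨rfl, rfl⟩ := ha
      have := h.eq_zero_of_relation hX hbb (a₀ := b₀) (a₁ := b₁) (c₀₀ := c₀₀) (c₀₁ := c₀₁)
        (c₁₁ := c₁₁) (by
          simp only [map_zero, zero_mul, add_zero] at hr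
          linear_combination hr)
      tauto
    · obtain ⟨c, hc0, hc1⟩ : ∃ c, b₀ = c * a₀ ∧ b₁ = c * a₁ := by
        rw [not_and_or] at ha
        rcases ha with ha | ha
        · exact ⟨b₀ / a₀, by field_simp, by field_simp; linear_combination hD⟩
        · exact ⟨b₁ / a₁, by field_simp; linear_combination -hD, by field_simp⟩
      subst hc0 hc1
      have := h.eq_zero_of_relation hX (x := xa + c • xb) (i := a) (by simpa [hba] using haa)
        (a₀ := a₀) (a₁ := a₁) (c₀₀ := c₀₀) (c₀₁ := c₀₁) (c₁₁ := c₁₁) (by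
          rw [map_add, hsm]
          simp only [map_mul] at hr
          linear_combination hr)
      obtain ⟨rfl, rfl, rfl, rfl, rfl⟩ := this
      simp
  · exfalso
    set D := a₀ * b₁ - a₁ * b₀ with hDdef
    set u := a₀ • y 0 + a₁ • y 1 with hu
    set u' := b₀ • y 0 + b₁ • y 1 with hu'
    have hy0 : y 0 = D⁻¹ • (b₁ • u - a₁ • u') := by
      rw [eq_inv_smul_iff₀ hD, hu, hu', hDdef]; module
    have hy1 : y 1 = D⁻¹ • (a₀ • u' - b₀ • u) := by
      rw [eq_inv_smul_iff₀ hD, hu, hu', hDdef]; module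
    have h' : IsSection X ![u, u'] z e := h.change_basis fun v => by
      constructor
      · intro hv
        have h0 : u v = 0 := hv 0
        have h1 : u' v = 0 := hv 1
        intro j
        fin_cases j
        · change y 0 v = 0
          rw [hy0]; simp [h0, h1]
        · change y 1 v = 0
          rw [hy1]; simp [h0, h1]
      · intro hv j
        fin_cases j <;> simp [hu, hu', hv]
    set g := D⁻¹ • (b₁ • (c₀₀ • y 0 + c₀₁ • y 1) - (b₀ * c₁₁) • y 1) with hg
    set g' := D⁻¹ • ((a₀ * c₁₁) • y 1 - a₁ • (c₀₀ • y 0 + c₀₁ • y 1)) with hg'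
    have hrel : form X u * form X (xa + g) + form X u' * form X (xb + g') = 0 := by
      have hDi : algebraMap k (CoordRing X) D⁻¹ * algebraMap k (CoordRing X) D = 1 := by
        rw [← map_mul, inv_mul_cancel₀ hD, map_one]
      rw [hDdef] at hDi
      simp only [hu, hu', hg, hg', map_add, map_sub, hsm] at hDi ⊢
      generalize algebraMap k (CoordRing X) (a₀ * b₁ - a₁ * b₀)⁻¹ = Di at *
      simp only [map_mul] at hDi ⊢
      linear_combination hr + (algebraMap k (CoordRing X) c₀₀ * form X (y 0) ^ 2
      + algebraMap k (CoordRing X) c₀₁ * (form X (y 0) * form X (y 1))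
      + algebraMap k (CoordRing X) c₁₁ * form X (y 1) ^ 2) * hDi
    have hind := h'.algebraicIndependent hX
    have hInt := h'.isIntegral hX.closed
    set x : Fin 3 → CoordRing X := fun i => form X ((Fin.snoc ![u, u'] z : Fin 3 → _) i) with hx
    have : IsIntegrallyClosed (Algebra.adjoin k (Set.range x)) := isIntegrallyClosed_adjoin hind
    have h0 : evalPt (h.mem a) (form X (xa + g)) = 0 := by
      refine eq_zero_of_mul_add_mul_eq_zero (A := Algebra.adjoin k (Set.range x))
        (prime_adjoin_of_algebraicIndependent hind 1)
        (not_dvd_adjoin_of_algebraicIndependent hind (i := 1) (j := 0) (by decide))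
        (hInt (form X (xa + g))) (hInt (form X (xb + g'))) hrel (evalPt (h.mem a) : CoordRing X →+* k) ?_
      change evalPt (h.mem a) (form X u') = 0
      rw [evalPt_form, hu']
      simp [h.eq_zero]
    rw [evalPt_form] at h0
    apply haa
    simpa [hg, h.eq_zero] using h0

theorem IsSection.exists_quadratic_relation [CharZero k] (h : IsSection X y z e)
    (hX : IsCubicSurface X) {x : Fin 3 → Module.Dual k (Fin 5 → k)}
    (hx : ∀ i j, x i (e j) = if i = j then 1 else 0) {i a b : Fin 3} (hab : a ≠ b) (hia : i ≠ a)
    (hib : i ≠ b) :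
    ∃ p ∈ Submodule.span k (Set.range y), ∃ q ∈ Submodule.span k (Set.range y),
      ∃ B ∈ Algebra.adjoin k (Set.range fun j => form X (y j)),
        form X (x a) * form X (x b) + form X p * form X (x a) + form X q * form X (x b) + B = 0 := by
  have hdom := hX.isDomain
  have hsm (c : k) (u : Module.Dual k (Fin 5 → k)) :
      form X (c • u) = algebraMap k (CoordRing X) c * form X u := by
    rw [map_smul]
    exact Algebra.smul_def (R := k) (A := CoordRing X) _ _
  obtain ⟨P, hP, hP0, hPX⟩ := h.exists_quadric hX (xa := x a) (xb := x b) (i := i) (b := b)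
    (by simp [hx]) (by simp [hx, hia.symm]) (by simp [hx, hib.symm]) (fun j h1 h2 => by
      simp only [hx, ite_eq_right_iff, one_ne_zero, imp_false] at h1 h2
      clear * - hab hia hib h1 h2
      revert i a b j
      decide)
  obtain ⟨c₀₀, c₀₁, c₁₁, a₀, a₁, b₀, b₁, d, r, s, rfl⟩ := exists_quadratic_coeffs hP
  have hev (j : Fin 3) := congrArg (evalPt (h.mem j)) hPX
  simp only [map_add, map_mul, map_pow, aeval_X, algHom_C, map_zero, evalPt_form, AlgHom.commutes]
    at hev hPX
  have hr := hev a
  have hs := hev b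
  simp [h.eq_zero, hx, hab, hab.symm] at hr hs
  subst hr hs
  simp at hPX
  have hd : d ≠ 0 := by
    rintro rfl
    apply hP0
    obtain ⟨rfl, rfl, rfl, rfl, rfl, rfl, rfl⟩ := h.eq_zero_of_bilinear_relation hX (xa := x a)
      (xb := x b) (a := a) (b := b) (by simp [hx]) (by simp [hx, hab.symm]) (by simp [hx])
      (c₀₀ := c₀₀) (c₀₁ := c₀₁) (c₁₁ := c₁₁) (a₀ := a₀) (a₁ := a₁)
      (b₀ := b₀) (b₁ := b₁) (by simpa using hPX)
    simp
  have hy (j) : y j ∈ Submodule.span k (Set.range y) := Submodule.subset_span ⟨j, rfl⟩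
  have hY (j) : form X (y j) ∈ Algebra.adjoin k (Set.range fun j => form X (y j)) :=
    Algebra.subset_adjoin ⟨j, rfl⟩
  have hmap (c : k) : algebraMap k (CoordRing X) c ∈
    Algebra.adjoin k (Set.range fun j => form X (y j)) := Subalgebra.algebraMap_mem _ c
  refine ⟨(d⁻¹ * a₀) • y 0 + (d⁻¹ * a₁) • y 1, add_mem (Submodule.smul_mem _ _ (hy 0))
    (Submodule.smul_mem _ _ (hy 1)), (d⁻¹ * b₀) • y 0 + (d⁻¹ * b₁) • y 1,
    add_mem (Submodule.smul_mem _ _ (hy 0)) (Submodule.smul_mem _ _ (hy 1)),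
    algebraMap k (CoordRing X) d⁻¹ * (algebraMap k (CoordRing X) c₀₀ * form X (y 0) ^ 2
      + algebraMap k (CoordRing X) c₀₁ * (form X (y 0) * form X (y 1))
      + algebraMap k (CoordRing X) c₁₁ * form X (y 1) ^ 2),
    mul_mem (hmap _) (add_mem (add_mem (mul_mem (hmap _) (pow_mem (hY 0) 2))
      (mul_mem (hmap _) (mul_mem (hY 0) (hY 1)))) (mul_mem (hmap _) (pow_mem (hY 1) 2))), ?_⟩
  have hDi : algebraMap k (CoordRing X) d⁻¹ * algebraMap k (CoordRing X) d = 1 := by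
    rw [← map_mul, inv_mul_cancel₀ hd, map_one]
  simp only [map_add, hsm, map_mul]
  generalize algebraMap k (CoordRing X) d⁻¹ = Di at *
  linear_combination (Di) * hPX - form X (x a) * form X (x b) * hDi

end QuadricRelations

section NormalForm
variable {k : Type} [Field k]

theorem eq_zero_of_transcendental {S : Type} [CommRing S] [Algebra k S] {A : Subalgebra k S}
    {x : S} (hx : Transcendental A x) {a b c : S} (ha : a ∈ A) (hb : b ∈ A) (hc : c ∈ A)
    (h : a * x ^ 2 + b * x + c = 0) : a = 0 ∧ b = 0 ∧ c = 0 := by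
  rw [transcendental_iff] at hx
  have h0 := hx (Polynomial.C ⟨a, ha⟩ * Polynomial.X ^ 2 + Polynomial.C ⟨b, hb⟩ * Polynomial.X
    + Polynomial.C ⟨c, hc⟩) (by simpa [Subalgebra.algebraMap_def] using h)
  have h1 (n : ℕ) := congrArg (fun f => ((f.coeff n : A) : S)) h0
  have ha := h1 2
  have hb := h1 1
  have hc := h1 0
  simp [Polynomial.coeff_X, Polynomial.coeff_C] at ha hb hc
  exact ⟨ha, hb, hc⟩

theorem syzygy_constants {S : Type} [CommRing S] [IsDomain S] [Algebra k S] {A : Subalgebra k S}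
    {P Q R r s t b₂ b₃ b₄ : S} (hR : Transcendental A R) (hP : P ≠ 0) (hQ : Q ≠ 0)
    (hr : r ∈ A) (hs : s ∈ A) (ht : t ∈ A) (hb₂ : b₂ ∈ A) (hb₃ : b₃ ∈ A) (hb₄ : b₄ ∈ A)
    (h₂ : Q * R + s * R + b₂ = 0) (h₃ : P * R + t * P + b₃ = 0) (h₄ : P * Q + r * Q + b₄ = 0) :
    b₂ = s * t ∧ b₃ = r * t ∧ b₄ = r * s := by
  have h1 : (s * t - b₂) * P + (b₄ - r * s) * R + (s * b₃ - r * b₂) = 0 := by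
    linear_combination (-P - r) * h₂ + s * h₃ + R * h₄
  obtain ⟨h2, h3, -⟩ := eq_zero_of_transcendental hR (a := b₄ - r * s)
    (b := (b₄ - r * s) * t + (s * b₃ - r * b₂))
    (c := (s * b₃ - r * b₂) * t - (s * t - b₂) * b₃) (sub_mem hb₄ (mul_mem hr hs))
    (add_mem (mul_mem (sub_mem hb₄ (mul_mem hr hs)) ht)
      (sub_mem (mul_mem hs hb₃) (mul_mem hr hb₂)))
    (sub_mem (mul_mem (sub_mem (mul_mem hs hb₃) (mul_mem hr hb₂)) ht)
      (mul_mem (sub_mem (mul_mem hs ht) hb₂) hb₃)) (by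
      linear_combination (R + t) * h1 - (s * t - b₂) * h₃)
  have h4 : s * b₃ - r * b₂ = 0 := by linear_combination h3 - t * h2
  have h5 : s * t - b₂ = 0 := by
    refine (mul_eq_zero.mp (?_ : (s * t - b₂) * P = 0)).resolve_right hP
    linear_combination h1 - R * h2 - h4
  have h6 : r * t - b₃ = 0 := by
    refine (mul_eq_zero.mp (?_ : (r * t - b₃) * Q = 0)).resolve_right hQ
    linear_combination (R + t) * h₄ - Q * h₃ - r * h₂ - (R + t) * h2 - r * h5
  exact ⟨by linear_combination -h5, by linear_combination -h6, by linear_combination h2⟩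

/-- Linear forms in which the quadrics through a cubic surface take a symmetric shape. -/
structure IsNormalForm (X : Set (PS k 5)) (y : Fin 2 → Module.Dual k (Fin 5 → k))
    (P Q R r s t : Module.Dual k (Fin 5 → k)) : Prop where
  linearIndependent : LinearIndependent k y
  r_mem : r ∈ Submodule.span k (Set.range y)
  s_mem : s ∈ Submodule.span k (Set.range y)
  t_mem : t ∈ Submodule.span k (Set.range y)
  r_ne : r ≠ 0
  s_ne : s ≠ 0
  t_ne : t ≠ 0
  eq_zero : ∀ v, (∀ j, y j v = 0) → P v = 0 → Q v = 0 → R v = 0 → v = 0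
  rel_R : form X R * (form X Q + form X s) = -(form X s * form X t)
  rel_P : form X P * (form X R + form X t) = -(form X r * form X t)
  rel_Q : form X Q * (form X P + form X r) = -(form X r * form X s)

theorem IsNormalForm.rotate {X : Set (PS k 5)} {y : Fin 2 → Module.Dual k (Fin 5 → k)}
    {P Q R r s t : Module.Dual k (Fin 5 → k)} (h : IsNormalForm X y P Q R r s t) :
    IsNormalForm X y R P Q t r s where
  linearIndependent := h.linearIndependent
  r_mem := h.t_mem
  s_mem := h.r_mem
  t_mem := h.s_mem
  r_ne := h.t_ne
  s_ne := h.r_ne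
  t_ne := h.s_ne
  eq_zero v hy hR hP hQ := h.eq_zero v hy hP hQ hR
  rel_R := h.rel_Q
  rel_P := by rw [h.rel_R, mul_comm]
  rel_Q := by rw [h.rel_P, mul_comm]

theorem apply_eq_zero_of_mem_span {V : Type} [AddCommGroup V] [Module k V] {ι : Type}
    {y : ι → Module.Dual k V} {u : Module.Dual k V} (hu : u ∈ Submodule.span k (Set.range y))
    {v : V} (hv : ∀ j, y j v = 0) : u v = 0 := by
  induction hu using Submodule.span_induction with
  | mem w hw => obtain ⟨j, rfl⟩ := hw; exact hv j
  | zero => rfl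
  | add a b _ _ ha hb => rw [LinearMap.add_apply, ha, hb, add_zero]
  | smul c a _ ha => rw [LinearMap.smul_apply, ha, smul_zero]

theorem form_mem_adjoin {X : Set (PS k 5)} {y : Fin 2 → Module.Dual k (Fin 5 → k)}
    {u : Module.Dual k (Fin 5 → k)} (hu : u ∈ Submodule.span k (Set.range y)) :
    form X u ∈ Algebra.adjoin k (Set.range fun j => form X (y j)) := by
  induction hu using Submodule.span_induction with
  | mem w hw => obtain ⟨j, rfl⟩ := hw; exact Algebra.subset_adjoin ⟨j, rfl⟩
  | zero => rw [map_zero]; exact zero_mem _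
  | add a b _ _ ha hb => rw [map_add]; exact add_mem ha hb
  | smul c a _ ha => rw [map_smul]; exact Subalgebra.smul_mem _ ha c

theorem IsSection.exists_isNormalForm [IsAlgClosed k] [CharZero k] {X : Set (PS k 5)}
    {y : Fin 2 → Module.Dual k (Fin 5 → k)} {z : Module.Dual k (Fin 5 → k)} {e : Fin 3 → Fin 5 → k}
    (h : IsSection X y z e) (hX : IsCubicSurface X) :
    ∃ P Q R r s t, IsNormalForm X y P Q R r s t := by
  have hdom := hX.isDomain
  obtain ⟨x, hx⟩ := h.exists_dual hX
  obtain ⟨p₂, hp₂, q₂, hq₂, B₂, hB₂, h₂⟩ := h.exists_quadratic_relation hX hx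
    (i := 0) (a := 1) (b := 2) (by decide) (by decide) (by decide)
  obtain ⟨p₃, hp₃, q₃, hq₃, B₃, hB₃, h₃⟩ := h.exists_quadratic_relation hX hx
    (i := 1) (a := 0) (b := 2) (by decide) (by decide) (by decide)
  obtain ⟨p₄, hp₄, q₄, hq₄, B₄, hB₄, h₄⟩ := h.exists_quadratic_relation hX hx
    (i := 2) (a := 0) (b := 1) (by decide) (by decide) (by decide)
  have hye {u} (hu : u ∈ Submodule.span k (Set.range y)) (i : Fin 3) : u (e i) = 0 :=
    apply_eq_zero_of_mem_span hu fun j => h.eq_zero j i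
  have hPe : (x 0 + q₃) (e 0) = 1 := by simp [hx, hye hq₃]
  have hQe : (x 1 + p₄) (e 1) = 1 := by simp [hx, hye hp₄]
  have hRe : (x 2 + p₂) (e 2) = 1 := by simp [hx, hye hp₂]
  have hne {u : Module.Dual k (Fin 5 → k)} {v} (huv : u v = 1) : form X u ≠ 0 := by
    rw [Ne, form_eq_zero_iff hX.nondeg]
    rintro rfl
    exact zero_ne_one huv
  have hRA : Transcendental (Algebra.adjoin k (Set.range fun j => form X (y j)))
      (form X (x 2 + p₂)) := by
    have h1 := h.algebraicIndependent_snoc hX (x := x 2 + p₂) (i := 2) (by rw [hRe]; exact one_ne_zero)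
    rw [form_snoc, EL.algebraicIndependent_snoc] at h1
    exact h1.2
  have hs : q₂ - p₄ ∈ Submodule.span k (Set.range y) := sub_mem hq₂ hp₄
  have ht : p₃ - p₂ ∈ Submodule.span k (Set.range y) := sub_mem hp₃ hp₂
  have hr : q₄ - q₃ ∈ Submodule.span k (Set.range y) := sub_mem hq₄ hq₃
  have hmul {a b} (ha : a ∈ Submodule.span k (Set.range y)) (hb : b ∈ Submodule.span k (Set.range y)) :
      form X a * form X b ∈ Algebra.adjoin k (Set.range fun j => form X (y j)) :=
    mul_mem (form_mem_adjoin ha) (form_mem_adjoin hb)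
  obtain ⟨e₂, e₃, e₄⟩ := syzygy_constants (P := form X (x 0 + q₃)) (Q := form X (x 1 + p₄)) hRA
    (hne hPe) (hne hQe) (form_mem_adjoin hr) (form_mem_adjoin hs) (form_mem_adjoin ht)
    (sub_mem hB₂ (hmul hq₂ hp₂)) (sub_mem hB₃ (hmul hp₃ hq₃)) (sub_mem hB₄ (hmul hq₄ hp₄))
    (by simp only [map_add, map_sub]; linear_combination h₂)
    (by simp only [map_add, map_sub]; linear_combination h₃)
    (by simp only [map_add, map_sub]; linear_combination h₄)
  have relR : form X (x 2 + p₂) * (form X (x 1 + p₄) + form X (q₂ - p₄)) =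
      -(form X (q₂ - p₄) * form X (p₃ - p₂)) := by
    rw [← e₂]; simp only [map_add, map_sub]; linear_combination h₂
  have relP : form X (x 0 + q₃) * (form X (x 2 + p₂) + form X (p₃ - p₂)) =
      -(form X (q₄ - q₃) * form X (p₃ - p₂)) := by
    rw [← e₃]; simp only [map_add, map_sub]; linear_combination h₃
  have relQ : form X (x 1 + p₄) * (form X (x 0 + q₃) + form X (q₄ - q₃)) =
      -(form X (q₄ - q₃) * form X (q₂ - p₄)) := by
    rw [← e₄]; simp only [map_add, map_sub]; linear_combination h₄
  refine ⟨x 0 + q₃, x 1 + p₄, x 2 + p₂, q₄ - q₃, q₂ - p₄, p₃ - p₂, h.linearIndependent hX,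
    hr, hs, ht, ?_, ?_, ?_, fun v hv hP hQ hR => ?_, relR, relP, relQ⟩
  · intro h0
    rw [h0, map_zero, add_zero, zero_mul, neg_zero] at relQ
    exact mul_ne_zero (hne hQe) (hne hPe) relQ
  · intro h0
    rw [h0, map_zero, add_zero, zero_mul, neg_zero] at relR
    exact mul_ne_zero (hne hRe) (hne hQe) relR
  · intro h0
    rw [h0, map_zero, add_zero, mul_zero, neg_zero] at relP
    exact mul_ne_zero (hne hPe) (hne hRe) relP
  · refine h.eq_zero_of_dual hX hx hv fun i => ?_
    have hz {u} (hu : u ∈ Submodule.span k (Set.range y)) : u v = 0 :=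
      apply_eq_zero_of_mem_span hu hv
    rw [LinearMap.add_apply, hz hq₃, add_zero] at hP
    rw [LinearMap.add_apply, hz hp₄, add_zero] at hQ
    rw [LinearMap.add_apply, hz hp₂, add_zero] at hR
    fin_cases i
    · exact hP
    · exact hQ
    · exact hR

end NormalForm

section Parametrization
variable {k : Type} [Field k]

theorem aeval_mul_of_isHomogeneous {σ S : Type} [CommRing S] [Algebra k S] {f : MvPolynomial σ k}
    {d : ℕ} (hf : f.IsHomogeneous d) (c : S) (x : σ → S) :
    aeval (fun i => c * x i) f = c ^ d * aeval x f := by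
  rw [f.as_sum, map_sum, map_sum, Finset.mul_sum]
  refine Finset.sum_congr rfl fun v hv => ?_
  have hd : v.degree = d := by
    rw [Finsupp.degree_eq_weight_one, ← hf (mem_support_iff.mp hv)]; rfl
  rw [aeval_monomial, aeval_monomial, ← hd]
  simp only [mul_pow, Finsupp.prod_mul]
  have : (v.prod fun _ n => c ^ n) = c ^ v.degree := by
    rw [Finsupp.prod, Finset.prod_pow_eq_pow_sum]; rfl
  rw [this]
  ring

theorem IsCubicSurface.exists_parametrization [IsAlgClosed k] {X : Set (PS k 5)}
    (hX : IsCubicSurface X) {ψ : Fin 5 → Module.Dual k (Fin 5 → k)}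
    (hψ : ∀ v, (∀ i, ψ i v = 0) → v = 0) {u : Fin 3 → Module.Dual k (Fin 5 → k)}
    {m : Fin 5 → MvPolynomial (Fin 3) k} {c : MvPolynomial (Fin 3) k}
    (hc : aeval (fun i => form X (u i)) c ≠ 0)
    (hm : ∀ i, aeval (fun i => form X (u i)) c * form X (ψ i) = aeval (fun i => form X (u i)) (m i)) :
    ∃ e : (Fin 5 → k) ≃ₗ[k] (Fin 5 → k), (∀ v i, e v i = ψ i v) ∧
      ∀ (a : Fin 3 → k) (h : e.symm (fun i => eval a (m i)) ≠ 0),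
        Projectivization.mk k _ h ∈ X := by
  have hdom := hX.isDomain
  have hinj : Function.Injective (LinearMap.pi ψ) := by
    rw [← LinearMap.ker_eq_bot, LinearMap.ker_eq_bot']
    exact fun v hv => hψ v fun i => congrFun hv i
  let e := LinearEquiv.ofInjectiveEndo (LinearMap.pi ψ) hinj
  have he (v i) : e v i = ψ i v := rfl
  have hej (w : Fin 5 → k) (i : Fin 5) : e.symm w i = ∑ j, e.symm (Pi.single j 1) i * w j := by
    conv_lhs => rw [pi_eq_sum_univ' w]
    rw [map_sum, Finset.sum_apply]
    simp [mul_comm]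
  have hproj (i : Fin 5) : LinearMap.proj i =
      ∑ j, (e.symm (Pi.single j 1) i) • ψ j := by
    refine LinearMap.ext fun v => ?_
    obtain ⟨w, rfl⟩ := e.symm.surjective v
    rw [LinearMap.sum_apply]
    simp only [LinearMap.smul_apply, ← he, LinearEquiv.apply_symm_apply, LinearMap.proj_apply]
    exact hej w i
  refine ⟨e, he, fun a h => ?_⟩
  set x := fun i => form X (u i) with hx
  set A := Algebra.adjoin k (Set.range x) with hA
  have hmem (f : MvPolynomial (Fin 3) k) : aeval x f ∈ A := by
    rw [hA, Algebra.adjoin_range_eq_range_aeval]; exact ⟨f, rfl⟩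
  have hind : AlgebraicIndependent k x := by
    apply algebraicIndependent_of_isAlgebraic hX.trdeg_eq.ge
    have hψa (i) : IsAlgebraic A (form X (ψ i)) := by
      refine ⟨Polynomial.C ⟨aeval x c, hmem c⟩ * Polynomial.X - Polynomial.C ⟨_, hmem (m i)⟩,
        fun h0 => hc ?_, ?_⟩
      · have := congrArg (fun p => ((p.coeff 1 : A) : CoordRing X)) h0
        simpa [Polynomial.coeff_C] using this
      · simp only [map_sub, map_mul, Polynomial.aeval_C, Polynomial.aeval_X]
        exact sub_eq_zero.mpr (hm i)
    have hpa (i : Fin 5) : IsAlgebraic A (form X (LinearMap.proj i)) := by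
      rw [hproj, map_sum]
      refine Finset.sum_induction _ (IsAlgebraic A) (fun _ _ => IsAlgebraic.add) isAlgebraic_zero
        fun j _ => ?_
      rw [map_smul]
      exact (Algebra.smul_def (R := k) (A := CoordRing X) _ (form X (ψ j))) ▸
        (isAlgebraic_algebraMap (algebraMap k A _)).mul (hψa j)
    refine ⟨fun s => ?_⟩
    obtain ⟨f, rfl⟩ := Ideal.Quotient.mk_surjective s
    rw [mk_eq_aeval_form]
    induction f using MvPolynomial.induction_on with
    | C c => rw [algHom_C]; exact isAlgebraic_algebraMap (algebraMap k A c)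
    | add f g hf hg => rw [map_add]; exact hf.add hg
    | mul_X f i hf => rw [map_mul, aeval_X]; exact hf.mul (hpa i)
  rw [← mem_affCone, mem_affCone_iff hX.closed]
  intro f hf
  rw [← sum_homogeneousComponent f, map_sum]
  refine Finset.sum_eq_zero fun d _ => ?_
  have hfd := homogeneousComponent_mem_coneIdeal hf d
  have hfh := homogeneousComponent_isHomogeneous d f
  generalize homogeneousComponent d f = g at *
  have h0 : aeval (fun i => form X (LinearMap.proj i)) g = 0 := by
    rw [← mk_eq_aeval_form]; exact Ideal.Quotient.eq_zero_iff_mem.mpr hfd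
  have h1 := aeval_mul_of_isHomogeneous hfh (aeval x c) (fun i => form X (LinearMap.proj i))
  rw [h0, mul_zero] at h1
  have h2 (i : Fin 5) : aeval x c * form X (LinearMap.proj i) =
      aeval x (∑ j, C (e.symm (Pi.single j 1) i) * m j) := by
    rw [hproj, map_sum, map_sum, Finset.mul_sum]
    refine Finset.sum_congr rfl fun j _ => ?_
    rw [map_smul, map_mul, ← hm, algHom_C]
    rw [Algebra.smul_def (R := k) (A := CoordRing X)]
    ring
  simp only [h2] at h1
  rw [← comp_aeval, AlgHom.comp_apply] at h1
  have h3 := congrArg (eval a) (algebraicIndependent_iff.mp hind _ h1)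
  rw [map_zero, ← aeval_eq_eval, ← AlgHom.comp_apply, comp_aeval] at h3
  rw [← h3, ← aeval_eq_eval]
  congr 2
  funext i
  rw [hej]
  simp [aeval_eq_eval]

end Parametrization

section Classification
variable {k : Type} [Field k]

theorem ne_zero_of_forall_eq_zero {n : ℕ} {ψ : Fin n → Module.Dual k (Fin n → k)}
    (hψ : ∀ v, (∀ i, ψ i v = 0) → v = 0) (i : Fin n) : ψ i ≠ 0 := by
  have hinj : Function.Injective (LinearMap.pi ψ) := by
    rw [← LinearMap.ker_eq_bot, LinearMap.ker_eq_bot']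
    exact fun v hv => hψ v fun i => congrFun hv i
  obtain ⟨v, hv⟩ := LinearMap.injective_iff_surjective.mp hinj (Pi.single i 1)
  intro h0
  have h1 := congrFun hv i
  simp [h0] at h1

theorem form_smul {n : ℕ} {X : Set (PS k n)} (c : k) (u : Module.Dual k (Fin n → k)) :
    form X (c • u) = algebraMap k (CoordRing X) c * form X u := by
  rw [map_smul]
  exact Algebra.smul_def (R := k) (A := CoordRing X) _ _

variable [IsAlgClosed k] {X : Set (PS k 5)}

theorem IsCubicSurface.exists_isScroll (hX : IsCubicSurface X)
    {ψ : Fin 5 → Module.Dual k (Fin 5 → k)} (hψ : ∀ v, (∀ i, ψ i v = 0) → v = 0)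
    (h₁ : form X (ψ 0) * form X (ψ 2) = form X (ψ 1) ^ 2)
    (h₂ : form X (ψ 0) * form X (ψ 4) = form X (ψ 1) * form X (ψ 3))
    (h₃ : form X (ψ 1) * form X (ψ 4) = form X (ψ 2) * form X (ψ 3)) :
    ∃ e, IsScroll e X := by
  have h₀ := ne_zero_of_forall_eq_zero hψ 0
  obtain ⟨e, he, hpts⟩ := hX.exists_parametrization hψ (u := ![ψ 0, ψ 1, ψ 3])
    (c := MvPolynomial.X 0)
    (m := ![MvPolynomial.X 0 ^ 2, MvPolynomial.X 0 * MvPolynomial.X 1, MvPolynomial.X 1 ^ 2,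
      MvPolynomial.X 0 * MvPolynomial.X 2, MvPolynomial.X 1 * MvPolynomial.X 2])
    (by simpa [form_eq_zero_iff hX.nondeg] using h₀) (fun i => by
      fin_cases i <;> simp [h₁, h₂, pow_two])
  refine ⟨e, ⟨fun v hv hvX => ?_, fun a b c => ?_⟩⟩
  · have hv' := (mem_affCone hv).mpr hvX
    have e₁ := congrArg (evalPt hv') h₁
    have e₂ := congrArg (evalPt hv') h₂
    have e₃ := congrArg (evalPt hv') h₃
    simp only [map_mul, map_pow, evalPt_form] at e₁ e₂ e₃
    simp only [he]
    exact ⟨e₁, e₂, e₃⟩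
  · have := hpts ![a, b, c]
    have h : (fun i => eval ![a, b, c] ((![MvPolynomial.X 0 ^ 2, MvPolynomial.X 0 * MvPolynomial.X 1,
        MvPolynomial.X 1 ^ 2, MvPolynomial.X 0 * MvPolynomial.X 2,
        MvPolynomial.X 1 * MvPolynomial.X 2] : Fin 5 → MvPolynomial (Fin 3) k) i)) =
        ![a ^ 2, a * b, b ^ 2, a * c, b * c] := by
      funext i
      fin_cases i <;> simp
    rw [h] at this
    exact this

theorem IsCubicSurface.exists_isCubicCone (hX : IsCubicSurface X)
    {ψ : Fin 5 → Module.Dual k (Fin 5 → k)} (hψ : ∀ v, (∀ i, ψ i v = 0) → v = 0)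
    (h₁ : form X (ψ 0) * form X (ψ 2) = form X (ψ 1) ^ 2)
    (h₂ : form X (ψ 0) * form X (ψ 3) = form X (ψ 1) * form X (ψ 2))
    (h₃ : form X (ψ 1) * form X (ψ 3) = form X (ψ 2) ^ 2) :
    ∃ e, IsCubicCone e X := by
  have hdom := hX.isDomain
  have h₀ := ne_zero_of_forall_eq_zero hψ 0
  obtain ⟨e, he, hpts⟩ := hX.exists_parametrization hψ (u := ![ψ 0, ψ 1, ψ 4])
    (c := MvPolynomial.X 0 ^ 2)
    (m := ![MvPolynomial.X 0 ^ 3, MvPolynomial.X 0 ^ 2 * MvPolynomial.X 1,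
      MvPolynomial.X 0 * MvPolynomial.X 1 ^ 2, MvPolynomial.X 1 ^ 3,
      MvPolynomial.X 0 ^ 2 * MvPolynomial.X 2])
    (by simpa [form_eq_zero_iff hX.nondeg] using h₀) (fun i => by
      fin_cases i
      · simp; ring
      · simp
      · simp; linear_combination form X (ψ 0) * h₁
      · simp; linear_combination form X (ψ 0) * h₂ + form X (ψ 1) * h₁
      · simp)
  refine ⟨e, ⟨fun v hv hvX => ?_, fun a b c => ?_⟩⟩
  · have hv' := (mem_affCone hv).mpr hvX
    have e₁ := congrArg (evalPt hv') h₁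
    have e₂ := congrArg (evalPt hv') h₂
    have e₃ := congrArg (evalPt hv') h₃
    simp only [map_mul, map_pow, evalPt_form] at e₁ e₂ e₃
    simp only [he]
    exact ⟨e₁, e₂, e₃⟩
  · have := hpts ![a, b, c]
    have h : (fun i => eval ![a, b, c] ((![MvPolynomial.X 0 ^ 3,
        MvPolynomial.X 0 ^ 2 * MvPolynomial.X 1, MvPolynomial.X 0 * MvPolynomial.X 1 ^ 2,
        MvPolynomial.X 1 ^ 3, MvPolynomial.X 0 ^ 2 * MvPolynomial.X 2] :
          Fin 5 → MvPolynomial (Fin 3) k) i)) =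
        ![a ^ 3, a ^ 2 * b, a * b ^ 2, b ^ 3, a ^ 2 * c] := by
      funext i
      fin_cases i <;> simp
    rw [h] at this
    exact this

variable {y : Fin 2 → Module.Dual k (Fin 5 → k)} {P Q R r s t : Module.Dual k (Fin 5 → k)}

theorem IsNormalForm.exists_isScroll (h : IsNormalForm X y P Q R r s t) (hX : IsCubicSurface X)
    (hrs : LinearIndependent k ![r, s]) : ∃ e, IsScroll e X := by
  have hspan : Submodule.span k (Set.range ![r, s]) = Submodule.span k (Set.range y) := by
    refine Submodule.eq_of_le_of_finrank_eq (Submodule.span_le.mpr ?_) ?_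
    · rintro _ ⟨i, rfl⟩
      fin_cases i
      · exact h.r_mem
      · exact h.s_mem
    · rw [finrank_span_eq_card hrs, finrank_span_eq_card h.linearIndependent]
  have hzero (v) (hr : r v = 0) (hs : s v = 0) (hP : P v = 0) (hQ : Q v = 0) (hR : R v = 0) :
      v = 0 := by
    refine h.eq_zero v (fun j => ?_) hP hQ hR
    have hj : y j ∈ Submodule.span k (Set.range ![r, s]) := by
      rw [hspan]; exact Submodule.subset_span ⟨j, rfl⟩
    refine apply_eq_zero_of_mem_span hj fun i => ?_
    fin_cases i
    · exact hr
    · exact hs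
  have hP := h.rel_P
  have hQ := h.rel_Q
  have hR := h.rel_R
  obtain ⟨α, β, rfl⟩ : ∃ α β : k, β • s + α • r = t := by
    have := h.t_mem
    rw [← hspan, Matrix.range_cons, Matrix.range_cons, Matrix.range_empty, Set.union_empty,
      Set.singleton_union, Submodule.mem_span_pair] at this
    obtain ⟨α, β, h⟩ := this
    exact ⟨α, β, by rw [add_comm]; exact h⟩
  simp only [map_add, form_smul] at hP hR
  by_cases hα : α = 0
  · subst hα
    have hβ : β ≠ 0 := by
      rintro rfl
      exact h.t_ne (by simp)
    simp only [map_zero, zero_mul, add_zero] at hP hR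
    refine hX.exists_isScroll (ψ := ![β • (-Q - s), β • s, R, -P, r + P]) (fun v hv => ?_) ?_ ?_ ?_
    · have h0 := hv 0
      have h1 := hv 1
      have h2 := hv 2
      have h3 := hv 3
      have h4 := hv 4
      simp [hβ] at h0 h1 h2 h3 h4
      rw [h1, sub_zero, neg_eq_zero] at h0
      rw [h3, add_zero] at h4
      exact hzero v h4 h1 h3 h0 h2
    all_goals
      simp only [Matrix.cons_val, form_smul, map_add, map_sub, map_neg]
    · linear_combination -(algebraMap k (CoordRing X) β) * hR
    · linear_combination -(algebraMap k (CoordRing X) β) * hQ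
    · linear_combination hP
  · refine hX.exists_isScroll (ψ := ![β • (-Q - s) - α • P, β • s + α • (r + P), R - α • (r + P),
      -Q - s, s]) (fun v hv => ?_) ?_ ?_ ?_
    · have h0 := hv 0
      have h1 := hv 1
      have h2 := hv 2
      have h3 := hv 3
      have h4 := hv 4
      simp at h0 h1 h2 h3 h4
      have hQ0 : Q v = 0 := by rw [h4, sub_zero, neg_eq_zero] at h3; exact h3
      have hP0 : P v = 0 := by simpa [h4, hQ0, hα] using h0
      have hr0 : r v = 0 := by simpa [h4, hP0, hα] using h1
      have hR0 : R v = 0 := by simpa [hr0, hP0] using h2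
      exact hzero v hr0 h4 hP0 hQ0 hR0
    all_goals
      simp only [Matrix.cons_val, form_smul, map_add, map_sub, map_neg]
      generalize algebraMap k (CoordRing X) α = a at *
      generalize algebraMap k (CoordRing X) β = b at *
    · linear_combination -b * hR - a * hP + a * b * hQ
    · linear_combination a * hQ
    · linear_combination hR - a * hQ

theorem IsNormalForm.exists_isCubicCone (h : IsNormalForm X y P Q R r s t) (hX : IsCubicSurface X)
    {a b : k} (hs : s = a • r) (ht : t = b • r) : ∃ e, IsCubicCone e X := by
  have hdom := hX.isDomain
  have ha : a ≠ 0 := by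
    rintro rfl
    exact h.s_ne (by rw [hs, zero_smul])
  have hb : b ≠ 0 := by
    rintro rfl
    exact h.t_ne (by rw [ht, zero_smul])
  have ha' : algebraMap k (CoordRing X) a ≠ 0 := by simpa using ha
  have hb' : algebraMap k (CoordRing X) b ≠ 0 := by simpa using hb
  obtain ⟨Q, rfl⟩ : ∃ Q', a • Q' = Q := ⟨a⁻¹ • Q, smul_inv_smul₀ ha Q⟩
  obtain ⟨R, rfl⟩ : ∃ R', b • R' = R := ⟨b⁻¹ • R, smul_inv_smul₀ hb R⟩
  have hP := h.rel_P
  have hQ := h.rel_Q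
  have hR := h.rel_R
  rw [hs, ht] at hR
  rw [ht] at hP
  rw [hs] at hQ
  simp only [form_smul] at hP hQ hR
  replace hP : form X P * (form X R + form X r) = -form X r ^ 2 :=
    mul_left_cancel₀ hb' (by linear_combination hP)
  replace hQ : form X Q * (form X P + form X r) = -form X r ^ 2 :=
    mul_left_cancel₀ ha' (by linear_combination hQ)
  replace hR : form X R * (form X Q + form X r) = -form X r ^ 2 :=
    mul_left_cancel₀ (mul_ne_zero ha' hb') (by linear_combination hR)
  obtain ⟨w, hw⟩ : ∃ w : Module.Dual k (Fin 5 → k), ∀ v, r v = 0 → w v = 0 → ∀ j, y j v = 0 := by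
    have hr := h.r_mem
    have hr0 := h.r_ne
    have h2 : Set.range y = {y 0, y 1} := by
      ext u
      simp [Fin.exists_fin_two, eq_comm]
    rw [h2, Submodule.mem_span_pair] at hr
    obtain ⟨c, d, rfl⟩ := hr
    by_cases hc : c = 0
    · subst hc
      have hd : d ≠ 0 := by
        rintro rfl
        exact hr0 (by simp)
      refine ⟨y 0, fun v h0 h1 j => ?_⟩
      fin_cases j
      · exact h1
      · simpa [hd] using h0
    · refine ⟨y 1, fun v h0 h1 j => ?_⟩
      fin_cases j
      · simpa [hc, h1] using h0
      · exact h1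
  refine hX.exists_isCubicCone (ψ := ![-Q + P - r, -P, r + P, R - r - P, w]) (fun v hv => ?_) ?_ ?_ ?_
  · have h0 := hv 0
    have h1 := hv 1
    have h2 := hv 2
    have h3 := hv 3
    have h4 := hv 4
    simp at h0 h1 h2 h3 h4
    rw [h1, add_zero] at h2
    rw [h1, h2, sub_zero, sub_zero] at h3
    rw [h1, h2, add_zero, sub_zero, neg_eq_zero] at h0
    exact h.eq_zero v (hw v h2 h4) h1 (by simp [h0]) (by simp [h3])
  all_goals
    simp only [Matrix.cons_val, map_add, map_sub, map_neg]
  · linear_combination -hQ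
  · linear_combination hQ - hR + hP
  · linear_combination -hP

theorem IsNormalForm.exists_isScroll_or_isCubicCone (h : IsNormalForm X y P Q R r s t)
    (hX : IsCubicSurface X) : (∃ e, IsScroll e X) ∨ ∃ e, IsCubicCone e X := by
  by_cases hs : ∃ a : k, a • r = s
  · obtain ⟨a, hs⟩ := hs
    by_cases ht : ∃ b : k, b • r = t
    · obtain ⟨b, ht⟩ := ht
      exact Or.inr (h.exists_isCubicCone hX hs.symm ht.symm)
    · refine Or.inl (h.rotate.exists_isScroll hX ?_)
      rw [LinearIndependent.pair_symm_iff, LinearIndependent.pair_iff' h.r_ne]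
      exact fun b hb => ht ⟨b, hb⟩
  · refine Or.inl (h.exists_isScroll hX ?_)
    rw [LinearIndependent.pair_iff' h.r_ne]
    exact fun b hb => hs ⟨b, hb⟩

end Classification

section CubicSurfaces
variable {k : Type} [Field k] [IsAlgClosed k]

theorem exists_isCubicSurface_and_isSection {X : Set (PS k 5)} (hX : IsVariety X) (hnd : Nondeg X)
    (hdim : pdim X = 2) (hdeg : HasDegree X 2 3) :
    IsCubicSurface X ∧ ∃ y z e, IsSection X y z e := by
  have : Infinite k := IsAlgClosed.instInfinite
  obtain ⟨⟨L, ⟨W, hW, rfl⟩, -, hc⟩, hub⟩ := hdeg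
  obtain ⟨y, z, e, h⟩ := exists_isSection hW hc
  have htr : Algebra.trdeg k (CoordRing X) = (3 : ℕ) := by
    have hprime := isPrime_coneIdeal hX.2
    have hdom : IsDomain (CoordRing X) := Ideal.Quotient.isDomain _
    refine le_antisymm (trdeg_le_of_isAlgebraic (h.isAlgebraic hX.1)) ?_
    exact_mod_cast three_le_trdeg hX.1 hX.2 hdim.ge
  exact ⟨⟨hX.1, hX.2, hnd, htr, fun W hW hfin => hub ⟨_, ⟨W, hW, rfl⟩, hfin, rfl⟩⟩, y, z, e, h⟩

end CubicSurfaces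

end EL
open EL in
/-- An integral nondegenerate surface `X ⊂ ℙ^4` of minimal degree 3 with
only isolated singularities is of type A, and it is of type II (reducible general entry
locus) iff it is a cone. -/
theorem statement14 {k : Type} [Field k] [IsAlgClosed k] [CharZero k]
    (X : Set (PS k 5)) (hX : IsVariety X) (hnd : Nondeg X)
    (hdim : pdim X = 2) (hsing : IsolatedSings X 2) (hdeg : HasDegree X 2 3) :
    TypeA X ∧ (TypeII X ↔ ∃ v ∈ X, IsCone X v) := by
  obtain ⟨hcubic, y, z, e, hsec⟩ := exists_isCubicSurface_and_isSection hX hnd hdim hdeg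
  obtain ⟨P, Q, R, r, s, t, hnf⟩ := hsec.exists_isNormalForm hcubic
  rcases hnf.exists_isScroll_or_isCubicCone hcubic with ⟨e, he⟩ | ⟨e, he⟩
  · exact he.typeA_and_typeII_iff
  · exact he.typeA_and_typeII_iff hX.1
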